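/- arXiv:2211.11866 — 2 statements merged into one kernel-verified Lean document; each statement's English description precedes it below -/
import Mathlib

section
/- (Simple Harnack estimate, initially determined case.) Let T > 0 and let (𝓜, u) be a complete, initially determined conformal Ricci flow spacetime in the ambient space ℂ × (0,T). Fix t₀ ∈ (0,T) and let γ : [0,1] → ℂ be a C¹ map with γ′(s) ≠ 0 and (γ(s),t₀) ∈ 𝓜 for every s ∈ [0,1]. For t ∈ [t₀,T) set J_t := { s ∈ [0,1] : (γ(s),r) ∈ 𝓜 for all r ∈ [t₀,t] }. Then for every t ∈ [t₀,T), ∫_{J_t} √(u(γ(s),t))·|γ′(s)| ds ≤ √(t/t₀) · ∫_0^1 √(u(γ(s),t₀))·|γ′(s)| ds. -/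
open Set MeasureTheory Filter Metric

/-- The Euclidean Laplacian of `f : ℂ → ℝ` at `z`, i.e. `∂²f/∂x² + ∂²f/∂y²`. -/
noncomputable def lap (f : ℂ → ℝ) (z : ℂ) : ℝ :=
  iteratedFDeriv ℝ 2 f z ![1, 1] + iteratedFDeriv ℝ 2 f z ![Complex.I, Complex.I]

/-- The time-timeSlice of a spacetime `M ⊆ ℂ × ℝ` at time `t`. -/
def timeSlice (M : Set (ℂ × ℝ)) (t : ℝ) : Set ℂ := {z | (z, t) ∈ M}

/-- The conformal distance on `Ω` induced by a conformal factor `v`: the infimum of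
`v`-lengths of `C¹` paths in `Ω` joining `x` to `y`. -/
noncomputable def confDist (v : ℂ → ℝ) (Ω : Set ℂ) (x y : ℂ) : ℝ :=
  sInf {L : ℝ | ∃ γ : ℝ → ℂ, ContDiffOn ℝ 1 γ (Icc 0 1) ∧
    (∀ s ∈ Icc (0:ℝ) 1, γ s ∈ Ω) ∧ γ 0 = x ∧ γ 1 = y ∧
    L = ∫ s in (0:ℝ)..1, Real.sqrt (v (γ s)) * ‖derivWithin γ (Icc 0 1) s‖}

/-- The conformal ball of centre `p` and radius `ρ` in `Ω` for the metric `v|dz|²`. -/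
def confBall (v : ℂ → ℝ) (Ω : Set ℂ) (p : ℂ) (ρ : ℝ) : Set ℂ :=
  {z ∈ connectedComponentIn Ω p | confDist v Ω p z < ρ}

/-- The conformal metric `v|dz|²` is complete on `Ω`: every connected component of `Ω` is a
complete metric space with respect to the induced distance `confDist v Ω`. -/
def ConfComplete (v : ℂ → ℝ) (Ω : Set ℂ) : Prop :=
  ∀ x₀ ∈ Ω, ∀ x : ℕ → ℂ, (∀ n, x n ∈ connectedComponentIn Ω x₀) →
    (∀ ε : ℝ, 0 < ε → ∃ N : ℕ, ∀ m ≥ N, ∀ n ≥ N, confDist v Ω (x m) (x n) < ε) →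
    ∃ l ∈ connectedComponentIn Ω x₀,
      Tendsto (fun n => confDist v Ω (x n) l) atTop (nhds 0)

/-- A conformal Ricci flow spacetime in the ambient space `ℂ × (0,T)`:
`M` is a connected open subset of `ℂ × (0,T)` with non-empty time-slices, and `u` is a smooth
positive conformal factor on `M` solving the logarithmic fast diffusion equation
`∂u/∂t = Δ log u`. -/
structure ConfRFS (T : ℝ) (M : Set (ℂ × ℝ)) (u : ℂ → ℝ → ℝ) : Prop where
  sub : M ⊆ {p : ℂ × ℝ | p.2 ∈ Ioo 0 T}
  opn : IsOpen M
  conn : IsConnected M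
  nonempty : ∀ t ∈ Ioo (0:ℝ) T, (timeSlice M t).Nonempty
  pos : ∀ p ∈ M, 0 < u p.1 p.2
  smooth : ContDiffOn ℝ (⊤ : ℕ∞) (fun p : ℂ × ℝ => u p.1 p.2) M
  lfde : ∀ p ∈ M, deriv (u p.1) p.2 = lap (fun z => Real.log (u z p.2)) p.1

/-- A conformal Ricci flow spacetime is complete if the metric `u(·,t)|dz|²` is complete on the
timeSlice `M_t` for every `t ∈ (0,T)`. -/
def ConfRFSComplete (T : ℝ) (M : Set (ℂ × ℝ)) (u : ℂ → ℝ → ℝ) : Prop :=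
  ∀ t ∈ Ioo (0:ℝ) T, ConfComplete (fun z => u z t) (timeSlice M t)

/-- There is a time-preserving path in `M` from time `s` to the point `(z,t)`. -/
def TimePreservingFrom (M : Set (ℂ × ℝ)) (s : ℝ) (z : ℂ) (t : ℝ) : Prop :=
  ∃ γ : ℝ → ℂ, ContinuousOn γ (Icc s t) ∧ (∀ r ∈ Icc s t, (γ r, r) ∈ M) ∧ γ t = z

/-- The hindsight function of a spacetime `M`. -/
noncomputable def hindsight (M : Set (ℂ × ℝ)) (z : ℂ) (t : ℝ) : ℝ :=
  sInf {s : ℝ | 0 < s ∧ s ≤ t ∧ TimePreservingFrom M s z t}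

/-- A spacetime is initially determined if its hindsight function vanishes identically. -/
def InitiallyDetermined (M : Set (ℂ × ℝ)) : Prop :=
  ∀ p ∈ M, hindsight M p.1 p.2 = 0

/-- A spacetime in `ℂ × (0,T)` is expanding if worldlines persist until the final time. -/
def Expanding (T : ℝ) (M : Set (ℂ × ℝ)) : Prop :=
  ∀ (z : ℂ) (t t' : ℝ), (z, t) ∈ M → t ≤ t' → t' < T → (z, t') ∈ M

/-- An expanding spacetime is continuous if each timeSlice is the interior of the intersection of
all later slices. -/
def ContinuousSpacetime (T : ℝ) (M : Set (ℂ × ℝ)) : Prop :=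
  ∀ s ∈ Ioo (0:ℝ) T, timeSlice M s = interior (⋂ t ∈ Ioo s T, timeSlice M t)

/-- The vanishing time of the point `(z,t)`: the supremum of the connected component containing
`t` of the set of times at which `z` belongs to the spacetime. -/
noncomputable def vanishTime (M : Set (ℂ × ℝ)) (z : ℂ) (t : ℝ) : ℝ :=
  sSup (connectedComponentIn {r : ℝ | (z, r) ∈ M} t)

/-- `PolyReach v Ω x y r`: there is a polygonal chain in `Ω` from `x` to `y` whose `v`-length is
visibly at most `r`. -/
inductive PolyReach (v : ℂ → ℝ) (Ω : Set ℂ) (x : ℂ) : ℂ → ℝ → Prop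
  | refl : PolyReach v Ω x x 0
  | step {y z : ℂ} {r c : ℝ} : PolyReach v Ω x y r → segment ℝ y z ⊆ Ω →
      (∀ w ∈ segment ℝ y z, Real.sqrt (v w) ≤ c) → PolyReach v Ω x z (r + c * ‖z - y‖)

namespace PolyReach

variable {v : ℂ → ℝ} {Ω : Set ℂ} {x y z : ℂ} {r s c : ℝ}

lemma segment_const_nonneg (h : ∀ w ∈ segment ℝ y z, Real.sqrt (v w) ≤ c) : 0 ≤ c :=
  (Real.sqrt_nonneg _).trans (h y (left_mem_segment ℝ y z))

lemma single (h : segment ℝ y z ⊆ Ω) (hc : ∀ w ∈ segment ℝ y z, Real.sqrt (v w) ≤ c) :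
    PolyReach v Ω y z (c * ‖z - y‖) := by
  simpa using step refl h hc

lemma mem (hx : x ∈ Ω) (h : PolyReach v Ω x y r) : y ∈ Ω := by
  cases h with
  | refl => exact hx
  | step _ hs _ => exact hs (right_mem_segment ℝ _ _)

lemma trans (h : PolyReach v Ω x y r) (h' : PolyReach v Ω y z s) : PolyReach v Ω x z (r + s) := by
  induction h' with
  | refl => simpa using h
  | step _ hs hc ih =>
    rw [← add_assoc]
    exact step ih hs hc

lemma symm (h : PolyReach v Ω x y r) : PolyReach v Ω y x r := by
  induction h with
  | refl => exact refl
  | @step y z r c _ hs hc ih =>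
    rw [segment_symm] at hs hc
    have := (single hs hc).trans ih
    rwa [add_comm, norm_sub_rev] at this

lemma split (h : PolyReach v Ω x z r) (hs0 : 0 ≤ s) (hsr : s ≤ r) :
    ∃ m, PolyReach v Ω x m s ∧ PolyReach v Ω m z (r - s) := by
  induction h with
  | refl =>
    obtain rfl : s = 0 := le_antisymm hsr hs0
    exact ⟨x, refl, by simpa using refl⟩
  | @step y z r c hy hseg hc ih =>
    by_cases h1 : s ≤ r
    · obtain ⟨m, hm1, hm2⟩ := ih h1
      refine ⟨m, hm1, ?_⟩
      rw [add_sub_right_comm]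
      exact step hm2 hseg hc
    · push Not at h1
      have hcn : 0 < c * ‖z - y‖ := by linarith
      set q : ℝ := (s - r) / (c * ‖z - y‖) with hq
      have hq0 : 0 ≤ q := by apply div_nonneg <;> linarith
      have hq1 : q ≤ 1 := by rw [hq, div_le_one hcn]; linarith
      have hm : AffineMap.lineMap y z q ∈ segment ℝ y z := by
        rw [segment_eq_image_lineMap]
        exact ⟨q, ⟨hq0, hq1⟩, rfl⟩
      have hqe : q * (c * ‖z - y‖) = s - r := by rw [hq]; exact div_mul_cancel₀ _ hcn.ne'
      have s1 : segment ℝ y (AffineMap.lineMap y z q) ⊆ segment ℝ y z :=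
        (convex_segment y z).segment_subset (left_mem_segment ℝ y z) hm
      have s2 : segment ℝ (AffineMap.lineMap y z q) z ⊆ segment ℝ y z :=
        (convex_segment y z).segment_subset hm (right_mem_segment ℝ y z)
      refine ⟨AffineMap.lineMap y z q, ?_, ?_⟩
      · have := step hy (s1.trans hseg) fun w hw => hc w (s1 hw)
        convert this using 1
        rw [← dist_eq_norm, dist_lineMap_left, Real.norm_of_nonneg hq0, dist_comm, dist_eq_norm]
        linarith
      · have := single (s2.trans hseg) fun w hw => hc w (s2 hw)
        convert this using 1
        rw [← dist_eq_norm z (AffineMap.lineMap y z q), dist_comm, dist_lineMap_right,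
          Real.norm_of_nonneg (by linarith), dist_comm, dist_eq_norm]
        linarith

/-- Short chains stay close to their starting point. -/
lemma norm_sub_mul_le {c₀ δ : ℝ} (hc₀ : 0 < c₀)
    (hv : ∀ w ∈ closedBall x δ, c₀ ≤ Real.sqrt (v w))
    (h : PolyReach v Ω x y r) (hr : r < c₀ * δ) : ‖y - x‖ * c₀ ≤ r := by
  induction h with
  | refl => simp
  | @step y z r c hy hseg hc ih =>
    have hcn := segment_const_nonneg hc
    have hr' : r < c₀ * δ := lt_of_le_of_lt (le_add_of_nonneg_right (by positivity)) hr
    have h1 := ih hr'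
    have hmem : y ∈ closedBall x δ := by
      rw [mem_closedBall, dist_eq_norm]
      by_contra! hh
      nlinarith
    have h2 : c₀ ≤ c := (hv y hmem).trans (hc y (left_mem_segment ℝ y z))
    have h3 : ‖z - x‖ ≤ ‖z - y‖ + ‖y - x‖ := norm_sub_le_norm_sub_add_norm_sub z y x
    nlinarith [norm_nonneg (z - y)]

lemma eventually_reach (hΩ : IsOpen Ω) (hv : ContinuousOn v Ω) (hx : x ∈ Ω) {η : ℝ} (hη : 0 < η) :
    ∀ᶠ y in nhds x, ∃ s ≤ η, PolyReach v Ω x y s := by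
  have hc : ContinuousAt (fun w => Real.sqrt (v w)) x :=
    (hv.continuousAt (hΩ.mem_nhds hx)).sqrt
  have h1 : ∀ᶠ w in nhds x, Real.sqrt (v w) < Real.sqrt (v x) + 1 :=
    hc.eventually_lt continuousAt_const (by linarith)
  obtain ⟨δ, hδ, hball⟩ := Metric.eventually_nhds_iff_ball.1 (h1.and (hΩ.mem_nhds hx))
  set c := Real.sqrt (v x) + 1
  have hcp : 0 < c := by positivity
  filter_upwards [Metric.ball_mem_nhds x hδ, Metric.ball_mem_nhds x (div_pos hη hcp)] with y hy1 hy2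
  have hs : segment ℝ x y ⊆ ball x δ :=
    (convex_ball x δ).segment_subset (mem_ball_self hδ) hy1
  refine ⟨c * ‖y - x‖, ?_, single (fun w hw => (hball w (hs hw)).2)
    fun w hw => (hball w (hs hw)).1.le⟩
  rw [mem_ball, dist_eq_norm, lt_div_iff₀ hcp] at hy2
  linarith

lemma mem_connectedComponentIn (hx : x ∈ Ω) (h : PolyReach v Ω x y r) :
    y ∈ connectedComponentIn Ω x := by
  induction h with
  | refl => exact _root_.mem_connectedComponentIn hx
  | @step y z r c hy hseg hc ih =>
    rw [connectedComponentIn_eq ih]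
    exact (convex_segment y z).isPreconnected.subset_connectedComponentIn
      (left_mem_segment ℝ y z) hseg (right_mem_segment ℝ y z)

lemma exists_of_mem_connectedComponentIn (hΩ : IsOpen Ω) (hv : ContinuousOn v Ω) (hx : x ∈ Ω)
    (hy : y ∈ connectedComponentIn Ω x) : ∃ r, PolyReach v Ω x y r := by
  have key : connectedComponentIn Ω x ⊆ {z | z ∈ Ω ∧ ∃ r, PolyReach v Ω x z r} := by
    apply isPreconnected_connectedComponentIn.subset_of_closure_inter_subset
    · rw [isOpen_iff_mem_nhds]
      rintro z ⟨hz, r, hr⟩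
      filter_upwards [eventually_reach hΩ hv hz one_pos, hΩ.mem_nhds hz] with w ⟨s, _, hs⟩ hw
      exact ⟨hw, _, hr.trans hs⟩
    · exact ⟨x, _root_.mem_connectedComponentIn hx, hx, 0, refl⟩
    · rintro z ⟨hz, hzc⟩
      have hzΩ := connectedComponentIn_subset _ _ hzc
      refine ⟨hzΩ, ?_⟩
      obtain ⟨w, ⟨s, _, hs⟩, _, r, hr⟩ :=
        (mem_closure_iff_nhds.1 hz) _ (eventually_reach hΩ hv hzΩ one_pos)
      exact ⟨_, hr.trans hs.symm⟩
  exact (key hy).2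

/-- A polygonal chain can be traversed by a globally `C¹` path which is constant near its ends. -/
lemma exists_path (hx : x ∈ Ω) (hv : ContinuousOn v Ω) (h : PolyReach v Ω x y r) :
    ∃ σ : ℝ → ℂ, ContDiff ℝ 1 σ ∧ (∀ s ≤ 0, σ s = x) ∧ (∀ s, 1 ≤ s → σ s = y) ∧ (∀ s, σ s ∈ Ω) ∧
      ∫ s in (0:ℝ)..1, Real.sqrt (v (σ s)) * ‖deriv σ s‖ ≤ r := by
  induction h with
  | refl => exact ⟨fun _ => x, contDiff_const, by simp, by simp, by simpa using hx, by simp⟩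
  | @step y z r c hy hseg hc ih =>
    obtain ⟨σ, hσ, h0, h1, hσΩ, hlen⟩ := ih
    set τ : ℝ → ℂ := fun s => y + (Real.smoothTransition s : ℂ) * (z - y) with hτ
    have hcn := segment_const_nonneg hc
    have hst : ContDiff ℝ 1 Real.smoothTransition := Real.smoothTransition.contDiff
    have hτc : ContDiff ℝ 1 τ := by
      have : ContDiff ℝ 1 fun s => (Real.smoothTransition s : ℂ) :=
        Complex.ofRealCLM.contDiff.comp hst
      exact contDiff_const.add (this.mul contDiff_const)
    have hτseg : ∀ s, τ s ∈ segment ℝ y z := by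
      intro s
      rw [segment_eq_image']
      exact ⟨_, ⟨Real.smoothTransition.nonneg s, Real.smoothTransition.le_one s⟩, by simp [hτ]⟩
    have hτ0 : ∀ s ≤ 0, τ s = y := fun s hs => by
      simp [hτ, Real.smoothTransition.zero_of_nonpos hs]
    have hτ1 : ∀ s, 1 ≤ s → τ s = z := fun s hs => by
      simp [hτ, Real.smoothTransition.one_of_one_le hs]
    have hτd : ∀ s, ‖deriv τ s‖ = deriv Real.smoothTransition s * ‖z - y‖ := by
      intro s
      have hd : HasDerivAt Real.smoothTransition (deriv Real.smoothTransition s) s :=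
        (hst.differentiable one_ne_zero s).hasDerivAt
      have := ((hd.ofReal_comp).mul_const (z - y)).const_add y
      rw [this.deriv, norm_mul, Complex.norm_real,
        Real.norm_of_nonneg (Real.smoothTransition.monotone.deriv_nonneg)]
    have hlenτ : ∫ s in (0:ℝ)..1, Real.sqrt (v (τ s)) * ‖deriv τ s‖ ≤ c * ‖z - y‖ := by
      have hcd : Continuous (deriv Real.smoothTransition) := hst.continuous_deriv le_rfl
      have e1 : ∫ s in (0:ℝ)..1, c * (deriv Real.smoothTransition s * ‖z - y‖) = c * ‖z - y‖ := by
        rw [intervalIntegral.integral_const_mul, intervalIntegral.integral_mul_const,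
          intervalIntegral.integral_deriv_eq_sub (fun s _ => hst.differentiable one_ne_zero s)
            (hcd.intervalIntegrable _ _)]
        simp
      rw [← e1]
      apply intervalIntegral.integral_mono_on zero_le_one
      · apply Continuous.intervalIntegrable
        exact ((hv.comp_continuous hτc.continuous fun s => hseg (hτseg s)).sqrt).mul
          (hτc.continuous_deriv le_rfl).norm
      · exact (continuous_const.mul (hcd.mul continuous_const)).intervalIntegrable _ _
      · intro s _
        rw [hτd]
        exact mul_le_mul_of_nonneg_right (hc _ (hτseg s))
          (mul_nonneg Real.smoothTransition.monotone.deriv_nonneg (norm_nonneg _))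
    set ω : ℝ → ℂ := fun s => σ (2 * s) + τ (2 * s - 1) - y with hω
    have hωl : ∀ s ≤ 1 / 2, ω s = σ (2 * s) := fun s hs => by
      simp [hω, hτ0 (2 * s - 1) (by linarith)]
    have hωr : ∀ s, 1 / 2 ≤ s → ω s = τ (2 * s - 1) := fun s hs => by
      simp [hω, h1 (2 * s) (by linarith)]
    have hωc : ContDiff ℝ 1 ω :=
      ((hσ.comp (contDiff_const.mul contDiff_id)).add
        (hτc.comp ((contDiff_const.mul contDiff_id).sub contDiff_const))).sub contDiff_const
    have hωΩ : ∀ s, ω s ∈ Ω := by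
      intro s
      rcases le_total s (1 / 2) with hs | hs
      · rw [hωl s hs]; exact hσΩ _
      · rw [hωr s hs]; exact hseg (hτseg _)
    refine ⟨ω, hωc, fun s hs => ?_, fun s hs => ?_, hωΩ, ?_⟩
    · rw [hωl s (by linarith)]; exact h0 _ (by linarith)
    · rw [hωr s (by linarith)]; exact hτ1 _ (by linarith)
    · have hσd : ∀ s < (1:ℝ) / 2, deriv ω s = (2:ℝ) • deriv σ (2 * s) := by
        intro s hs
        have : ω =ᶠ[nhds s] fun s => σ (2 * s) := by
          filter_upwards [Iio_mem_nhds hs] with q hq using hωl q (le_of_lt hq)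
        rw [this.deriv_eq]
        exact deriv_comp_mul_left 2 σ s
      have hτd' : ∀ s > (1:ℝ) / 2, deriv ω s = (2:ℝ) • deriv τ (2 * s - 1) := by
        intro s hs
        have : ω =ᶠ[nhds s] fun s => τ (2 * s - 1) := by
          filter_upwards [Ioi_mem_nhds hs] with q hq using hωr q (le_of_lt hq)
        rw [this.deriv_eq]
        have hd := (hτc.differentiable one_ne_zero (2 * s - 1)).hasDerivAt
        have hl : HasDerivAt (fun s : ℝ => 2 * s - 1) 2 s := by
          simpa using ((hasDerivAt_id s).const_mul 2).sub_const 1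
        exact (hd.scomp s hl).deriv
      have hint : ∀ a b, IntervalIntegrable (fun s => Real.sqrt (v (ω s)) * ‖deriv ω s‖)
          volume a b := fun a b => by
        apply Continuous.intervalIntegrable
        exact ((hv.comp_continuous hωc.continuous hωΩ).sqrt).mul (hωc.continuous_deriv le_rfl).norm
      rw [← intervalIntegral.integral_add_adjacent_intervals (hint 0 (1 / 2)) (hint (1 / 2) 1)]
      have i1 : ∫ s in (0:ℝ)..(1/2), Real.sqrt (v (ω s)) * ‖deriv ω s‖
          = ∫ s in (0:ℝ)..1, Real.sqrt (v (σ s)) * ‖deriv σ s‖ := by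
        have := intervalIntegral.smul_integral_comp_mul_left
          (f := fun s => Real.sqrt (v (σ s)) * ‖deriv σ s‖) (a := 0) (b := 1 / 2) (2:ℝ)
        norm_num at this
        rw [← this, ← intervalIntegral.integral_const_mul]
        apply intervalIntegral.integral_congr_uIoo
        intro s hs
        rw [uIoo_of_le (by norm_num)] at hs
        simp only
        rw [hωl s hs.2.le, hσd s hs.2, norm_smul]
        norm_num
        ring
      have i2 : ∫ s in (1/2:ℝ)..1, Real.sqrt (v (ω s)) * ‖deriv ω s‖
          = ∫ s in (0:ℝ)..1, Real.sqrt (v (τ s)) * ‖deriv τ s‖ := by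
        have := intervalIntegral.smul_integral_comp_mul_sub
          (f := fun s => Real.sqrt (v (τ s)) * ‖deriv τ s‖) (a := 1 / 2) (b := 1) (2:ℝ) 1
        norm_num at this
        rw [← this, ← intervalIntegral.integral_const_mul]
        apply intervalIntegral.integral_congr_uIoo
        intro s hs
        rw [uIoo_of_le (by norm_num)] at hs
        simp only
        rw [hωr s hs.1.le, hτd' s hs.1, norm_smul]
        norm_num
        ring
      rw [i1, i2]
      exact add_le_add hlen hlenτ

lemma confDist_le (hx : x ∈ Ω) (hv : ContinuousOn v Ω) (h : PolyReach v Ω x y r) :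
    (∃ γ : ℝ → ℂ, ContDiffOn ℝ 1 γ (Icc 0 1) ∧
      (∀ s ∈ Icc (0:ℝ) 1, γ s ∈ Ω) ∧ γ 0 = x ∧ γ 1 = y) ∧ confDist v Ω x y ≤ r := by
  obtain ⟨σ, hσ, h0, h1, hσΩ, hlen⟩ := h.exists_path hx hv
  refine ⟨⟨σ, hσ.contDiffOn, fun s _ => hσΩ s, h0 0 le_rfl, h1 1 le_rfl⟩, ?_⟩
  refine le_trans (csInf_le (a := ∫ s in (0:ℝ)..1, Real.sqrt (v (σ s)) *
    ‖derivWithin σ (Icc 0 1) s‖) ⟨0, ?_⟩ ⟨σ, hσ.contDiffOn, fun s _ => hσΩ s, h0 0 le_rfl,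
      h1 1 le_rfl, rfl⟩) (le_trans (le_of_eq ?_) hlen)
  · rintro L ⟨γ, _, _, _, _, rfl⟩
    exact intervalIntegral.integral_nonneg zero_le_one fun s _ => by positivity
  · apply intervalIntegral.integral_congr
    intro s hs
    rw [uIcc_of_le zero_le_one] at hs
    simp only
    rw [(hσ.differentiable one_ne_zero s).derivWithin (uniqueDiffOn_Icc zero_lt_one s hs)]

end PolyReach

lemma norm_sub_lt_of_confDist_lt {v : ℂ → ℝ} {Ω : Set ℂ} {x l : ℂ} {c₀ δ : ℝ}
    (hv : ContinuousOn v Ω) (hc₀ : 0 < c₀)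
    (hb : ∀ w ∈ ball l δ, c₀ ≤ Real.sqrt (v w))
    (hne : ∃ γ : ℝ → ℂ, ContDiffOn ℝ 1 γ (Icc 0 1) ∧
      (∀ s ∈ Icc (0:ℝ) 1, γ s ∈ Ω) ∧ γ 0 = x ∧ γ 1 = l)
    (h : confDist v Ω x l < c₀ * δ) : ‖x - l‖ < δ := by
  obtain ⟨γ₀, h1, h2, h3, h4⟩ := hne
  rw [confDist] at h
  obtain ⟨L, ⟨γ, hγ, hγΩ, rfl, rfl, rfl⟩, hL⟩ :=
    exists_lt_of_csInf_lt (by exact ⟨_, γ₀, h1, h2, h3, h4, rfl⟩) h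
  by_contra! hcon
  have hnc : ContinuousOn (fun s => ‖γ s - γ 1‖) (Icc 0 1) :=
    (hγ.continuousOn.sub continuousOn_const).norm
  have hcomp : IsCompact (Icc (0:ℝ) 1 ∩ (fun s => ‖γ s - γ 1‖) ⁻¹' Ici δ) :=
    isCompact_Icc.of_isClosed_subset
      (hnc.preimage_isClosed_of_isClosed isClosed_Icc isClosed_Ici) inter_subset_left
  obtain ⟨s₁, ⟨hs₁, hs₁'⟩, hmax⟩ := hcomp.exists_isGreatest ⟨0, by simp, hcon⟩
  have hd : ContinuousOn (derivWithin γ (Icc 0 1)) (Icc 0 1) :=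
    hγ.continuousOn_derivWithin (uniqueDiffOn_Icc zero_lt_one) le_rfl
  have hf : ContinuousOn (fun s => Real.sqrt (v (γ s)) * ‖derivWithin γ (Icc 0 1) s‖) (Icc 0 1) :=
    ((hv.comp hγ.continuousOn hγΩ).sqrt).mul hd.norm
  have hsub : Icc s₁ 1 ⊆ Icc (0:ℝ) 1 := Icc_subset_Icc_left hs₁.1
  have hft : ∫ s in s₁..1, derivWithin γ (Icc 0 1) s = γ 1 - γ s₁ := by
    apply intervalIntegral.integral_eq_sub_of_hasDerivAt_of_le hs₁.2 (hγ.continuousOn.mono hsub)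
    · intro s hs
      have hs' : s ∈ Ioo (0:ℝ) 1 := ⟨hs₁.1.trans_lt hs.1, hs.2⟩
      exact ((hγ.differentiableOn one_ne_zero s ⟨hs'.1.le, hs'.2.le⟩).hasDerivWithinAt).hasDerivAt
        (Icc_mem_nhds hs'.1 hs'.2)
    · exact (hd.mono hsub).intervalIntegrable_of_Icc hs₁.2
  have i1 : δ ≤ ∫ s in s₁..1, ‖derivWithin γ (Icc 0 1) s‖ := by
    have := intervalIntegral.norm_integral_le_integral_norm (μ := volume)
      (f := derivWithin γ (Icc 0 1)) hs₁.2
    rw [hft, norm_sub_rev] at this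
    exact le_trans hs₁' this
  have i2 : c₀ * ∫ s in s₁..1, ‖derivWithin γ (Icc 0 1) s‖ ≤
      ∫ s in s₁..1, Real.sqrt (v (γ s)) * ‖derivWithin γ (Icc 0 1) s‖ := by
    rw [← intervalIntegral.integral_const_mul]
    apply intervalIntegral.integral_mono_on_of_le_Ioo hs₁.2
    · exact ((continuousOn_const.mul hd.norm).mono hsub).intervalIntegrable_of_Icc hs₁.2
    · exact (hf.mono hsub).intervalIntegrable_of_Icc hs₁.2
    · intro s hs
      refine mul_le_mul_of_nonneg_right (hb _ ?_) (norm_nonneg _)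
      rw [mem_ball, dist_eq_norm]
      by_contra! hh
      exact absurd (hmax ⟨⟨hs₁.1.trans hs.1.le, hs.2.le⟩, hh⟩) (not_le.2 hs.1)
  have i3 : ∫ s in s₁..1, Real.sqrt (v (γ s)) * ‖derivWithin γ (Icc 0 1) s‖ ≤
      ∫ s in (0:ℝ)..1, Real.sqrt (v (γ s)) * ‖derivWithin γ (Icc 0 1) s‖ := by
    apply intervalIntegral.integral_mono_interval hs₁.1 hs₁.2 le_rfl
    · exact Eventually.of_forall fun s => by positivity
    · exact hf.intervalIntegrable_of_Icc zero_le_one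
  nlinarith

/-- The points at chain distance less than `r` from `x` lie in a compact subset of `Ω`. -/
def Confined (v : ℂ → ℝ) (Ω : Set ℂ) (x : ℂ) (r : ℝ) : Prop :=
  ∃ K, IsCompact K ∧ K ⊆ Ω ∧ ∀ z s, s < r → PolyReach v Ω x z s → z ∈ K

namespace Confined

variable {v : ℂ → ℝ} {Ω : Set ℂ} {x y : ℂ} {r s : ℝ}

lemma mono (h : Confined v Ω x r) (hsr : s ≤ r) : Confined v Ω x s := by
  obtain ⟨K, hK, hKΩ, h⟩ := h
  exact ⟨K, hK, hKΩ, fun z t ht hz => h z t (ht.trans_le hsr) hz⟩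

lemma exists_reach_of_not (hΩ : IsOpen Ω) (hv : ContinuousOn v Ω) {A : ℝ}
    (hA : 0 < A) (h : ¬ Confined v Ω x A) :
    ∃ q s, s ≤ A ∧ PolyReach v Ω x q s ∧ ¬ Confined v Ω q (3 / 4 * A) := by
  by_cases hh : Confined v Ω x (A / 2)
  swap
  · exact ⟨x, 0, hA.le, .refl, fun hc => hh (hc.mono (by linarith))⟩
  by_contra! hall
  apply h
  obtain ⟨K, hK, hKΩ, hKr⟩ := hh
  set Z := closure {z | ∃ s < A / 2, PolyReach v Ω x z s} with hZ
  have hZK : Z ⊆ K := closure_minimal (fun z ⟨s, hs, hz⟩ => hKr z s hs hz) hK.isClosed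
  have hZc : IsCompact Z := hK.of_isClosed_subset isClosed_closure hZK
  have key : ∃ K', IsCompact K' ∧ K' ⊆ Ω ∧ ∀ m ∈ Z, ∀ z, PolyReach v Ω m z (A / 2) → z ∈ K' := by
    refine hZc.induction_on
      (p := fun s => ∃ K', IsCompact K' ∧ K' ⊆ Ω ∧
        ∀ m ∈ s, ∀ z, PolyReach v Ω m z (A / 2) → z ∈ K') ?_ ?_ ?_ ?_
    · exact ⟨∅, isCompact_empty, empty_subset _, by simp⟩
    · rintro s t hst ⟨K', h1, h2, h3⟩
      exact ⟨K', h1, h2, fun m hm => h3 m (hst hm)⟩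
    · rintro s t ⟨K', h1, h2, h3⟩ ⟨K'', h1', h2', h3'⟩
      refine ⟨K' ∪ K'', h1.union h1', union_subset h2 h2', ?_⟩
      rintro m (hm | hm) z hz
      · exact Or.inl (h3 m hm z hz)
      · exact Or.inr (h3' m hm z hz)
    · intro q hq
      have hqΩ : q ∈ Ω := hKΩ (hZK hq)
      have hev := PolyReach.eventually_reach hΩ hv hqΩ (show 0 < A / 8 by linarith)
      obtain ⟨z, ⟨s, hs, hqz⟩, s', hs', hxz⟩ := (mem_closure_iff_nhds.1 hq) _ hev
      obtain ⟨K', h1, h2, h3⟩ := hall q (s' + s) (by linarith) (hxz.trans hqz.symm)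
      refine ⟨_, mem_nhdsWithin_of_mem_nhds hev, K', h1, h2, ?_⟩
      rintro m ⟨s, hs, hm⟩ z hz
      exact h3 z (s + A / 2) (by linarith) (hm.trans hz)
  obtain ⟨K', h1, h2, h3⟩ := key
  refine ⟨K ∪ K', hK.union h1, union_subset hKΩ h2, fun z s hs hz => ?_⟩
  by_cases hsA : s < A / 2
  · exact Or.inl (hKr z s hsA hz)
  · obtain ⟨m, hm, hm'⟩ := hz.split (s := s - A / 2) (by linarith) (by linarith)
    refine Or.inr (h3 m (subset_closure ⟨_, by linarith, hm⟩) z ?_)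
    simpa using hm'

lemma eventually_confined (hΩ : IsOpen Ω) (hv : ContinuousOn v Ω) (hpos : ∀ x ∈ Ω, 0 < v x)
    (hx : x ∈ Ω) : ∃ r > 0, ∀ᶠ y in nhds x, Confined v Ω y r := by
  have hc : ContinuousAt (fun w => Real.sqrt (v w)) x :=
    (hv.continuousAt (hΩ.mem_nhds hx)).sqrt
  set c := Real.sqrt (v x) / 2 with hcd
  have hcp : 0 < Real.sqrt (v x) := Real.sqrt_pos.2 (hpos x hx)
  have h1 : ∀ᶠ w in nhds x, c < Real.sqrt (v w) :=
    continuousAt_const.eventually_lt hc (by rw [hcd]; linarith)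
  obtain ⟨δ, hδ, hball⟩ := Metric.eventually_nhds_iff_ball.1 (h1.and (hΩ.mem_nhds hx))
  have hc0 : 0 < c := by positivity
  refine ⟨c * (δ / 4), by positivity, ?_⟩
  filter_upwards [ball_mem_nhds x (show 0 < δ / 4 by linarith)] with y hy
  have hsub : closedBall x (δ / 2) ⊆ ball x δ := closedBall_subset_ball (by linarith)
  refine ⟨closedBall x (δ / 2), isCompact_closedBall _ _, fun w hw => (hball w (hsub hw)).2,
    fun z s hs hz => ?_⟩
  have h2 : ∀ w ∈ closedBall y (δ / 4), c ≤ Real.sqrt (v w) := fun w hw => by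
    refine (hball w ?_).1.le
    have := dist_triangle w y x
    rw [mem_closedBall] at hw
    rw [mem_ball] at hy ⊢
    linarith
  have h3 := hz.norm_sub_mul_le hc0 h2 hs
  have h4 : ‖z - y‖ ≤ δ / 4 := by
    by_contra! hh
    nlinarith
  rw [← dist_eq_norm] at h4
  have := dist_triangle z y x
  rw [mem_ball] at hy
  rw [mem_closedBall]
  linarith

/-- Hopf–Rinow: bounded sets of a complete conformal metric are relatively compact. -/
theorem of_complete (hΩ : IsOpen Ω) (hv : ContinuousOn v Ω) (hpos : ∀ x ∈ Ω, 0 < v x)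
    (hcomp : ConfComplete v Ω) (hx : x ∈ Ω) (A : ℝ) : Confined v Ω x A := by
  by_contra hA₀
  have hA : ¬ Confined v Ω x (max A 1) := fun h => hA₀ (h.mono (le_max_left _ _))
  let X := {p : ℂ × ℝ // 0 < p.2 ∧ ¬ Confined v Ω p.1 p.2}
  have hnext : ∀ p : X, ∃ q : X, q.1.2 = 3 / 4 * p.1.2 ∧
      ∃ s ≤ p.1.2, PolyReach v Ω p.1.1 q.1.1 s := by
    rintro ⟨⟨p, a⟩, ha, hp⟩
    obtain ⟨q, s, hs, hpq, hq⟩ := exists_reach_of_not hΩ hv ha hp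
    exact ⟨⟨⟨q, 3 / 4 * a⟩, by simpa using ha, hq⟩, rfl, s, hs, hpq⟩
  choose next hn1 hn2 using hnext
  let p : ℕ → X := fun n => next^[n] ⟨⟨x, max A 1⟩, by simp, hA⟩
  have hps : ∀ n, p (n + 1) = next (p n) := fun n => Function.iterate_succ_apply' _ _ _
  have ha : ∀ n, (p n).1.2 = (3 / 4) ^ n * max A 1 := by
    intro n
    induction n with
    | zero => simp [p]
    | succ n ih => rw [hps, hn1, ih, pow_succ]; ring
  have hreach : ∀ m n, m ≤ n → ∃ s ≤ 4 * ((p m).1.2 - (p n).1.2),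
      PolyReach v Ω (p m).1.1 (p n).1.1 s := by
    intro m n hmn
    induction n, hmn using Nat.le_induction with
    | base => exact ⟨0, by simp, .refl⟩
    | succ n hmn ih =>
      obtain ⟨s, hs, h⟩ := ih
      obtain ⟨s', hs', h'⟩ := hn2 (p n)
      have := hn1 (p n)
      rw [hps]
      exact ⟨s + s', by linarith, h.trans h'⟩
  have hx0 : (p 0).1.1 = x := rfl
  have hr0 : ∀ n, ∃ s, PolyReach v Ω x (p n).1.1 s := fun n => by
    obtain ⟨s, _, h⟩ := hreach 0 n (Nat.zero_le _)
    exact ⟨s, h⟩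
  have hΩn : ∀ n, (p n).1.1 ∈ Ω := fun n => by
    obtain ⟨s, h⟩ := hr0 n
    exact h.mem hx
  have hlim : Tendsto (fun n => (p n).1.2) atTop (nhds 0) := by
    simp_rw [ha]
    simpa using (tendsto_pow_atTop_nhds_zero_of_lt_one (by norm_num : (0:ℝ) ≤ 3 / 4)
      (by norm_num)).mul_const (max A 1)
  obtain ⟨l, hl, hlt⟩ := hcomp x hx (fun n => (p n).1.1)
    (fun n => by
      obtain ⟨s, h⟩ := hr0 n
      exact h.mem_connectedComponentIn hx)
    (by
      intro ε hε
      obtain ⟨N, hN⟩ := eventually_atTop.1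
        (hlim.eventually_lt_const (show (0:ℝ) < ε / 4 by linarith))
      refine ⟨N, fun m hm n hn => ?_⟩
      rcases le_total m n with hmn | hmn
      · obtain ⟨s, hs, h⟩ := hreach m n hmn
        have := (h.confDist_le (hΩn m) hv).2
        have h1 := hN m hm
        have h2 := (p n).2.1
        linarith
      · obtain ⟨s, hs, h⟩ := hreach n m hmn
        have := (h.symm.confDist_le (hΩn m) hv).2
        have h1 := hN n hn
        have h2 := (p m).2.1
        linarith)
  have hlΩ : l ∈ Ω := connectedComponentIn_subset _ _ hl
  obtain ⟨rl, hrl⟩ := PolyReach.exists_of_mem_connectedComponentIn hΩ hv hx hl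
  have hconv : Tendsto (fun n => (p n).1.1) atTop (nhds l) := by
    have hc : ContinuousAt (fun w => Real.sqrt (v w)) l :=
      (hv.continuousAt (hΩ.mem_nhds hlΩ)).sqrt
    have hcp : 0 < Real.sqrt (v l) := Real.sqrt_pos.2 (hpos l hlΩ)
    have h1 : ∀ᶠ w in nhds l, Real.sqrt (v l) / 2 < Real.sqrt (v w) :=
      continuousAt_const.eventually_lt hc (by linarith)
    obtain ⟨δ, hδ, hball⟩ := Metric.eventually_nhds_iff_ball.1 h1
    rw [Metric.tendsto_atTop]
    intro ε hε
    have hm : 0 < min δ ε := lt_min hδ hε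
    obtain ⟨N, hN⟩ := eventually_atTop.1
      (hlt.eventually_lt_const (show (0:ℝ) < Real.sqrt (v l) / 2 * min δ ε by positivity))
    refine ⟨N, fun n hn => ?_⟩
    rw [dist_eq_norm]
    obtain ⟨s, hs⟩ := hr0 n
    exact (norm_sub_lt_of_confDist_lt hv (by positivity)
      (fun w hw => (hball w (ball_subset_ball (min_le_left _ _) hw)).le)
      ((hs.symm.trans hrl).confDist_le (hΩn n) hv).1 (hN n hn)).trans_le (min_le_right _ _)
  obtain ⟨r, hr, hev⟩ := eventually_confined hΩ hv hpos hlΩ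
  obtain ⟨n, hn1, hn2⟩ := ((hconv.eventually hev).and (hlim.eventually_lt_const hr)).exists
  exact (p n).2.2 (hn1.mono hn2.le)

end Confined

/-- Confinement is uniform in time along a continuous world-line. -/
theorem exists_compact_spacetime {M : Set (ℂ × ℝ)} (hM : IsOpen M) {U : ℂ × ℝ → ℝ}
    (hU : ContinuousOn U M) (hpos : ∀ p ∈ M, 0 < U p) {a b : ℝ} {x₀ : ℝ → ℂ}
    (hx₀ : ContinuousOn x₀ (Icc a b)) (hx₀M : ∀ t ∈ Icc a b, (x₀ t, t) ∈ M)
    (hconf : ∀ t ∈ Icc a b, ∀ A, Confined (fun z => U (z, t)) (timeSlice M t) (x₀ t) A) (A : ℝ) :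
    ∃ K, IsCompact K ∧ K ⊆ M ∧ ∀ t ∈ Icc a b, ∀ z r, r ≤ A →
      PolyReach (fun z => U (z, t)) (timeSlice M t) (x₀ t) z r → (z, t) ∈ K := by
  refine (isCompact_Icc (a := a) (b := b)).induction_on
    (p := fun s => ∃ K, IsCompact K ∧ K ⊆ M ∧ ∀ t ∈ s, ∀ z r, r ≤ A →
      PolyReach (fun z => U (z, t)) (timeSlice M t) (x₀ t) z r → (z, t) ∈ K) ?_ ?_ ?_ ?_
  · exact ⟨∅, isCompact_empty, empty_subset _, by simp⟩
  · rintro s t hst ⟨K', h1, h2, h3⟩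
    exact ⟨K', h1, h2, fun m hm => h3 m (hst hm)⟩
  · rintro s t ⟨K', h1, h2, h3⟩ ⟨K'', h1', h2', h3'⟩
    refine ⟨K' ∪ K'', h1.union h1', union_subset h2 h2', ?_⟩
    rintro m (hm | hm) z r hr hz
    · exact Or.inl (h3 m hm z r hr hz)
    · exact Or.inr (h3' m hm z r hr hz)
  intro t₁ ht₁
  have hslice : ∀ t, IsOpen (timeSlice M t) := fun t =>
    hM.preimage (Continuous.prodMk_left t)
  have hUs : ∀ t, ContinuousOn (fun z => U (z, t)) (timeSlice M t) := fun t =>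
    hU.comp (Continuous.prodMk_left t).continuousOn fun z hz => hz
  obtain ⟨K, hK, hKΩ, hKr⟩ := hconf t₁ ht₁ (2 * A + 2)
  set N : Set (ℂ × ℝ) := M ∩ {p | (p.1, t₁) ∈ M} with hN
  have hNo : IsOpen N := hM.inter (hM.preimage (by fun_prop))
  set O : Set (ℂ × ℝ) := N ∩ {p | U (p.1, t₁) < 4 * U p} with hO
  have hOo : IsOpen O := by
    have h1 : ContinuousOn (fun p : ℂ × ℝ => 4 * U p - U (p.1, t₁)) N :=
      (continuousOn_const.mul (hU.mono inter_subset_left)).sub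
        (hU.comp (f := fun p : ℂ × ℝ => (p.1, t₁)) (by fun_prop) fun p hp => hp.2)
    have := h1.isOpen_inter_preimage hNo isOpen_Ioi (t := Ioi 0)
    convert this using 2
    ext p
    simp
  obtain ⟨V, W, hVo, hWo, hKV, htW, hVW⟩ := generalized_tube_lemma hK
    (isCompact_singleton (x := t₁)) hOo (by
      rintro ⟨z, t⟩ ⟨hz, ht⟩
      obtain rfl : t = t₁ := ht
      have h0 : (z, t) ∈ M := hKΩ hz
      exact ⟨⟨h0, h0⟩, by have := hpos _ h0; simp only [mem_ofPred_eq]; linarith⟩)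
  obtain ⟨τ, hτ, hτW⟩ := Metric.nhds_basis_closedBall.mem_iff.1
    (hWo.mem_nhds (htW (mem_singleton t₁)))
  have hbase : ∀ᶠ t in nhdsWithin t₁ (Icc a b), ∃ s ≤ 1,
      PolyReach (fun z => U (z, t₁)) (timeSlice M t₁) (x₀ t₁) (x₀ t) s :=
    (hx₀ t₁ ht₁).eventually (PolyReach.eventually_reach (hslice t₁) (hUs t₁) (hx₀M t₁ ht₁) one_pos)
  refine ⟨{t | t ∈ closedBall t₁ τ ∧ ∃ s ≤ 1,
      PolyReach (fun z => U (z, t₁)) (timeSlice M t₁) (x₀ t₁) (x₀ t) s},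
    inter_mem (mem_nhdsWithin_of_mem_nhds (closedBall_mem_nhds t₁ hτ)) hbase,
    K ×ˢ closedBall t₁ τ, hK.prod (isCompact_closedBall _ _), fun p hp =>
      (hVW ⟨hKV hp.1, hτW hp.2⟩).1.1, ?_⟩
  rintro t ⟨htτ, s₀, hs₀, hxt⟩ z r hr hz
  have htW' : t ∈ W := hτW htτ
  refine ⟨?_, htτ⟩
  suffices h : ∃ r' ≤ 2 * r + 1,
      PolyReach (fun z => U (z, t₁)) (timeSlice M t₁) (x₀ t₁) z r' by
    obtain ⟨r', hr', h⟩ := h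
    exact hKr z r' (by linarith) h
  induction hz with
  | refl => exact ⟨s₀, by linarith, hxt⟩
  | @step y z r c hy hseg hc ih =>
    have hcn := PolyReach.segment_const_nonneg hc
    obtain ⟨r', hr', hy'⟩ := ih (le_trans (le_add_of_nonneg_right (by positivity)) hr)
    have hyK : y ∈ K := hKr y r' (by nlinarith [mul_nonneg hcn (norm_nonneg (z - y))]) hy'
    have hext : ∀ q ∈ segment ℝ y z, segment ℝ y q ⊆ V →
        PolyReach (fun z => U (z, t₁)) (timeSlice M t₁) (x₀ t₁) q (r' + 2 * c * ‖q - y‖) := by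
      intro q hq hqV
      refine hy'.step (fun w hw => (hVW (mk_mem_prod (hqV hw) htW')).1.2) fun w hw => ?_
      have h1 := hc w ((convex_segment y z).segment_subset (left_mem_segment ℝ y z) hq hw)
      have h2 : U (w, t₁) < 4 * U (w, t) := (hVW (mk_mem_prod (hqV hw) htW')).2
      calc Real.sqrt (U (w, t₁)) ≤ Real.sqrt (2 ^ 2 * U (w, t)) :=
            Real.sqrt_le_sqrt (by linarith)
        _ = 2 * Real.sqrt (U (w, t)) := by
            rw [Real.sqrt_mul (by norm_num), Real.sqrt_sq (by norm_num)]
        _ ≤ 2 * c := by linarith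
    suffices hV : segment ℝ y z ⊆ V from
      ⟨_, by linarith, hext z (right_mem_segment ℝ y z) hV⟩
    have hqK : ∀ q ∈ segment ℝ y z, segment ℝ y q ⊆ V → q ∈ K := by
      intro q hq hqV
      refine hKr q _ ?_ (hext q hq hqV)
      have : ‖q - y‖ ≤ ‖z - y‖ := by
        rw [segment_eq_image_lineMap] at hq
        obtain ⟨θ, hθ, rfl⟩ := hq
        rw [← dist_eq_norm, dist_lineMap_left, ← dist_eq_norm, dist_comm y,
          Real.norm_of_nonneg hθ.1]
        exact mul_le_of_le_one_left dist_nonneg hθ.2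
      nlinarith [mul_le_mul_of_nonneg_left this hcn]
    by_contra hnV
    let f : ℝ → ℂ := fun θ => AffineMap.lineMap y z θ
    have hf : Continuous f := AffineMap.lineMap_continuous
    have hfs : segment ℝ y z = f '' Icc 0 1 := segment_eq_image_lineMap ℝ y z
    have hcmp : IsCompact (Icc (0:ℝ) 1 ∩ f ⁻¹' Vᶜ) :=
      isCompact_Icc.inter_right (hVo.isClosed_compl.preimage hf)
    have hne : (Icc (0:ℝ) 1 ∩ f ⁻¹' Vᶜ).Nonempty := by
      rw [hfs, not_subset] at hnV
      obtain ⟨_, ⟨θ, hθ, rfl⟩, hθ'⟩ := hnV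
      exact ⟨θ, hθ, hθ'⟩
    obtain ⟨θ, ⟨hθ, hθV⟩, hmin⟩ := hcmp.exists_isLeast hne
    have hf0 : f 0 = y := by simp [f]
    have hθ0 : 0 < θ := lt_of_le_of_ne hθ.1 fun h => hθV (by
      rw [← h, hf0]; exact hKV hyK)
    have hlt : ∀ σ ∈ Ico 0 θ, f σ ∈ K := by
      intro σ hσ
      have hσ1 : σ ∈ Icc (0:ℝ) 1 := ⟨hσ.1, hσ.2.le.trans hθ.2⟩
      refine hqK _ (hfs ▸ ⟨σ, hσ1, rfl⟩) ?_
      rw [segment_eq_image_lineMap]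
      rintro _ ⟨κ, hκ, rfl⟩
      have e : AffineMap.lineMap y (f σ) κ = f (κ * σ) := by
        simp only [f, AffineMap.lineMap_apply]
        simp [mul_assoc]
      rw [e]
      by_contra hh
      have hκσ : κ * σ ≤ σ := mul_le_of_le_one_left hσ.1 hκ.2
      have := hmin ⟨⟨mul_nonneg hκ.1 hσ.1, hκσ.trans hσ1.2⟩, hh⟩
      linarith [hσ.2]
    have hcl : f θ ∈ K := by
      have h1 : θ ∈ closure (Ico 0 θ) := by
        rw [closure_Ico hθ0.ne]
        exact ⟨hθ0.le, le_rfl⟩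
      have h2 := image_closure_subset_closure_image hf (mem_image_of_mem f h1)
      exact closure_minimal (by rintro _ ⟨σ, hσ, rfl⟩; exact hlt σ hσ) hK.isClosed h2
    exact hθV (hKV hcl)

/-- `f` has second-order jet `(a, b, c)` at `0`. -/
def HasJet (f : ℝ → ℝ) (a b c : ℝ) : Prop :=
  ∃ f' : ℝ → ℝ, f 0 = a ∧ f' 0 = b ∧ (∀ᶠ x in nhds 0, HasDerivAt f (f' x) x) ∧ HasDerivAt f' c 0

namespace HasJet

variable {f g : ℝ → ℝ} {a b c a' b' c' : ℝ}

lemma congr_jet (h : HasJet f a b c) (ha : a = a') (hb : b = b') (hc : c = c') :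
    HasJet f a' b' c' := by
  subst ha hb hc
  exact h

lemma const (k : ℝ) : HasJet (fun _ => k) k 0 0 :=
  ⟨fun _ => 0, rfl, rfl, Eventually.of_forall fun x => hasDerivAt_const x k, hasDerivAt_const 0 0⟩

lemma affine (k l : ℝ) : HasJet (fun x => k + x * l) k l 0 :=
  ⟨fun _ => l, by simp, rfl, Eventually.of_forall fun x => by
    simpa using ((hasDerivAt_id x).mul_const l).const_add k, hasDerivAt_const 0 l⟩

lemma add (hf : HasJet f a b c) (hg : HasJet g a' b' c') :
    HasJet (fun x => f x + g x) (a + a') (b + b') (c + c') := by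
  obtain ⟨f', h1, h2, h3, h4⟩ := hf
  obtain ⟨g', k1, k2, k3, k4⟩ := hg
  refine ⟨fun x => f' x + g' x, by simp [h1, k1], by simp [h2, k2], ?_, h4.add k4⟩
  filter_upwards [h3, k3] with x hx hx' using hx.add hx'

lemma mul (hf : HasJet f a b c) (hg : HasJet g a' b' c') :
    HasJet (fun x => f x * g x) (a * a') (b * a' + a * b') (c * a' + 2 * (b * b') + a * c') := by
  obtain ⟨f', h1, h2, h3, h4⟩ := hf
  obtain ⟨g', k1, k2, k3, k4⟩ := hg
  refine ⟨fun x => f' x * g x + f x * g' x, by simp [h1, k1], by simp [h1, h2, k1, k2], ?_, ?_⟩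
  · filter_upwards [h3, k3] with x hx hx' using hx.mul hx'
  · have := (h4.mul k3.self_of_nhds).add (h3.self_of_nhds.mul k4)
    rw [h1, h2, k1, k2] at this
    exact this.congr_deriv (by ring)

lemma const_mul (k : ℝ) (hf : HasJet f a b c) :
    HasJet (fun x => k * f x) (k * a) (k * b) (k * c) :=
  ((const k).mul hf).congr_jet rfl (by ring) (by ring)

lemma comp {φ φ' : ℝ → ℝ} {φ'' : ℝ} (hf : HasJet f a b c)
    (h1 : ∀ᶠ x in nhds a, HasDerivAt φ (φ' x) x) (h2 : HasDerivAt φ' φ'' a) :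
    HasJet (fun x => φ (f x)) (φ a) (φ' a * b) (φ'' * b ^ 2 + φ' a * c) := by
  obtain ⟨f', rfl, rfl, h3, h4⟩ := hf
  have hd := h3.self_of_nhds
  refine ⟨fun x => φ' (f x) * f' x, rfl, rfl, ?_, ?_⟩
  · filter_upwards [h3, hd.continuousAt.eventually h1] with x hx hx' using hx'.comp x hx
  · exact ((h2.comp 0 hd).mul h4).congr_deriv (by simp; ring)

lemma exp (hf : HasJet f a b c) :
    HasJet (fun x => Real.exp (f x)) (Real.exp a) (Real.exp a * b)
      (Real.exp a * b ^ 2 + Real.exp a * c) :=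
  hf.comp (Eventually.of_forall Real.hasDerivAt_exp) (Real.hasDerivAt_exp a)

lemma sum {ι : Type*} (s : Finset ι) {F : ι → ℝ → ℝ} {α β κ : ι → ℝ}
    (h : ∀ i ∈ s, HasJet (F i) (α i) (β i) (κ i)) :
    HasJet (fun x => ∑ i ∈ s, F i x) (∑ i ∈ s, α i) (∑ i ∈ s, β i) (∑ i ∈ s, κ i) := by
  classical
  induction s using Finset.induction_on with
  | empty => simpa using const 0
  | insert i s hi ih =>
    simp only [Finset.sum_insert hi]
    exact (h i (Finset.mem_insert_self i s)).add (ih fun j hj => h j (Finset.mem_insert_of_mem hj))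

lemma normSq_affine (α β : ℂ) :
    HasJet (fun x => Complex.normSq (α + x * β)) (Complex.normSq α)
      (2 * (α.re * β.re + α.im * β.im)) (2 * Complex.normSq β) := by
  have h1 := (affine α.re β.re).mul (affine α.re β.re)
  have h2 := (affine α.im β.im).mul (affine α.im β.im)
  have h := (h1.add h2).congr_jet (a' := Complex.normSq α)
    (b' := 2 * (α.re * β.re + α.im * β.im)) (c' := 2 * Complex.normSq β)
    (by rw [Complex.normSq_apply]) (by ring) (by rw [Complex.normSq_apply]; ring)
  convert h using 2 with x
  rw [Complex.normSq_apply]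
  simp

lemma continuousAt (h : HasJet f a b c) : ContinuousAt f 0 := by
  obtain ⟨f', _, _, h3, _⟩ := h
  exact h3.self_of_nhds.continuousAt

/-- Necessary conditions for a local minimum. -/
lemma of_isLocalMin (h : HasJet f a b c) (hmin : ∀ᶠ x in nhds 0, a ≤ f x) : b = 0 ∧ 0 ≤ c := by
  obtain ⟨f', rfl, rfl, h3, h4⟩ := h
  have hb : f' 0 = 0 := IsLocalMin.hasDerivAt_eq_zero hmin h3.self_of_nhds
  refine ⟨hb, ?_⟩
  by_contra! hc
  have hde : deriv f =ᶠ[nhds 0] f' := by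
    filter_upwards [h3] with x hx using hx.deriv
  have hdd : deriv (deriv f) 0 = c := by rw [hde.deriv_eq, h4.deriv]
  have hmax := isLocalMax_of_deriv_deriv_neg (f := f) (x₀ := 0) (by rw [hdd]; exact hc)
    (by rw [h3.self_of_nhds.deriv, hb]) h3.self_of_nhds.continuousAt
  have hconst : f =ᶠ[nhds 0] fun _ => f 0 := by
    filter_upwards [hmin, hmax] with x h1 h2 using le_antisymm h2 h1
  have : deriv (deriv f) 0 = 0 := by
    rw [hconst.deriv.deriv_eq]
    simp
  linarith

end HasJet

lemma HasDerivAt.nonpos_of_left_nonneg {f : ℝ → ℝ} {d t : ℝ} (h : HasDerivAt f d t) (h0 : f t = 0)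
    (hl : ∀ᶠ x in nhdsWithin t (Iio t), 0 ≤ f x) : d ≤ 0 := by
  have ht : Tendsto (slope f t) (nhdsWithin t (Iio t)) (nhds d) :=
    (hasDerivAt_iff_tendsto_slope.1 h).mono_left (nhdsWithin_mono _ fun x hx => ne_of_lt hx)
  refine le_of_tendsto ht ?_
  filter_upwards [hl, self_mem_nhdsWithin] with x hx hxt
  rw [slope_def_field, h0, sub_zero]
  exact div_nonpos_of_nonneg_of_nonpos hx (sub_nonpos.2 (le_of_lt hxt))

/-- The derivative of `f` in the constant direction `v`. -/
noncomputable def dirDeriv (v : ℂ × ℝ) (f : ℂ × ℝ → ℝ) (p : ℂ × ℝ) : ℝ := fderiv ℝ f p v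

/-- The spatial Laplacian of a function on spacetime. -/
noncomputable def spaceLap (f : ℂ × ℝ → ℝ) (p : ℂ × ℝ) : ℝ :=
  dirDeriv (1, 0) (dirDeriv (1, 0) f) p + dirDeriv (Complex.I, 0) (dirDeriv (Complex.I, 0) f) p

/-- The time derivative of a function on spacetime. -/
noncomputable abbrev timeDeriv (f : ℂ × ℝ → ℝ) : ℂ × ℝ → ℝ := dirDeriv (0, 1) f

/-- The Wirtinger derivative `∂f/∂z` of a function on spacetime. -/
noncomputable def wirtinger (f : ℂ × ℝ → ℝ) (p : ℂ × ℝ) : ℂ :=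
  ⟨dirDeriv (1, 0) f p / 2, - dirDeriv (Complex.I, 0) f p / 2⟩

section Calculus

variable {M : Set (ℂ × ℝ)} {f : ℂ × ℝ → ℝ} {p : ℂ × ℝ}

lemma ContDiffOn.dirDeriv (hM : IsOpen M) (hf : ContDiffOn ℝ (⊤ : ℕ∞) f M) (v : ℂ × ℝ) :
    ContDiffOn ℝ (⊤ : ℕ∞) (dirDeriv v f) M :=
  (hf.fderiv_of_isOpen hM (by simp)).clm_apply contDiffOn_const

lemma ContDiffOn.hasFDerivAt_of_isOpen (hM : IsOpen M) (hf : ContDiffOn ℝ (⊤ : ℕ∞) f M)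
    (hp : p ∈ M) : HasFDerivAt f (fderiv ℝ f p) p :=
  ((hf.contDiffAt (hM.mem_nhds hp)).differentiableAt (by simp)).hasFDerivAt

lemma dirDeriv_dirDeriv (hM : IsOpen M) (hf : ContDiffOn ℝ (⊤ : ℕ∞) f M) (hp : p ∈ M)
    (v w : ℂ × ℝ) : dirDeriv w (dirDeriv v f) p = fderiv ℝ (fderiv ℝ f) p w v := by
  have hd : DifferentiableAt ℝ (fderiv ℝ f) p :=
    ((hf.fderiv_of_isOpen (m := (⊤ : ℕ∞)) hM (by simp)).contDiffAt
      (hM.mem_nhds hp)).differentiableAt (by simp)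
  have := hd.hasFDerivAt.clm_apply (hasFDerivAt_const v p)
  rw [dirDeriv]
  rw [show dirDeriv v f = fun q => fderiv ℝ f q v from rfl, this.fderiv]
  simp

lemma dirDeriv_comm (hM : IsOpen M) (hf : ContDiffOn ℝ (⊤ : ℕ∞) f M) (hp : p ∈ M)
    (v w : ℂ × ℝ) : dirDeriv w (dirDeriv v f) p = dirDeriv v (dirDeriv w f) p := by
  rw [dirDeriv_dirDeriv hM hf hp, dirDeriv_dirDeriv hM hf hp]
  exact ((hf.contDiffAt (hM.mem_nhds hp)).isSymmSndFDerivAt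
    (by simp only [minSmoothness_of_isRCLikeNormedField]; exact WithTop.coe_le_coe.2 (le_top : (2 : ℕ∞) ≤ ⊤))).eq w v

lemma dirDeriv_congr {g : ℂ × ℝ → ℝ} (h : f =ᶠ[nhds p] g) (v : ℂ × ℝ) :
    dirDeriv v f p = dirDeriv v g p := by
  rw [dirDeriv, dirDeriv, h.fderiv_eq]

lemma space_decomp (ζ : ℂ) :
    ((ζ, 0) : ℂ × ℝ) = ζ.re • ((1 : ℂ), (0 : ℝ)) + ζ.im • (Complex.I, (0 : ℝ)) := by
  ext <;> simp

lemma dirDeriv_space (ζ : ℂ) : dirDeriv (ζ, 0) f p = 2 * (wirtinger f p * ζ).re := by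
  rw [dirDeriv, space_decomp, map_add, map_smul, map_smul]
  simp only [wirtinger, dirDeriv, smul_eq_mul, Complex.mul_re]
  ring

lemma dirDeriv_dirDeriv_space (hM : IsOpen M) (hf : ContDiffOn ℝ (⊤ : ℕ∞) f M) (hp : p ∈ M)
    (η : ℂ) : dirDeriv (η, 0) (dirDeriv (η, 0) f) p +
      dirDeriv (Complex.I * η, 0) (dirDeriv (Complex.I * η, 0) f) p =
      Complex.normSq η * spaceLap f p := by
  simp only [spaceLap, dirDeriv_dirDeriv hM hf hp]
  rw [space_decomp η, space_decomp (Complex.I * η), Complex.normSq_apply]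
  have h1 : (Complex.I * η).re = - η.im := by simp
  have h2 : (Complex.I * η).im = η.re := by simp
  simp only [h1, h2, map_add, map_smul, add_apply,
    smul_apply, smul_eq_mul]
  ring

lemma hasJet_space (hM : IsOpen M) (hf : ContDiffOn ℝ (⊤ : ℕ∞) f M) {y : ℂ} {t : ℝ}
    (hp : (y, t) ∈ M) (ζ : ℂ) :
    HasJet (fun x : ℝ => f (y + x * ζ, t)) (f (y, t)) (dirDeriv (ζ, 0) f (y, t))
      (dirDeriv (ζ, 0) (dirDeriv (ζ, 0) f) (y, t)) := by
  have hline : ∀ x : ℝ, HasDerivAt (fun x : ℝ => (y + x * ζ, t)) ((ζ, 0) : ℂ × ℝ) x := by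
    intro x
    have h1 : HasDerivAt (fun x : ℝ => y + x * ζ) ζ x := by
      simpa using ((Complex.ofRealCLM.hasDerivAt (x := x)).mul_const ζ).const_add y
    exact h1.prodMk (hasDerivAt_const x t)
  have hcomp : ∀ (g : ℂ × ℝ → ℝ) (x : ℝ), ContDiffOn ℝ (⊤ : ℕ∞) g M → (y + x * ζ, t) ∈ M →
      HasDerivAt (fun x : ℝ => g (y + x * ζ, t)) (dirDeriv (ζ, 0) g (y + x * ζ, t)) x :=
    fun g x hg hx => (hg.hasFDerivAt_of_isOpen hM hx).comp_hasDerivAt x (hline x)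
  have hev : ∀ᶠ x : ℝ in nhds 0, (y + x * ζ, t) ∈ M :=
    (hline 0).continuousAt (hM.mem_nhds (by simpa using hp))
  refine ⟨fun x => dirDeriv (ζ, 0) f (y + x * ζ, t), by simp, by simp, ?_, ?_⟩
  · filter_upwards [hev] with x hx using hcomp f x hf hx
  · simpa using hcomp _ 0 (hf.dirDeriv hM (ζ, 0)) (by simpa using hp)

lemma hasDerivAt_time (hM : IsOpen M) (hf : ContDiffOn ℝ (⊤ : ℕ∞) f M) {y : ℂ} {t : ℝ}
    (hp : (y, t) ∈ M) : HasDerivAt (fun t => f (y, t)) (timeDeriv f (y, t)) t :=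
  (hf.hasFDerivAt_of_isOpen hM hp).comp_hasDerivAt t ((hasDerivAt_const t y).prodMk (hasDerivAt_id t))

/-- Evolution of `S = ∂ₜL` (minus the scalar curvature) when `e^L ∂ₜL = ΔL`. -/
lemma spaceLap_timeDeriv (hM : IsOpen M) {L : ℂ × ℝ → ℝ} (hL : ContDiffOn ℝ (⊤ : ℕ∞) L M)
    (heq : ∀ p ∈ M, Real.exp (L p) * timeDeriv L p = spaceLap L p) (hp : p ∈ M) :
    spaceLap (timeDeriv L) p =
      Real.exp (L p) * (timeDeriv L p ^ 2 + timeDeriv (timeDeriv L) p) := by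
  have hnear : ∀ᶠ q in nhds p, q ∈ M := hM.mem_nhds hp
  have hS := hL.dirDeriv hM (0, 1)
  have h1 : timeDeriv (spaceLap L) p = spaceLap (timeDeriv L) p := by
    have key : ∀ v, timeDeriv (dirDeriv v (dirDeriv v L)) p =
        dirDeriv v (dirDeriv v (timeDeriv L)) p := by
      intro v
      refine (dirDeriv_comm hM (hL.dirDeriv hM v) hp v (0, 1)).trans ?_
      exact dirDeriv_congr (hnear.mono fun q hq => dirDeriv_comm hM hL hq _ _) _
    have hadd : timeDeriv (spaceLap L) p = timeDeriv (dirDeriv (1, 0) (dirDeriv (1, 0) L)) p +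
        timeDeriv (dirDeriv (Complex.I, 0) (dirDeriv (Complex.I, 0) L)) p := by
      have := (((hL.dirDeriv hM (1, 0)).dirDeriv hM (1, 0)).hasFDerivAt_of_isOpen hM hp).add
        (((hL.dirDeriv hM (Complex.I, 0)).dirDeriv hM (Complex.I, 0)).hasFDerivAt_of_isOpen hM hp)
      exact congrArg (fun T : ℂ × ℝ →L[ℝ] ℝ => T (0, 1)) this.fderiv
    rw [hadd, key, key, spaceLap]
  have h2 : timeDeriv (spaceLap L) p = timeDeriv (fun q => Real.exp (L q) * timeDeriv L q) p :=
    dirDeriv_congr (hnear.mono fun q hq => (heq q hq).symm) _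
  have h3 := ((hL.hasFDerivAt_of_isOpen hM hp).exp.mul (hS.hasFDerivAt_of_isOpen hM hp)).fderiv
  rw [← h1, h2]
  refine (congrArg (fun T : ℂ × ℝ →L[ℝ] ℝ => T (0, 1)) h3).trans ?_
  simp [timeDeriv, dirDeriv]
  ring

end Calculus

/-- A discrete parallel frame along a chain: `q` is the transport and `l` the logarithm of the
conformal factor; if transport almost preserves the metric, the frame stays almost unit. -/
lemma exists_frame (q : ℕ → ℂ) (l : ℕ → ℝ) (N : ℕ) {θ : ℝ} (hq : ∀ i < N, q i ≠ 0)
    (hsum : ∑ i ∈ Finset.range N, |Real.log (Complex.normSq (q i)) + (l (i + 1) - l i)| ≤ θ) :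
    ∃ η : ℕ → ℂ, (∀ i < N, η (i + 1) = η i * q i) ∧ (∀ i, N < i → η i = 0) ∧
      Complex.normSq (η N) * Real.exp (l N) = 1 ∧
      ∀ i ≤ N, Real.exp (-θ) ≤ Complex.normSq (η i) * Real.exp (l i) ∧
        Complex.normSq (η i) * Real.exp (l i) ≤ Real.exp θ := by
  classical
  set π : ℕ → ℂ := fun i => ∏ j ∈ Finset.range i, q j with hπ
  have hπ0 : ∀ i ≤ N, π i ≠ 0 := fun i hi => Finset.prod_ne_zero_iff.2 fun j hj =>
    hq j (lt_of_lt_of_le (Finset.mem_range.1 hj) hi)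
  set r : ℝ := Real.sqrt ((Complex.normSq (π N) * Real.exp (l N))⁻¹) with hr
  have hN : 0 < Complex.normSq (π N) * Real.exp (l N) :=
    mul_pos (Complex.normSq_pos.2 (hπ0 N le_rfl)) (Real.exp_pos _)
  have hr0 : 0 < r := Real.sqrt_pos.2 (inv_pos.2 hN)
  have hr2 : r * r = (Complex.normSq (π N) * Real.exp (l N))⁻¹ :=
    Real.mul_self_sqrt (inv_pos.2 hN).le
  set η : ℕ → ℂ := fun i => if i ≤ N then r * π i else 0 with hη
  have hηi : ∀ i ≤ N, η i = r * π i := fun i hi => by simp [hη, hi]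
  have hpos : ∀ i ≤ N, 0 < Complex.normSq (η i) := fun i hi => by
    rw [hηi i hi, Complex.normSq_pos]
    exact mul_ne_zero (by exact_mod_cast hr0.ne') (hπ0 i hi)
  have hstep : ∀ i < N, η (i + 1) = η i * q i := fun i hi => by
    rw [hηi i hi.le, hηi (i + 1) hi, hπ]
    simp only [Finset.prod_range_succ]
    ring
  have hlast : Complex.normSq (η N) * Real.exp (l N) = 1 := by
    rw [hηi N le_rfl, Complex.normSq_mul, Complex.normSq_ofReal, hr2, mul_assoc]
    exact inv_mul_cancel₀ hN.ne'
  refine ⟨η, hstep, fun i hi => by simp [hη, not_le.2 hi], hlast, fun i hi => ?_⟩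
  set Λ : ℕ → ℝ := fun i => Real.log (Complex.normSq (η i) * Real.exp (l i)) with hΛ
  have hΛi : ∀ i ≤ N, Λ i = Real.log (Complex.normSq (η i)) + l i := fun i hi => by
    rw [hΛ]
    simp only
    rw [Real.log_mul (hpos i hi).ne' (Real.exp_pos _).ne', Real.log_exp]
  have hdist : |Λ i| ≤ θ := by
    have h1 := dist_le_Ico_sum_dist Λ hi
    have h2 : Λ N = 0 := by simp [hΛ, hlast]
    rw [h2, Real.dist_eq, sub_zero] at h1
    refine h1.trans (le_trans ?_ hsum)
    have h3 : ∀ j ∈ Finset.Ico i N, dist (Λ j) (Λ (j + 1)) =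
        |Real.log (Complex.normSq (q j)) + (l (j + 1) - l j)| := by
      intro j hj
      have hjN := (Finset.mem_Ico.1 hj).2
      rw [hΛi j hjN.le, hΛi (j + 1) hjN, hstep j hjN, Complex.normSq_mul,
        Real.log_mul (hpos j hjN.le).ne' (Complex.normSq_pos.2 (hq j hjN)).ne', dist_comm,
        Real.dist_eq]
      congr 1
      ring
    rw [Finset.sum_congr rfl h3]
    refine Finset.sum_le_sum_of_subset_of_nonneg (fun j hj => ?_) fun _ _ _ => abs_nonneg _
    exact Finset.mem_range.2 (Finset.mem_Ico.1 hj).2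
  have hp := mul_pos (hpos i hi) (Real.exp_pos (l i))
  rw [← Real.le_log_iff_exp_le hp, ← Real.log_le_iff_le_exp hp]
  exact abs_le.1 hdist

/-- The discrete action of a chain `y 0, …, y N` at time `t`, with a penalty for starting away
from the centre `x₀ t`. -/
noncomputable def chainCost (L : ℂ × ℝ → ℝ) (B ε : ℝ) (x₀ : ℝ → ℂ) (t : ℝ) (N : ℕ) (y : ℕ → ℂ) :
    ℝ :=
  B * Complex.normSq (y 0 - x₀ t) + ∑ i ∈ Finset.range N,
    (ε + Real.exp (L (y i, t)) * Complex.normSq (y (i + 1) - y i) / ε)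

section Variation

variable {M : Set (ℂ × ℝ)} {L : ℂ × ℝ → ℝ}

/-- Second variation of one step of the action, with parallel variation field. -/
lemma hasJet_step (hM : IsOpen M) (hL : ContDiffOn ℝ (⊤ : ℕ∞) L M) {y : ℂ} {t : ℝ}
    (hp : (y, t) ∈ M) (α ζ : ℂ) :
    HasJet (fun x : ℝ => Real.exp (L (y + x * ζ, t)) *
        Complex.normSq (α + x * (-(wirtinger L (y, t) * α * ζ))))
      (Real.exp (L (y, t)) * Complex.normSq α) 0
      (Real.exp (L (y, t)) * Complex.normSq α *
        (dirDeriv (ζ, 0) (dirDeriv (ζ, 0) L) (y, t) - 4 * (wirtinger L (y, t) * ζ).re ^ 2 +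
          2 * Complex.normSq (wirtinger L (y, t) * ζ))) := by
  refine ((hasJet_space hM hL hp ζ).exp.mul (HasJet.normSq_affine α _)).congr_jet rfl ?_ ?_
  · rw [dirDeriv_space]
    simp only [Complex.normSq_apply, Complex.mul_re, Complex.mul_im, Complex.neg_re,
      Complex.neg_im]
    ring
  · rw [dirDeriv_space]
    simp only [Complex.normSq_apply, Complex.mul_re, Complex.mul_im, Complex.neg_re,
      Complex.neg_im]
    ring

variable {B ε : ℝ} {x₀ : ℝ → ℂ} {t : ℝ} {N : ℕ} {y η : ℕ → ℂ}

lemma hasJet_chainCost (hM : IsOpen M) (hL : ContDiffOn ℝ (⊤ : ℕ∞) L M)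
    (hy : ∀ i ≤ N, (y i, t) ∈ M)
    (hη : ∀ i < N, η (i + 1) = η i * (1 - wirtinger L (y i, t) * (y (i + 1) - y i))) (d : ℂ) :
    HasJet (fun x : ℝ => chainCost L B ε x₀ t N fun i => y i + x * (d * η i))
      (chainCost L B ε x₀ t N y)
      (2 * B * ((y 0 - x₀ t).re * (d * η 0).re + (y 0 - x₀ t).im * (d * η 0).im))
      (2 * B * Complex.normSq (d * η 0) + ∑ i ∈ Finset.range N,
        Real.exp (L (y i, t)) * Complex.normSq (y (i + 1) - y i) *
        (dirDeriv (d * η i, 0) (dirDeriv (d * η i, 0) L) (y i, t) -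
          4 * (wirtinger L (y i, t) * (d * η i)).re ^ 2 +
          2 * Complex.normSq (wirtinger L (y i, t) * (d * η i))) / ε) := by
  have h0 := (HasJet.normSq_affine (y 0 - x₀ t) (d * η 0)).const_mul B
  have h1 := HasJet.sum (Finset.range N) fun i hi => (HasJet.const ε).add
    ((hasJet_step hM hL (hy i (Finset.mem_range.1 hi).le) (y (i + 1) - y i)
      (d * η i)).const_mul ε⁻¹)
  have h2 := (h0.add h1).congr_jet (a' := chainCost L B ε x₀ t N y)
    (b' := 2 * B * ((y 0 - x₀ t).re * (d * η 0).re + (y 0 - x₀ t).im * (d * η 0).im)) (by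
      rw [chainCost]
      congr 1
      refine Finset.sum_congr rfl fun i _ => ?_
      ring) (by simp; ring) rfl
  refine (?_ : HasJet _ _ _ _)
  convert h2 using 1
  · funext x
    rw [chainCost]
    congr 1
    · rw [show y 0 + x * (d * η 0) - x₀ t = y 0 - x₀ t + x * (d * η 0) by ring]
    · refine Finset.sum_congr rfl fun i hi => ?_
      rw [hη i (Finset.mem_range.1 hi)]
      rw [show y (i + 1) + x * (d * (η i * (1 - wirtinger L (y i, t) * (y (i + 1) - y i)))) -
        (y i + x * (d * η i)) = (y (i + 1) - y i) +
          x * (-(wirtinger L (y i, t) * (y (i + 1) - y i) * (d * η i))) by ring]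
      ring
  · congr 1
    · ring
    · refine Finset.sum_congr rfl fun i _ => ?_
      ring

lemma hasDerivAt_chainCost (hM : IsOpen M) (hL : ContDiffOn ℝ (⊤ : ℕ∞) L M)
    (hy : ∀ i ≤ N, (y i, t) ∈ M) {v : ℂ} (hv : HasDerivAt x₀ v t) :
    HasDerivAt (fun τ => chainCost L B ε x₀ τ N y)
      (-(2 * B * ((y 0 - x₀ t).re * v.re + (y 0 - x₀ t).im * v.im)) + ∑ i ∈ Finset.range N,
        Real.exp (L (y i, t)) * timeDeriv L (y i, t) * Complex.normSq (y (i + 1) - y i) / ε) t := by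
  have hre : HasDerivAt (fun τ => (y 0 - x₀ τ).re) (-v).re t :=
    Complex.reCLM.hasFDerivAt.comp_hasDerivAt t (hv.const_sub (y 0))
  have him : HasDerivAt (fun τ => (y 0 - x₀ τ).im) (-v).im t :=
    Complex.imCLM.hasFDerivAt.comp_hasDerivAt t (hv.const_sub (y 0))
  have h1 := ((hre.mul hre).add (him.mul him)).const_mul B
  have h2 := HasDerivAt.fun_sum (u := Finset.range N) fun i hi =>
    ((((hasDerivAt_time hM hL (hy i (Finset.mem_range.1 hi).le)).exp).mul_const
      (Complex.normSq (y (i + 1) - y i))).div_const ε).const_add ε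
  simp only [chainCost, Complex.normSq_apply (y 0 - _)]
  exact (h1.add h2).congr_deriv (by simp; ring)

end Variation

lemma HasJet.of_weighted_max {g s : ℝ → ℝ} {g₀ b c s₀ sb sc A k : ℝ} (hg : HasJet g g₀ b c)
    (hs : HasJet s s₀ sb sc) (hA : 0 < A) (hgA : g₀ < A) (hk : 0 < k)
    (hmax : ∀ᶠ x in nhds 0, k * (1 - g x / A) ^ 2 * s x ≤ k * (1 - g₀ / A) ^ 2 * s₀) :
    (1 - g₀ / A) ^ 2 * sc ≤ s₀ * (6 * b ^ 2 / A ^ 2 + 2 * (1 - g₀ / A) * c / A) := by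
  set w := 1 - g₀ / A with hw
  have hw0 : 0 < w := by
    rw [hw, sub_pos, div_lt_one hA]
    exact hgA
  have h1 := ((HasJet.const 1).add (hg.const_mul (-A⁻¹))).congr_jet (a' := w)
    (by rw [hw]; ring) rfl rfl
  have h2 := ((h1.mul h1).mul hs).const_mul (-k)
  obtain ⟨e1, e2⟩ := h2.of_isLocalMin (hmax.mono fun x hx => by
    have : (1 - g x / A) ^ 2 * s x = (1 + -A⁻¹ * g x) * (1 + -A⁻¹ * g x) * s x := by ring
    rw [mul_assoc, mul_assoc, this] at hx
    linarith [show k * (w ^ 2 * s₀) = k * (w * w * s₀) by ring])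
  have e3 : 2 * (-A⁻¹ * b) * s₀ + w * sb = 0 := by
    have : k * w * (2 * (-A⁻¹ * b) * s₀ + w * sb) = 0 := by linear_combination -e1
    exact (mul_eq_zero.1 this).resolve_left (mul_pos hk hw0).ne'
  have e4 : 0 ≤ k * (s₀ * (6 * b ^ 2 / A ^ 2 + 2 * w * c / A) - w ^ 2 * sc) := by
    refine e2.trans_eq ?_
    rw [div_eq_mul_inv, div_eq_mul_inv, ← inv_pow]
    linear_combination (4 * k * (A⁻¹ * b)) * e3
  linarith [(mul_nonneg_iff_of_pos_left hk).1 e4]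

lemma HasDerivAt.weighted_left_max {g s : ℝ → ℝ} {gt st A a t : ℝ} (hg : HasDerivAt g gt t)
    (hs : HasDerivAt s st t) (hmax : ∀ᶠ τ in nhdsWithin t (Iio t),
      (τ - a) * (1 - g τ / A) ^ 2 * s τ ≤ (t - a) * (1 - g t / A) ^ 2 * s t) :
    0 ≤ (1 - g t / A) ^ 2 * s t - (t - a) * (2 * (1 - g t / A) * (gt / A)) * s t +
      (t - a) * (1 - g t / A) ^ 2 * st := by
  have h : HasDerivAt (fun τ => (t - a) * (1 - g t / A) ^ 2 * s t -
      (τ - a) * (1 - g τ / A) ^ 2 * s τ) (-((1 - g t / A) ^ 2 * s t -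
        (t - a) * (2 * (1 - g t / A) * (gt / A)) * s t + (t - a) * (1 - g t / A) ^ 2 * st)) t := by
    refine ((((((hasDerivAt_id t).sub_const a).mul
      (((hg.div_const A).const_sub 1).pow 2)).mul hs).const_sub
        ((t - a) * (1 - g t / A) ^ 2 * s t))).congr_deriv ?_
    simp only [id_eq, Pi.mul_apply, Pi.pow_apply]
    push_cast
    ring
  have := h.nonpos_of_left_nonneg (by ring) (hmax.mono fun τ hτ => sub_nonneg.2 hτ)
  linarith

private lemma weighted_max_algebra {A s S St w C Q b₁ b₂ c₁ c₂ D₁ D₂ g' : ℝ} (hA : 0 < A)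
    (hs : 0 < s) (hS : 0 < S) (hw₀ : 0 < w) (hw₁ : w ≤ 1) (hC : 0 ≤ C) (hQ : b₁ ^ 2 + b₂ ^ 2 ≤ Q)
    (h₁ : w ^ 2 * D₁ ≤ S * (6 * b₁ ^ 2 / A ^ 2 + 2 * w * c₁ / A))
    (h₂ : w ^ 2 * D₂ ≤ S * (6 * b₂ ^ 2 / A ^ 2 + 2 * w * c₂ / A)) (hD : D₁ + D₂ = S ^ 2 + St)
    (ht : 0 ≤ w ^ 2 * S - s * (2 * w * (g' / A)) * S + s * w ^ 2 * St)
    (hc : c₁ + c₂ - g' ≤ C) :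
    s * w ^ 2 * S ≤ 1 + s * (2 * C / A + 6 * Q / A ^ 2) := by
  have hq : 6 / A ^ 2 * (b₁ ^ 2 + b₂ ^ 2) ≤ 6 / A ^ 2 * Q := by gcongr
  have hcw : 2 / A * (w * (c₁ + c₂ - g')) ≤ 2 / A * C := by
    have : w * (c₁ + c₂ - g') ≤ C :=
      (mul_le_mul_of_nonneg_left hc hw₀.le).trans (mul_le_of_le_one_left hC hw₁)
    gcongr
  have h₄ := mul_le_mul_of_nonneg_left (add_le_add hq hcw) (mul_pos hs hS).le
  have h₅ := mul_le_mul_of_nonneg_left (add_le_add h₁ h₂) hs.le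
  have h₆ : s * (w ^ 2 * D₁ + w ^ 2 * D₂) = s * w ^ 2 * S ^ 2 + s * w ^ 2 * St := by
    linear_combination s * w ^ 2 * hD
  have h₇ : S * (s * w ^ 2 * S) ≤ S * (w ^ 2 + s * (2 * C / A + 6 * Q / A ^ 2)) := by
    simp only [div_eq_mul_inv] at *
    linarith
  have h₈ := le_of_mul_le_mul_left h₇ hS
  have h₉ : w ^ 2 ≤ 1 := pow_le_one₀ hw₀.le hw₁
  linarith

/-- The maximum principle computation: at a space-time maximum of the localised quantity
`(t - a) (1 - G / A) ^ 2 S`, where `G` is the action of a chain, the maximum is controlled. -/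
lemma weighted_max_le {M : Set (ℂ × ℝ)} (hM : IsOpen M) {L : ℂ × ℝ → ℝ}
    (hL : ContDiffOn ℝ (⊤ : ℕ∞) L M)
    (heq : ∀ p ∈ M, Real.exp (L p) * timeDeriv L p = spaceLap L p)
    {B ε A C Q a t : ℝ} {x₀ : ℝ → ℂ} {N : ℕ} {y η : ℕ → ℂ} {v : ℂ}
    (hB : 0 ≤ B) (hε : 0 < ε) (hA : 0 < A) (hC : 0 ≤ C) (hat : a < t)
    (hv : HasDerivAt x₀ v t) (hy : ∀ i ≤ N, (y i, t) ∈ M)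
    (hG : chainCost L B ε x₀ t N y < A) (hS : 0 < timeDeriv L (y N, t))
    (hη : ∀ i < N, η (i + 1) = η i * (1 - wirtinger L (y i, t) * (y (i + 1) - y i)))
    (hηN : Complex.normSq (η N) * Real.exp (L (y N, t)) = 1)
    (hspace : ∀ d : ℂ, ∀ᶠ x : ℝ in nhds 0,
      (t - a) * (1 - chainCost L B ε x₀ t N (fun i => y i + x * (d * η i)) / A) ^ 2 *
        timeDeriv L (y N + x * (d * η N), t) ≤
      (t - a) * (1 - chainCost L B ε x₀ t N y / A) ^ 2 * timeDeriv L (y N, t))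
    (htime : ∀ᶠ τ in nhdsWithin t (Iio t),
      (τ - a) * (1 - chainCost L B ε x₀ τ N y / A) ^ 2 * timeDeriv L (y N, τ) ≤
      (t - a) * (1 - chainCost L B ε x₀ t N y / A) ^ 2 * timeDeriv L (y N, t))
    (hQ : 4 * B ^ 2 * Complex.normSq (y 0 - x₀ t) * Complex.normSq (η 0) ≤ Q)
    (hCb : 4 * B * Complex.normSq (η 0) +
      2 * B * ((y 0 - x₀ t).re * v.re + (y 0 - x₀ t).im * v.im) +
      ∑ i ∈ Finset.range N, Real.exp (L (y i, t)) * Complex.normSq (y (i + 1) - y i) / ε *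
        (timeDeriv L (y i, t) * (Complex.normSq (η i) * Real.exp (L (y i, t)) - 1)) ≤ C) :
    (t - a) * (1 - chainCost L B ε x₀ t N y / A) ^ 2 * timeDeriv L (y N, t) ≤
      1 + (t - a) * (2 * C / A + 6 * Q / A ^ 2) := by
  have hSd := hL.dirDeriv hM (0, 1)
  have hg : ∀ d, HasJet _ _ _ _ := fun d => hasJet_chainCost (B := B) (ε := ε) (x₀ := x₀) hM hL hy hη d
  have hs : ∀ d : ℂ, HasJet _ _ _ _ := fun d => hasJet_space hM hSd (hy N le_rfl) (d * η N)
  have hgt := hasDerivAt_chainCost (B := B) (ε := ε) hM hL hy hv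
  have hst := hasDerivAt_time hM hSd (hy N le_rfl)
  have hG0 : 0 ≤ chainCost L B ε x₀ t N y := by
    refine add_nonneg (mul_nonneg hB (Complex.normSq_nonneg _)) (Finset.sum_nonneg fun i _ => ?_)
    have := Complex.normSq_nonneg (y (i + 1) - y i)
    positivity
  have hs1 : 0 < t - a := sub_pos.2 hat
  have k1 := (hg 1).of_weighted_max (hs 1) hA hG hs1 (hspace 1)
  have kI := (hg Complex.I).of_weighted_max (hs Complex.I) hA hG hs1 (hspace Complex.I)
  set g₀ := chainCost L B ε x₀ t N y with hg₀
  set w := 1 - g₀ / A with hw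
  have hw0 : 0 < w := by
    rw [hw, sub_pos, div_lt_one hA]
    exact hG
  have hw1 : w ≤ 1 := by
    rw [hw]
    linarith [div_nonneg hG0 hA.le]
  have hlap := dirDeriv_dirDeriv_space hM hSd (hy N le_rfl) (η N)
  rw [spaceLap_timeDeriv hM hL heq (hy N le_rfl), ← mul_assoc, hηN, one_mul] at hlap
  rw [one_mul] at k1
  set S := timeDeriv L (y N, t) with hSdef
  set St := timeDeriv (timeDeriv L) (y N, t) with hStdef
  have htm := hgt.weighted_left_max hst htime
  rw [← hg₀, ← hw] at htm
  have hsum : ∑ i ∈ Finset.range N, Real.exp (L (y i, t)) * Complex.normSq (y (i + 1) - y i) *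
        (dirDeriv (1 * η i, 0) (dirDeriv (1 * η i, 0) L) (y i, t) -
          4 * (wirtinger L (y i, t) * (1 * η i)).re ^ 2 +
          2 * Complex.normSq (wirtinger L (y i, t) * (1 * η i))) / ε +
      ∑ i ∈ Finset.range N, Real.exp (L (y i, t)) * Complex.normSq (y (i + 1) - y i) *
        (dirDeriv (Complex.I * η i, 0) (dirDeriv (Complex.I * η i, 0) L) (y i, t) -
          4 * (wirtinger L (y i, t) * (Complex.I * η i)).re ^ 2 +
          2 * Complex.normSq (wirtinger L (y i, t) * (Complex.I * η i))) / ε -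
      ∑ i ∈ Finset.range N,
        Real.exp (L (y i, t)) * timeDeriv L (y i, t) * Complex.normSq (y (i + 1) - y i) / ε =
      ∑ i ∈ Finset.range N, Real.exp (L (y i, t)) * Complex.normSq (y (i + 1) - y i) / ε *
        (timeDeriv L (y i, t) * (Complex.normSq (η i) * Real.exp (L (y i, t)) - 1)) := by
    rw [← Finset.sum_add_distrib, ← Finset.sum_sub_distrib]
    refine Finset.sum_congr rfl fun i hi => ?_
    have hl := dirDeriv_dirDeriv_space hM hL (hy i (Finset.mem_range.1 hi).le) (η i)
    rw [← heq _ (hy i (Finset.mem_range.1 hi).le)] at hl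
    have hn : 2 * Complex.normSq (wirtinger L (y i, t) * (1 * η i)) +
      2 * Complex.normSq (wirtinger L (y i, t) * (Complex.I * η i)) =
      4 * (wirtinger L (y i, t) * (1 * η i)).re ^ 2 +
      4 * (wirtinger L (y i, t) * (Complex.I * η i)).re ^ 2 := by
      simp [Complex.normSq_apply]
      ring
    rw [one_mul] at hn ⊢
    linear_combination Real.exp (L (y i, t)) * Complex.normSq (y (i + 1) - y i) / ε * (hl + hn)
  have hb : ∀ z w : ℂ, (2 * B * (z.re * (1 * w).re + z.im * (1 * w).im)) ^ 2 +
      (2 * B * (z.re * (Complex.I * w).re + z.im * (Complex.I * w).im)) ^ 2 =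
      4 * B ^ 2 * Complex.normSq z * Complex.normSq w := by
    intro z w
    simp [Complex.normSq_apply]
    ring
  have hbb := hb (y 0 - x₀ t) (η 0)
  have hn1 : Complex.normSq (1 * η 0) = Complex.normSq (η 0) := by simp
  have hnI : Complex.normSq (Complex.I * η 0) = Complex.normSq (η 0) := by simp
  rw [hn1] at k1
  rw [hnI] at kI
  generalize 2 * B * ((y 0 - x₀ t).re * (1 * η 0).re + (y 0 - x₀ t).im * (1 * η 0).im) = b1
    at k1 hbb
  generalize 2 * B * ((y 0 - x₀ t).re * (Complex.I * η 0).re +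
    (y 0 - x₀ t).im * (Complex.I * η 0).im) = bI at kI hbb
  generalize Complex.normSq (η 0) = n0 at *
  generalize 2 * B * ((y 0 - x₀ t).re * v.re + (y 0 - x₀ t).im * v.im) = vb at *
  rw [← hsum] at hCb
  clear hsum hspace htime hg hs hgt hst
  generalize (∑ i ∈ Finset.range N, _ : ℝ) = s1 at k1 hCb
  generalize (∑ i ∈ Finset.range N, _ : ℝ) = sI at kI hCb
  generalize (∑ i ∈ Finset.range N, _ : ℝ) = sT at htm hCb
  exact weighted_max_algebra hA hs1 hS hw0 hw1 hC (hbb.le.trans hQ) k1 kI hlap htm (by linarith)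

lemma Complex.abs_log_normSq_one_sub {z : ℂ} (hz : ‖z‖ ≤ 1 / 2) :
    |Real.log (Complex.normSq (1 - z)) + 2 * z.re| ≤ 2 * ‖z‖ ^ 2 := by
  have h1 := Complex.norm_log_one_add_sub_self_le (z := -z) (by rw [norm_neg]; linarith)
  rw [norm_neg] at h1
  have h2 : ‖z‖ ^ 2 * (1 - ‖z‖)⁻¹ / 2 ≤ ‖z‖ ^ 2 := by
    have : (1 - ‖z‖)⁻¹ ≤ 2 := inv_le_of_inv_le₀ (by norm_num) (by linarith)
    nlinarith [sq_nonneg ‖z‖]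
  have h3 := (Complex.abs_re_le_norm _).trans (h1.trans h2)
  rw [Complex.sub_re, Complex.log_re, Complex.neg_re, ← sub_eq_add_neg, sub_neg_eq_add] at h3
  have h4 : Real.log (Complex.normSq (1 - z)) = 2 * Real.log ‖1 - z‖ := by
    rw [Complex.normSq_eq_norm_sq, Real.log_pow]
    norm_num
  rw [h4, ← mul_add, abs_mul, abs_two]
  linarith

section Uniform

variable {M : Set (ℂ × ℝ)} {L : ℂ × ℝ → ℝ} {K : Set (ℂ × ℝ)}

lemma exists_uniform_differentiability (hM : IsOpen M) (hL : ContDiffOn ℝ (⊤ : ℕ∞) L M)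
    (hK : IsCompact K) (hKM : K ⊆ M) {ω : ℝ} (hω : 0 < ω) :
    ∃ δ > 0, ∀ p ∈ K, ∀ q, ‖q - p‖ ≤ δ →
      q ∈ M ∧ |L q - L p - fderiv ℝ L p (q - p)| ≤ ω * ‖q - p‖ := by
  obtain ⟨δ₀, hδ₀, hKδ⟩ := hK.exists_cthickening_subset_open hM hKM
  have hc : IsCompact (cthickening δ₀ K) := hK.cthickening
  have hcont : ContinuousOn (fderiv ℝ L) (cthickening δ₀ K) :=
    (hL.continuousOn_fderiv_of_isOpen hM (by simp)).mono hKδ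
  obtain ⟨δ₁, hδ₁, huc⟩ := Metric.uniformContinuousOn_iff.1
    (hc.uniformContinuousOn_of_continuous hcont) ω hω
  refine ⟨min δ₀ (δ₁ / 2), lt_min hδ₀ (half_pos hδ₁), fun p hp q hq => ?_⟩
  have hball : closedBall p (min δ₀ (δ₁ / 2)) ⊆ cthickening δ₀ K := fun z hz =>
    mem_cthickening_of_dist_le z p δ₀ K hp ((mem_closedBall.1 hz).trans (min_le_left _ _))
  have hpball : p ∈ closedBall p (min δ₀ (δ₁ / 2)) :=
    mem_closedBall_self (le_min hδ₀.le (half_pos hδ₁).le)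
  have hqball : q ∈ closedBall p (min δ₀ (δ₁ / 2)) := by
    rwa [mem_closedBall, dist_eq_norm]
  refine ⟨hKδ (hball hqball), ?_⟩
  have := (convex_closedBall p (min δ₀ (δ₁ / 2))).norm_image_sub_le_of_norm_hasFDerivWithin_le'
    (φ := fderiv ℝ L p) (C := ω)
    (fun z hz => (hL.hasFDerivAt_of_isOpen hM (hKδ (hball hz))).hasFDerivWithinAt)
    (fun z hz => ?_) hpball hqball
  · simpa [Real.norm_eq_abs] using this
  · rw [← dist_eq_norm]
    refine (huc z (hball hz) p (hball hpball) (lt_of_le_of_lt (mem_closedBall.1 hz) ?_)).le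
    exact (min_le_right _ _).trans_lt (half_lt_self hδ₁)

lemma norm_wirtinger_le (L : ℂ × ℝ → ℝ) (p : ℂ × ℝ) : ‖wirtinger L p‖ ≤ ‖fderiv ℝ L p‖ := by
  have h : ∀ ζ : ℂ, ‖ζ‖ = 1 → |dirDeriv (ζ, 0) L p| ≤ ‖fderiv ℝ L p‖ := fun ζ hζ => by
    have := (fderiv ℝ L p).le_opNorm (ζ, 0)
    simpa [Prod.norm_def, hζ, dirDeriv] using this
  refine (Complex.norm_le_abs_re_add_abs_im _).trans ?_
  have h1 := h 1 (by simp)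
  have hI := h Complex.I (by simp)
  simp only [wirtinger, abs_div, abs_neg, abs_two]
  linarith

lemma exists_step_radius (hM : IsOpen M) (hL : ContDiffOn ℝ (⊤ : ℕ∞) L M)
    (hK : IsCompact K) (hKM : K ⊆ M) {ω : ℝ} (hω : 0 < ω) :
    ∃ δ > 0, ∀ y t, (y, t) ∈ K → ∀ α : ℂ, ‖α‖ ≤ δ → (y + α, t) ∈ M ∧
      Real.sqrt (Real.exp (L (y + α, t))) ≤ 2 * Real.sqrt (Real.exp (L (y, t))) ∧
      1 - wirtinger L (y, t) * α ≠ 0 ∧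
      |Real.log (Complex.normSq (1 - wirtinger L (y, t) * α)) + (L (y + α, t) - L (y, t))| ≤
        ω * ‖α‖ := by
  obtain ⟨δ₀, hδ₀, hunif⟩ := exists_uniform_differentiability hM hL hK hKM (half_pos hω)
  obtain ⟨Λ, hΛ⟩ := hK.exists_bound_of_continuousOn
    ((hL.continuousOn_fderiv_of_isOpen hM (by simp)).mono hKM)
  have hΛ0 : 0 ≤ |Λ| := abs_nonneg Λ
  refine ⟨min δ₀ (min (1 / (2 * (|Λ| + ω + 1))) (ω / (4 * (|Λ| ^ 2 + 1)))),
    lt_min hδ₀ (lt_min (by positivity) (by positivity)), fun y t hp α hα => ?_⟩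
  have hα0 := hα.trans (min_le_left _ _)
  have hα1 := (hα.trans (min_le_right _ _)).trans (min_le_left _ _)
  have hα2 := (hα.trans (min_le_right _ _)).trans (min_le_right _ _)
  rw [le_div_iff₀ (by positivity)] at hα1 hα2
  have hsub : (y + α, t) - (y, t) = ((α, 0) : ℂ × ℝ) := by simp
  have hnorm : ‖((α, 0) : ℂ × ℝ)‖ = ‖α‖ := by simp [Prod.norm_def]
  obtain ⟨hqM, hq⟩ := hunif (y, t) hp (y + α, t) (by rw [hsub, hnorm]; exact hα0)
  have hD : fderiv ℝ L (y, t) ((y + α, t) - (y, t)) = 2 * (wirtinger L (y, t) * α).re := by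
    rw [hsub]
    exact dirDeriv_space α
  rw [hD, hsub, hnorm] at hq
  have hP : ‖wirtinger L (y, t) * α‖ ≤ |Λ| * ‖α‖ := by
    rw [norm_mul]
    gcongr
    exact (norm_wirtinger_le L _).trans ((hΛ _ hp).trans (le_abs_self Λ))
  set z := wirtinger L (y, t) * α with hz
  have hn := norm_nonneg α
  have hz2 : ‖z‖ ≤ 1 / 2 := by nlinarith
  have hre := (Complex.abs_re_le_norm z).trans hP
  have hlog := Complex.abs_log_normSq_one_sub hz2
  refine ⟨hqM, ?_, ?_, ?_⟩
  · have hdiff : L (y + α, t) ≤ L (y, t) + 1 := by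
      have h1 := (abs_le.1 hq).2
      have h2 := (abs_le.1 hre).2
      nlinarith
    have h4 : Real.exp (L (y + α, t)) ≤ 2 ^ 2 * Real.exp (L (y, t)) := by
      refine (Real.exp_le_exp.2 hdiff).trans ?_
      rw [Real.exp_add, mul_comm]
      gcongr
      linarith [Real.exp_one_lt_d9]
    refine (Real.sqrt_le_sqrt h4).trans_eq ?_
    rw [Real.sqrt_mul (by norm_num), Real.sqrt_sq (by norm_num)]
  · intro h0
    have : ‖z‖ = 1 := by rw [← sub_eq_zero.1 h0, norm_one]
    linarith
  · have hzz : 2 * ‖z‖ ^ 2 ≤ ω / 2 * ‖α‖ := by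
      have : ‖z‖ ^ 2 ≤ (|Λ| * ‖α‖) ^ 2 := pow_le_pow_left₀ (norm_nonneg z) hP 2
      nlinarith [mul_le_mul_of_nonneg_right hα2 hn, mul_nonneg hn hn]
    calc |Real.log (Complex.normSq (1 - z)) + (L (y + α, t) - L (y, t))| =
          |(Real.log (Complex.normSq (1 - z)) + 2 * z.re) +
            (L (y + α, t) - L (y, t) - 2 * z.re)| := by
          congr 1
          ring
      _ ≤ 2 * ‖z‖ ^ 2 + ω / 2 * ‖α‖ := (abs_add_le _ _).trans (add_le_add hlog hq)
      _ ≤ ω * ‖α‖ := by linarith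

end Uniform

lemma PolyReach.of_chain {v : ℂ → ℝ} {Ω : Set ℂ} {x : ℂ} {r : ℝ} {y : ℕ → ℂ} {N : ℕ}
    (h0 : PolyReach v Ω x (y 0) r)
    (hstep : ∀ i < N, segment ℝ (y i) (y (i + 1)) ⊆ Ω ∧
      ∀ w ∈ segment ℝ (y i) (y (i + 1)), Real.sqrt (v w) ≤ 2 * Real.sqrt (v (y i))) :
    ∀ j ≤ N, PolyReach v Ω x (y j)
      (r + ∑ i ∈ Finset.range j, 2 * Real.sqrt (v (y i)) * ‖y (i + 1) - y i‖) := by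
  intro j
  induction j with
  | zero => exact fun _ => by simpa using h0
  | succ j ih =>
    intro hj
    have := (ih (Nat.le_of_succ_le hj)).step (hstep j hj).1 (hstep j hj).2
    rwa [Finset.sum_range_succ, ← add_assoc]

lemma two_mul_sqrt_mul_le {U a ε : ℝ} (hU : 0 ≤ U) (hε : 0 < ε) :
    2 * Real.sqrt U * a ≤ ε + U * a ^ 2 / ε := by
  have h : ε + U * a ^ 2 / ε - 2 * Real.sqrt U * a = (ε - Real.sqrt U * a) ^ 2 / ε := by
    field_simp
    nlinarith [Real.sq_sqrt hU]
  linarith [div_nonneg (sq_nonneg (ε - Real.sqrt U * a)) hε.le]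

lemma chainCost_summand_nonneg (L : ℂ × ℝ → ℝ) {ε : ℝ} (hε : 0 < ε) (t : ℝ) (y : ℕ → ℂ) (i : ℕ) :
    0 ≤ ε + Real.exp (L (y i, t)) * Complex.normSq (y (i + 1) - y i) / ε := by
  have := Complex.normSq_nonneg (y (i + 1) - y i)
  positivity

section Chain

variable {M K : Set (ℂ × ℝ)} {L : ℂ × ℝ → ℝ} {B ε A ρ a b t : ℝ} {x₀ : ℝ → ℂ} {N : ℕ} {y : ℕ → ℂ}

lemma sum_le_of_chainCost_le (hB : 0 ≤ B) (hε : 0 < ε) (hA : chainCost L B ε x₀ t N y ≤ A) {j : ℕ}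
    (hj : j ≤ N) : ∑ i ∈ Finset.range j,
      (ε + Real.exp (L (y i, t)) * Complex.normSq (y (i + 1) - y i) / ε) ≤ A := by
  refine (Finset.sum_le_sum_of_subset_of_nonneg (Finset.range_mono hj)
    fun i _ _ => chainCost_summand_nonneg L hε t y i).trans (le_trans ?_ hA)
  exact le_add_of_nonneg_left (mul_nonneg hB (Complex.normSq_nonneg _))

lemma length_mul_le_of_chainCost_le (hB : 0 ≤ B) (hε : 0 < ε)
    (hA : chainCost L B ε x₀ t N y ≤ A) : N * ε ≤ A := by
  refine le_trans ?_ (sum_le_of_chainCost_le hB hε hA le_rfl)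
  rw [Finset.sum_add_distrib, Finset.sum_const, Finset.card_range, nsmul_eq_mul]
  refine le_add_of_nonneg_right (Finset.sum_nonneg fun i _ => ?_)
  have := Complex.normSq_nonneg (y (i + 1) - y i)
  positivity

lemma action_le_of_chainCost_le (hB : 0 ≤ B) (hε : 0 < ε)
    (hA : chainCost L B ε x₀ t N y ≤ A) : ∑ i ∈ Finset.range N,
      Real.exp (L (y i, t)) * Complex.normSq (y (i + 1) - y i) / ε ≤ A := by
  refine le_trans (Finset.sum_le_sum fun i _ => ?_) (sum_le_of_chainCost_le hB hε hA le_rfl)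
  exact le_add_of_nonneg_left hε.le

lemma length_sum_le_of_chainCost_le (hB : 0 ≤ B) (hε : 0 < ε)
    (hA : chainCost L B ε x₀ t N y ≤ A) {j : ℕ} (hj : j ≤ N) : ∑ i ∈ Finset.range j,
      2 * Real.sqrt (Real.exp (L (y i, t))) * ‖y (i + 1) - y i‖ ≤ A := by
  refine le_trans (Finset.sum_le_sum fun i _ => ?_) (sum_le_of_chainCost_le hB hε hA hj)
  rw [Complex.normSq_eq_norm_sq]
  exact two_mul_sqrt_mul_le (Real.exp_pos _).le hε

lemma norm_step_le_of_chainCost_le (hB : 0 ≤ B) (hε : 0 < ε)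
    (hA : chainCost L B ε x₀ t N y ≤ A) {c δ : ℝ} (hc : 0 < c) (hδ : 0 ≤ δ)
    (hcU : ∀ i ≤ N, c ≤ Real.exp (L (y i, t))) (hεδ : A * ε ≤ c * δ ^ 2) {i : ℕ} (hi : i < N) :
    ‖y (i + 1) - y i‖ ≤ δ := by
  have h1 := (Finset.single_le_sum (f := fun i =>
    Real.exp (L (y i, t)) * Complex.normSq (y (i + 1) - y i) / ε) (fun j _ => by
      have := Complex.normSq_nonneg (y (j + 1) - y j)
      positivity) (Finset.mem_range.2 hi)).trans (action_le_of_chainCost_le hB hε hA)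
  rw [div_le_iff₀ hε, Complex.normSq_eq_norm_sq] at h1
  have h2 : c * ‖y (i + 1) - y i‖ ^ 2 ≤ c * δ ^ 2 :=
    (mul_le_mul_of_nonneg_right (hcU i hi.le) (sq_nonneg _)).trans (h1.trans hεδ)
  exact le_of_sq_le_sq (le_of_mul_le_mul_left h2 hc) hδ
  
/-- Chains of bounded cost, starting near the centre and staying in `K`. -/
structure AdmissibleChain (L : ℂ × ℝ → ℝ) (B ε A ρ a b : ℝ) (x₀ : ℝ → ℂ) (K : Set (ℂ × ℝ))
    (N : ℕ) (t : ℝ) (y : ℕ → ℂ) : Prop where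
  time : t ∈ Icc a b
  mem : ∀ i ≤ N, (y i, t) ∈ K
  fst : ∀ i, y i ∈ Prod.fst '' K
  near : ‖y 0 - x₀ t‖ ≤ ρ
  cost : chainCost L B ε x₀ t N y ≤ A

/-- The localised Harnack quantity. -/
noncomputable def chainWeight (L : ℂ × ℝ → ℝ) (B ε A a : ℝ) (x₀ : ℝ → ℂ) (N : ℕ) (t : ℝ)
    (y : ℕ → ℂ) : ℝ :=
  (t - a) * (1 - chainCost L B ε x₀ t N y / A) ^ 2 * timeDeriv L (y N, t)

namespace AdmissibleChain

lemma exists_max_of_length (hK : IsCompact K) (hL : ContinuousOn L K)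
    (hS : ContinuousOn (timeDeriv L) K) (hx₀ : Continuous x₀) (N : ℕ)
    (hne : ∃ t y, AdmissibleChain L B ε A ρ a b x₀ K N t y) :
    ∃ t y, AdmissibleChain L B ε A ρ a b x₀ K N t y ∧
      ∀ t' y', AdmissibleChain L B ε A ρ a b x₀ K N t' y' →
        chainWeight L B ε A a x₀ N t' y' ≤ chainWeight L B ε A a x₀ N t y := by
  set Z : Set (ℝ × (ℕ → ℂ)) := {p | p.1 ∈ Icc a b ∧ (∀ i, p.2 i ∈ Prod.fst '' K) ∧
    (∀ i ≤ N, (p.2 i, p.1) ∈ K) ∧ ‖p.2 0 - x₀ p.1‖ ≤ ρ} with hZ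
  have hpi : IsCompact {y : ℕ → ℂ | ∀ i, y i ∈ Prod.fst '' K} :=
    isCompact_pi_infinite fun _ => hK.image continuous_fst
  have hev : ∀ i, Continuous fun p : ℝ × (ℕ → ℂ) => p.2 i := fun i =>
    (continuous_apply i).comp continuous_snd
  have hpt : ∀ i, Continuous fun p : ℝ × (ℕ → ℂ) => (p.2 i, p.1) := fun i =>
    (hev i).prodMk continuous_fst
  have hZc : IsCompact Z := by
    have c1 : IsClosed {p : ℝ × (ℕ → ℂ) | ∀ i, p.2 i ∈ Prod.fst '' K} := by
      rw [ofPred_forall]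
      exact isClosed_iInter fun i => (hK.image continuous_fst).isClosed.preimage (hev i)
    have c2 : IsClosed {p : ℝ × (ℕ → ℂ) | ∀ i ≤ N, (p.2 i, p.1) ∈ K} := by
      simp only [ofPred_forall]
      exact isClosed_iInter fun i => isClosed_iInter fun _ => hK.isClosed.preimage (hpt i)
    have c3 : IsClosed {p : ℝ × (ℕ → ℂ) | ‖p.2 0 - x₀ p.1‖ ≤ ρ} :=
      isClosed_le ((hev 0).sub (hx₀.comp continuous_fst)).norm continuous_const
    exact (isCompact_Icc.prod hpi).of_isClosed_subset
      ((isClosed_Icc.preimage continuous_fst).inter (c1.inter (c2.inter c3)))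
      (fun p hp => ⟨hp.1, hp.2.1⟩)
  have hcomp : ∀ f : ℂ × ℝ → ℝ, ContinuousOn f K → ∀ i ≤ N,
      ContinuousOn (fun p : ℝ × (ℕ → ℂ) => f (p.2 i, p.1)) Z := fun f hf i hi =>
    hf.comp (hpt i).continuousOn fun p hp => hp.2.2.1 i hi
  have hG : ContinuousOn (fun p : ℝ × (ℕ → ℂ) => chainCost L B ε x₀ p.1 N p.2) Z := by
    refine ContinuousOn.add ?_ (continuousOn_finsetSum _ fun i hi => ?_)
    · exact ((Complex.continuous_normSq.comp ((hev 0).sub (hx₀.comp continuous_fst))).const_mul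
        B).continuousOn
    · refine (ContinuousOn.div_const (ContinuousOn.mul ?_ ?_) ε).const_add ε
      · exact (hcomp L hL i (Finset.mem_range.1 hi).le).rexp
      · exact (Complex.continuous_normSq.comp ((hev (i + 1)).sub (hev i))).continuousOn
  have hX : IsCompact (Z ∩ (fun p : ℝ × (ℕ → ℂ) => chainCost L B ε x₀ p.1 N p.2) ⁻¹' Iic A) :=
    hZc.of_isClosed_subset (hG.preimage_isClosed_of_isClosed hZc.isClosed isClosed_Iic)
      inter_subset_left
  have hiff : ∀ t y, AdmissibleChain L B ε A ρ a b x₀ K N t y ↔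
      (t, y) ∈ Z ∩ (fun p : ℝ × (ℕ → ℂ) => chainCost L B ε x₀ p.1 N p.2) ⁻¹' Iic A :=
    fun t y => ⟨fun h => ⟨⟨h.time, h.fst, h.mem, h.near⟩, h.cost⟩,
      fun h => ⟨h.1.1, h.1.2.2.1, h.1.2.1, h.1.2.2.2, h.2⟩⟩
  have hW : ContinuousOn (fun p : ℝ × (ℕ → ℂ) => chainWeight L B ε A a x₀ N p.1 p.2) Z :=
    ((continuous_fst.sub continuous_const).continuousOn.mul
      ((continuousOn_const.sub (hG.div_const A)).pow 2)).mul (hcomp _ hS N le_rfl)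
  obtain ⟨t₁, y₁, h₁⟩ := hne
  obtain ⟨p, hp, hmax⟩ := hX.exists_isMaxOn ⟨(t₁, y₁), (hiff t₁ y₁).1 h₁⟩
    (hW.mono inter_subset_left)
  exact ⟨p.1, p.2, (hiff _ _).2 hp, fun t' y' h => hmax ((hiff _ _).1 h)⟩

lemma exists_max (hK : IsCompact K) (hL : ContinuousOn L K) (hS : ContinuousOn (timeDeriv L) K)
    (hx₀ : Continuous x₀) (hB : 0 ≤ B) (hε : 0 < ε)
    (hne : ∃ N t y, AdmissibleChain L B ε A ρ a b x₀ K N t y) :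
    ∃ N t y, AdmissibleChain L B ε A ρ a b x₀ K N t y ∧
      ∀ N' t' y', AdmissibleChain L B ε A ρ a b x₀ K N' t' y' →
        chainWeight L B ε A a x₀ N' t' y' ≤ chainWeight L B ε A a x₀ N t y := by
  classical
  have hlen : ∀ N t y, AdmissibleChain L B ε A ρ a b x₀ K N t y → N ≤ ⌈A / ε⌉₊ := by
    intro N t y h
    have h1 := length_mul_le_of_chainCost_le hB hε h.cost
    rw [← le_div_iff₀ hε] at h1
    exact_mod_cast h1.trans (Nat.le_ceil _)
  have hmaxN := fun (N : ℕ) (hN : ∃ t y, AdmissibleChain L B ε A ρ a b x₀ K N t y) =>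
    exists_max_of_length hK hL hS hx₀ N hN
  choose! τ Y hadm hmax using hmaxN
  set F := (Finset.range (⌈A / ε⌉₊ + 1)).filter
    fun N => ∃ t y, AdmissibleChain L B ε A ρ a b x₀ K N t y with hF
  have hmem : ∀ N t y, AdmissibleChain L B ε A ρ a b x₀ K N t y → N ∈ F := fun N t y h =>
    Finset.mem_filter.2 ⟨Finset.mem_range.2 (Nat.lt_succ_of_le (hlen N t y h)), t, y, h⟩
  obtain ⟨N₁, t₁, y₁, h₁⟩ := hne
  obtain ⟨N, hN, hNmax⟩ := F.exists_max_image (fun N => chainWeight L B ε A a x₀ N (τ N) (Y N))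
    ⟨N₁, hmem _ _ _ h₁⟩
  refine ⟨N, τ N, Y N, hadm N (Finset.mem_filter.1 hN).2, fun N' t' y' h => ?_⟩
  exact (hmax N' ⟨t', y', h⟩ t' y' h).trans (hNmax N' (hmem _ _ _ h))

end AdmissibleChain

end Chain

section Localised

variable {M K : Set (ℂ × ℝ)} {L : ℂ × ℝ → ℝ} {B ε A ρ a b t : ℝ} {x₀ : ℝ → ℂ} {N : ℕ}
  {y η : ℕ → ℂ}

namespace AdmissibleChain

lemma eventually_space (hM : IsOpen M) (hL : ContDiffOn ℝ (⊤ : ℕ∞) L M) (hKM : K ⊆ M)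
    (h : AdmissibleChain L B ε A ρ a b x₀ K N t y) (hint : ∀ i ≤ N, (y i, t) ∈ interior K)
    (hG : chainCost L B ε x₀ t N y < A) (hnear : ‖y 0 - x₀ t‖ < ρ)
    (hη : ∀ i < N, η (i + 1) = η i * (1 - wirtinger L (y i, t) * (y (i + 1) - y i)))
    (hη0 : ∀ i, N < i → η i = 0) (d : ℂ) :
    ∀ᶠ x : ℝ in nhds 0, AdmissibleChain L B ε A ρ a b x₀ K N t fun i => y i + x * (d * η i) := by
  have hline : ∀ i, Continuous fun x : ℝ => y i + x * (d * η i) := fun i => by fun_prop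
  have h1 : ∀ᶠ x : ℝ in nhds 0, ∀ i ∈ Iic N, (y i + x * (d * η i), t) ∈ interior K := by
    refine (eventually_all_finite (finite_Iic N)).2 fun i hi => ?_
    exact ((hline i).prodMk continuous_const).continuousAt
      (isOpen_interior.mem_nhds (by simpa using hint i hi))
  have h2 : ∀ᶠ x : ℝ in nhds 0, ‖y 0 + x * (d * η 0) - x₀ t‖ < ρ :=
    (((hline 0).sub continuous_const).norm.continuousAt (x := 0)).eventually_lt_const
      (by simpa using hnear)
  have h3 := (hasJet_chainCost (B := B) (ε := ε) (x₀ := x₀) hM hL (fun i hi => hKM (h.mem i hi))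
    hη d).continuousAt.eventually_lt_const (by simpa using hG)
  filter_upwards [h1, h2, h3] with x h1 h2 h3
  refine ⟨h.time, fun i hi => interior_subset (h1 i hi), fun i => ?_, h2.le, h3.le⟩
  rcases le_or_gt i N with hi | hi
  · exact ⟨_, interior_subset (h1 i hi), rfl⟩
  · simpa [hη0 i hi] using h.fst i

lemma eventually_time (hM : IsOpen M) (hL : ContDiffOn ℝ (⊤ : ℕ∞) L M) (hKM : K ⊆ M)
    (h : AdmissibleChain L B ε A ρ a b x₀ K N t y) (hint : ∀ i ≤ N, (y i, t) ∈ interior K)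
    (hG : chainCost L B ε x₀ t N y < A) (hnear : ‖y 0 - x₀ t‖ < ρ) {v : ℂ}
    (hv : HasDerivAt x₀ v t) (hat : a < t) :
    ∀ᶠ τ in nhdsWithin t (Iio t), AdmissibleChain L B ε A ρ a b x₀ K N τ y := by
  have h1 : ∀ᶠ τ in nhds t, ∀ i ∈ Iic N, (y i, τ) ∈ interior K := by
    refine (eventually_all_finite (finite_Iic N)).2 fun i hi => ?_
    exact (Continuous.prodMk_right (y i)).continuousAt (isOpen_interior.mem_nhds (hint i hi))
  have h2 : ∀ᶠ τ in nhds t, ‖y 0 - x₀ τ‖ < ρ :=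
    (hv.continuousAt.const_sub (y 0)).norm.eventually_lt_const hnear
  have h3 := (hasDerivAt_chainCost (B := B) (ε := ε) (x₀ := x₀) hM hL
    (fun i hi => hKM (h.mem i hi)) hv).continuousAt.eventually_lt_const hG
  filter_upwards [nhdsWithin_le_nhds h1, nhdsWithin_le_nhds h2, nhdsWithin_le_nhds h3,
    self_mem_nhdsWithin, nhdsWithin_le_nhds (lt_mem_nhds hat)] with τ h1 h2 h3 h4 h5
  exact ⟨⟨h5.le, (mem_Iio.1 h4).le.trans h.time.2⟩, fun i hi => interior_subset (h1 i hi), h.fst,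
    h2.le, h3.le⟩

end AdmissibleChain

/-- Moving the start of a chain towards the centre pays off when the penalty is large. -/
lemma chainCost_prepend_lt {Um : ℝ} (hε : 0 < ε) (hερ : ε ≤ ρ) (hnear : ‖y 0 - x₀ t‖ = ρ)
    (hU : ∀ z ∈ closedBall (x₀ t) ρ, Real.exp (L (z, t)) ≤ Um) (hB : B * ρ = 2 + Um)
    (hB0 : 0 ≤ B) :
    ∃ y' : ℕ → ℂ, (∀ i, y' (i + 1) = y i) ∧ ‖y' 0 - x₀ t‖ ≤ ρ ∧
      chainCost L B ε x₀ t (N + 1) y' < chainCost L B ε x₀ t N y := by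
  have hρ : 0 < ρ := hε.trans_le hερ
  set z : ℂ := y 0 + ((ε / ρ : ℝ) : ℂ) * (x₀ t - y 0) with hz
  have hκ : ε / ρ * ρ = ε := div_mul_cancel₀ ε hρ.ne'
  have hκ1 : ε / ρ ≤ 1 := (div_le_one hρ).2 hερ
  have e1 : z - x₀ t = ((1 - ε / ρ : ℝ) : ℂ) * (y 0 - x₀ t) := by
    rw [hz]
    push_cast
    ring
  have e2 : y 0 - z = ((ε / ρ : ℝ) : ℂ) * (y 0 - x₀ t) := by
    rw [hz]
    ring
  have n1 : ‖z - x₀ t‖ = ρ - ε := by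
    rw [e1, norm_mul, hnear, Complex.norm_real, Real.norm_eq_abs, abs_of_nonneg (by linarith)]
    linarith
  have n2 : ‖y 0 - z‖ = ε := by
    rw [e2, norm_mul, hnear, Complex.norm_real, Real.norm_eq_abs,
      abs_of_nonneg (div_pos hε hρ).le, hκ]
  refine ⟨fun i => Nat.casesOn i z y, fun i => rfl, ?_, ?_⟩
  · change ‖z - x₀ t‖ ≤ ρ
    linarith
  · have hUz := hU z (by rw [mem_closedBall, dist_eq_norm]; linarith)
    rw [chainCost, chainCost, Finset.sum_range_succ']
    change B * Complex.normSq (z - x₀ t) + (_ +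
      (ε + Real.exp (L (z, t)) * Complex.normSq (y 0 - z) / ε)) < _
    rw [Complex.normSq_eq_norm_sq (z - _), Complex.normSq_eq_norm_sq (y 0 - z),
      Complex.normSq_eq_norm_sq (y 0 - _), n1, n2, hnear]
    have e3 : Real.exp (L (z, t)) * ε ^ 2 / ε = Real.exp (L (z, t)) * ε := by
      field_simp
    rw [e3]
    have e4 : Real.exp (L (z, t)) * ε ≤ Um * ε := by gcongr
    have e5 : B * (ρ - ε) ^ 2 + (2 + Um) * ε ≤ B * ρ ^ 2 := by
      rw [← hB]
      have : 0 ≤ B * (ε * (ρ - ε)) := mul_nonneg hB0 (mul_nonneg hε.le (by linarith))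
      nlinarith
    simp only
    linarith

/-- Along a chain of bounded cost there is an almost unit parallel frame. -/
lemma exists_chain_frame {c δ θ : ℝ} (hB : 0 ≤ B) (hε : 0 < ε) (hA : 0 < A)
    (hθ : 0 ≤ θ) (hcost : chainCost L B ε x₀ t N y ≤ A)
    (hcU : ∀ i ≤ N, c ≤ Real.exp (L (y i, t)))
    (hδ : ∀ i ≤ N, ∀ α : ℂ, ‖α‖ ≤ δ → 1 - wirtinger L (y i, t) * α ≠ 0 ∧
      |Real.log (Complex.normSq (1 - wirtinger L (y i, t) * α)) +
        (L (y i + α, t) - L (y i, t))| ≤ θ * Real.sqrt c / A * ‖α‖)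
    (hstep : ∀ i < N, ‖y (i + 1) - y i‖ ≤ δ) :
    ∃ η : ℕ → ℂ,
      (∀ i < N, η (i + 1) = η i * (1 - wirtinger L (y i, t) * (y (i + 1) - y i))) ∧
      (∀ i, N < i → η i = 0) ∧ Complex.normSq (η N) * Real.exp (L (y N, t)) = 1 ∧
      ∀ i ≤ N, Real.exp (-θ) ≤ Complex.normSq (η i) * Real.exp (L (y i, t)) ∧
        Complex.normSq (η i) * Real.exp (L (y i, t)) ≤ Real.exp θ := by
  refine exists_frame (fun i => 1 - wirtinger L (y i, t) * (y (i + 1) - y i))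
    (fun i => L (y i, t)) N (fun i hi => (hδ i hi.le _ (hstep i hi)).1) ?_
  have hlen := length_sum_le_of_chainCost_le hB hε hcost le_rfl
  have hterm : ∀ i ∈ Finset.range N,
      |Real.log (Complex.normSq (1 - wirtinger L (y i, t) * (y (i + 1) - y i))) +
        (L (y (i + 1), t) - L (y i, t))| ≤
      θ / A * (2 * Real.sqrt (Real.exp (L (y i, t))) * ‖y (i + 1) - y i‖) := by
    intro i hi
    have hi := Finset.mem_range.1 hi
    have h1 := (hδ i hi.le _ (hstep i hi)).2
    rw [add_sub_cancel] at h1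
    refine h1.trans ?_
    have h2 := Real.sqrt_le_sqrt (hcU i hi.le)
    have h3 := Real.sqrt_nonneg (Real.exp (L (y i, t)))
    calc θ * Real.sqrt c / A * ‖y (i + 1) - y i‖ =
          θ / A * (Real.sqrt c * ‖y (i + 1) - y i‖) := by ring
      _ ≤ _ := by
          gcongr
          linarith
  refine (Finset.sum_le_sum hterm).trans ?_
  rw [← Finset.mul_sum]
  calc _ ≤ θ / A * A := by gcongr
    _ = θ := div_mul_cancel₀ θ hA.ne'

/-- The points of a chain of bounded cost are reached by polygons of bounded length. -/
lemma exists_reach_of_chain {δ r : ℝ} (hB : 0 ≤ B) (hε : 0 < ε)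
    (hcost : chainCost L B ε x₀ t N y ≤ A)
    (hδ : ∀ i ≤ N, ∀ α : ℂ, ‖α‖ ≤ δ → (y i + α, t) ∈ M ∧
      Real.sqrt (Real.exp (L (y i + α, t))) ≤ 2 * Real.sqrt (Real.exp (L (y i, t))))
    (hstep : ∀ i < N, ‖y (i + 1) - y i‖ ≤ δ)
    (h0 : PolyReach (fun z => Real.exp (L (z, t))) (timeSlice M t) (x₀ t) (y 0) r) :
    ∀ i ≤ N, ∃ s ≤ r + A,
      PolyReach (fun z => Real.exp (L (z, t))) (timeSlice M t) (x₀ t) (y i) s := by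
  intro i hi
  refine ⟨_, ?_, h0.of_chain (N := N) (fun j hj => ?_) i hi⟩
  · have := length_sum_le_of_chainCost_le hB hε hcost hi
    linarith
  · have hseg : ∀ w ∈ segment ℝ (y j) (y (j + 1)), ‖w - y j‖ ≤ δ := fun w hw => by
      have h1 := norm_sub_le_of_mem_segment hw
      exact h1.trans (hstep j hj)
    have hw : ∀ w ∈ segment ℝ (y j) (y (j + 1)), _ ∧ _ := fun w hw => hδ j hj.le _ (hseg w hw)
    simp only [add_sub_cancel] at hw
    exact ⟨fun w hws => (hw w hws).1, fun w hws => (hw w hws).2⟩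

set_option maxHeartbeats 4000000 in
/-- Localised form of the Harnack inequality `∂ₜ log u ≤ 1 / (t - a)`. -/
theorem localised_harnack (hM : IsOpen M) (hL : ContDiffOn ℝ (⊤ : ℕ∞) L M)
    (heq : ∀ p ∈ M, Real.exp (L p) * timeDeriv L p = spaceLap L p) (hab : a < b) (hρ : 0 < ρ)
    (hA : 0 < A) (hx₀ : ContDiff ℝ 1 x₀) {um Um V : ℝ} (hum : 0 < um)
    (htube : ∀ t ∈ Icc a b, ∀ z ∈ closedBall (x₀ t) ρ,
      (z, t) ∈ M ∧ um ≤ Real.exp (L (z, t)) ∧ Real.exp (L (z, t)) ≤ Um)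
    (hV : ∀ t ∈ Icc a b, ‖deriv x₀ t‖ ≤ V)
    (hconf : ∀ A, ∃ K, IsCompact K ∧ K ⊆ M ∧ ∀ t ∈ Icc a b, ∀ z r, r ≤ A →
      PolyReach (fun z => Real.exp (L (z, t))) (timeSlice M t) (x₀ t) z r → (z, t) ∈ K) :
    (b - a) * timeDeriv L (x₀ b, b) ≤
      1 + (b - a) * (2 * (2 * (2 + Um) * V + 8 * ((2 + Um) / ρ) / um + 1) / A +
        6 * (8 * (2 + Um) ^ 2 / um) / A ^ 2) := by
  have hbI : b ∈ Icc a b := right_mem_Icc.2 hab.le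
  have hself : ∀ t, x₀ t ∈ closedBall (x₀ t) ρ := fun t => mem_closedBall_self hρ.le
  have hUm : 0 < Um := hum.trans_le ((htube b hbI _ (hself b)).2.1.trans (htube b hbI _ (hself b)).2.2)
  have hV0 : 0 ≤ V := (norm_nonneg _).trans (hV b hbI)
  set B := (2 + Um) / ρ with hBdef
  have hBρ : B * ρ = 2 + Um := div_mul_cancel₀ _ hρ.ne'
  have hB : 0 < B := by positivity
  set C := 2 * (2 + Um) * V + 8 * B / um + 1 with hCdef
  set Q := 8 * (2 + Um) ^ 2 / um with hQdef
  have hC : 0 ≤ C := by positivity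
  have hQ0 : 0 ≤ Q := by positivity
  have hba : 0 < b - a := sub_pos.2 hab
  have hrhs : 0 ≤ (b - a) * (2 * C / A + 6 * Q / A ^ 2) := by positivity
  rcases le_or_gt (timeDeriv L (x₀ b, b)) 0 with hS0 | hS0
  · linarith [mul_nonpos_of_nonneg_of_nonpos hba.le hS0]
  obtain ⟨K₀, hK₀, hK₀M, hreach⟩ := hconf (Real.sqrt Um * ρ + A)
  obtain ⟨K, hK, hK₀K, hKM⟩ := exists_compact_between hK₀ hM hK₀M
  have hLK := hL.continuousOn.mono hKM
  have hSK := (hL.dirDeriv hM (0, 1)).continuousOn.mono hKM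
  obtain ⟨R, hR⟩ := hK.exists_bound_of_continuousOn hLK
  obtain ⟨Sm, hSm⟩ := hK.exists_bound_of_continuousOn hSK
  set c := Real.exp (-R) with hc
  have hc0 : 0 < c := Real.exp_pos _
  have hcU : ∀ p ∈ K, c ≤ Real.exp (L p) := fun p hp =>
    Real.exp_le_exp.2 (abs_le.1 (hR p hp)).1
  set κ := 1 / (|Sm| * A + 1) with hκ
  have hκ0 : 0 < κ := by positivity
  set θ := Real.log (1 + κ) with hθ
  have hθ0 : 0 < θ := Real.log_pos (by linarith)
  obtain ⟨δ, hδ0, hδ⟩ := exists_step_radius hM hL hK hKM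
    (ω := θ * Real.sqrt c / A) (by have := Real.sqrt_pos.2 hc0; positivity)
  set ε := min ρ (c * δ ^ 2 / A) with hε
  have hε0 : 0 < ε := lt_min hρ (by positivity)
  have hεδ : A * ε ≤ c * δ ^ 2 := by
    have := min_le_right ρ (c * δ ^ 2 / A)
    rwa [le_div_iff₀ hA, mul_comm] at this
  have htubeReach : ∀ t ∈ Icc a b, ∀ z ∈ closedBall (x₀ t) ρ,
      ∃ r ≤ Real.sqrt Um * ρ, PolyReach (fun z => Real.exp (L (z, t))) (timeSlice M t) (x₀ t) z r := by
    intro t ht z hz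
    have hseg : segment ℝ (x₀ t) z ⊆ closedBall (x₀ t) ρ :=
      (convex_closedBall _ _).segment_subset (hself t) hz
    refine ⟨_, ?_, PolyReach.refl.step (c := Real.sqrt Um) (fun w hw => (htube t ht w (hseg hw)).1)
      fun w hw => Real.sqrt_le_sqrt (htube t ht w (hseg hw)).2.2⟩
    rw [zero_add]
    rw [mem_closedBall, dist_eq_norm] at hz
    gcongr
  have hmemK₀ : ∀ N t y, AdmissibleChain L B ε A ρ a b x₀ K N t y → ∀ i ≤ N, (y i, t) ∈ K₀ := by
    intro N t y h i hi
    obtain ⟨r, hr, h0⟩ := htubeReach t h.time (y 0) (by rw [mem_closedBall, dist_eq_norm]; exact h.near)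
    obtain ⟨s, hs, h1⟩ := exists_reach_of_chain hB.le hε0 h.cost
      (fun i hi α hα => ⟨(hδ _ _ (h.mem i hi) α hα).1, (hδ _ _ (h.mem i hi) α hα).2.1⟩)
      (fun i hi => norm_step_le_of_chainCost_le hB.le hε0 h.cost hc0 hδ0.le
        (fun j hj => hcU _ (h.mem j hj)) hεδ hi) h0 i hi
    exact hreach t h.time _ s (by linarith) h1
  have hcenter : ∀ t ∈ Icc a b, ∀ z ∈ closedBall (x₀ t) ρ, (z, t) ∈ K := by
    intro t ht z hz
    obtain ⟨r, hr, h0⟩ := htubeReach t ht z hz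
    exact interior_subset (hK₀K (hreach t ht z r (by linarith) h0))
  have htriv : AdmissibleChain L B ε A ρ a b x₀ K 0 b fun _ => x₀ b :=
    ⟨hbI, fun _ _ => hcenter b hbI _ (hself b), fun _ => ⟨_, hcenter b hbI _ (hself b), rfl⟩,
      by simpa using hρ.le, by simpa [chainCost] using hA.le⟩
  obtain ⟨N, t, y, hadm, hmax⟩ := AdmissibleChain.exists_max hK hLK hSK hx₀.continuous hB.le hε0
    ⟨0, b, _, htriv⟩
  have hWb : (b - a) * timeDeriv L (x₀ b, b) ≤ chainWeight L B ε A a x₀ N t y := by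
    simpa [chainWeight, chainCost] using hmax _ _ _ htriv
  refine hWb.trans ?_
  have hW : 0 < chainWeight L B ε A a x₀ N t y := (mul_pos hba hS0).trans_le hWb
  have hta : 0 ≤ t - a := sub_nonneg.2 hadm.time.1
  have hsq : 0 ≤ (1 - chainCost L B ε x₀ t N y / A) ^ 2 := sq_nonneg _
  have hS : 0 < timeDeriv L (y N, t) := pos_of_mul_pos_right hW (mul_nonneg hta hsq)
  have hprod : 0 < (t - a) * (1 - chainCost L B ε x₀ t N y / A) ^ 2 :=
    pos_of_mul_pos_left hW hS.le
  have hat : 0 < t - a := pos_of_mul_pos_left hprod hsq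
  have hG : chainCost L B ε x₀ t N y < A := by
    refine lt_of_le_of_ne hadm.cost fun h => ?_
    rw [h, div_self hA.ne'] at hprod
    simp at hprod
  have hint : ∀ i ≤ N, (y i, t) ∈ interior K := fun i hi => hK₀K (hmemK₀ N t y hadm i hi)
  have hyM : ∀ i ≤ N, (y i, t) ∈ M := fun i hi => hKM (hadm.mem i hi)
  have hy0 : y 0 ∈ closedBall (x₀ t) ρ := by
    rw [mem_closedBall, dist_eq_norm]
    exact hadm.near
  have hnear : ‖y 0 - x₀ t‖ < ρ := by
    refine lt_of_le_of_ne hadm.near fun h => ?_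
    obtain ⟨y', hy', hnear', hcost'⟩ := chainCost_prepend_lt (L := L) (ε := ε) (N := N) hε0 (min_le_left _ _) h
      (fun z hz => (htube t hadm.time z hz).2.2) hBρ hB.le
    have hy'0 := hcenter t hadm.time (y' 0) (by rw [mem_closedBall, dist_eq_norm]; exact hnear')
    have hadm' : AdmissibleChain L B ε A ρ a b x₀ K (N + 1) t y' := by
      refine ⟨hadm.time, fun i hi => ?_, fun i => ?_, hnear', hcost'.le.trans hadm.cost⟩
      · cases i with
        | zero => exact hy'0
        | succ i => exact hy' i ▸ hadm.mem i (by omega)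
      · cases i with
        | zero => exact ⟨_, hy'0, rfl⟩
        | succ i => exact hy' i ▸ hadm.fst i
    have hle := hmax _ _ _ hadm'
    rw [chainWeight, chainWeight, hy' N, mul_le_mul_iff_of_pos_right hS,
      mul_le_mul_iff_of_pos_left hat] at hle
    have h1 : chainCost L B ε x₀ t N y / A < 1 := (div_lt_one hA).2 hG
    have h2 : chainCost L B ε x₀ t (N + 1) y' / A < chainCost L B ε x₀ t N y / A := by gcongr
    nlinarith
  obtain ⟨η, hη, hη0, hηN, hηb⟩ := exists_chain_frame (δ := δ) hB.le hε0 hA hθ0.le hadm.cost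
    (fun i hi => hcU _ (hadm.mem i hi)) (fun i hi α hα => (hδ _ _ (hadm.mem i hi) α hα).2.2)
    (fun i hi => norm_step_le_of_chainCost_le hB.le hε0 hadm.cost hc0 hδ0.le
        (fun j hj => hcU _ (hadm.mem j hj)) hεδ hi)
  have hexpθ : Real.exp θ = 1 + κ := Real.exp_log (by linarith)
  have hκ1 : κ ≤ 1 := by
    rw [hκ, div_le_one (by positivity)]
    have : 0 ≤ |Sm| * A := by positivity
    linarith
  have hη2 : Complex.normSq (η 0) ≤ 2 / um := by
    rw [le_div_iff₀ hum]
    have h1 := (hηb 0 (Nat.zero_le N)).2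
    have h2 := (htube t hadm.time (y 0) hy0).2.1
    nlinarith [Complex.normSq_nonneg (η 0)]
  have hunit : ∀ i ≤ N, |Complex.normSq (η i) * Real.exp (L (y i, t)) - 1| ≤ κ := by
    intro i hi
    obtain ⟨h1, h2⟩ := hηb i hi
    rw [Real.exp_neg, hexpθ] at h1
    rw [hexpθ] at h2
    have h3 : 1 - κ ≤ (1 + κ)⁻¹ := by
      rw [← one_div, le_div_iff₀ (by linarith)]
      nlinarith
    rw [abs_le]
    constructor <;> linarith
  have hv : HasDerivAt x₀ (deriv x₀ t) t := (hx₀.differentiable (by norm_num) t).hasDerivAt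
  refine (weighted_max_le hM hL heq (C := C) (Q := Q) hB.le hε0 hA hC (sub_pos.1 hat) hv hyM hG hS hη hηN
    (fun d => ?_) ?_ ?_ ?_).trans ?_
  · filter_upwards [hadm.eventually_space hM hL hKM hint hG hnear hη hη0 d] with x hx
    exact hmax _ _ _ hx
  · filter_upwards [hadm.eventually_time hM hL hKM hint hG hnear hv (sub_pos.1 hat)] with τ hτ
    exact hmax _ _ _ hτ
  · rw [Complex.normSq_eq_norm_sq (y 0 - _)]
    have h1 : ‖y 0 - x₀ t‖ ^ 2 ≤ ρ ^ 2 := pow_le_pow_left₀ (norm_nonneg _) hnear.le 2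
    calc 4 * B ^ 2 * ‖y 0 - x₀ t‖ ^ 2 * Complex.normSq (η 0) ≤ 4 * B ^ 2 * ρ ^ 2 * (2 / um) := by
          gcongr
          exact Complex.normSq_nonneg _
      _ = Q := by
          rw [hQdef, ← hBρ]
          ring
  · have h1 : 4 * B * Complex.normSq (η 0) ≤ 8 * B / um := by
      calc _ ≤ 4 * B * (2 / um) := by gcongr
        _ = _ := by ring
    have h2 : 2 * B * ((y 0 - x₀ t).re * (deriv x₀ t).re + (y 0 - x₀ t).im * (deriv x₀ t).im) ≤
        2 * (2 + Um) * V := by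
      have h3 : (y 0 - x₀ t).re * (deriv x₀ t).re + (y 0 - x₀ t).im * (deriv x₀ t).im ≤ ρ * V := by
        have h4 := Complex.re_le_norm (starRingEnd ℂ (y 0 - x₀ t) * deriv x₀ t)
        rw [norm_mul, Complex.norm_conj, Complex.mul_re, Complex.conj_re, Complex.conj_im] at h4
        have h5 := mul_le_mul hnear.le (hV t hadm.time) (norm_nonneg _) hρ.le
        linarith
      calc _ ≤ 2 * B * (ρ * V) := by gcongr
        _ = 2 * (B * ρ) * V := by ring
        _ = _ := by rw [hBρ]
    have h6 : ∑ i ∈ Finset.range N,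
        Real.exp (L (y i, t)) * Complex.normSq (y (i + 1) - y i) / ε *
          (timeDeriv L (y i, t) * (Complex.normSq (η i) * Real.exp (L (y i, t)) - 1)) ≤ 1 := by
      have h7 : ∀ i ∈ Finset.range N,
          Real.exp (L (y i, t)) * Complex.normSq (y (i + 1) - y i) / ε *
            (timeDeriv L (y i, t) * (Complex.normSq (η i) * Real.exp (L (y i, t)) - 1)) ≤
          Real.exp (L (y i, t)) * Complex.normSq (y (i + 1) - y i) / ε * (|Sm| * κ) := by
        intro i hi
        have hi := (Finset.mem_range.1 hi).le
        have h8 := Complex.normSq_nonneg (y (i + 1) - y i)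
        refine mul_le_mul_of_nonneg_left ((le_abs_self _).trans ?_) (by positivity)
        rw [abs_mul]
        exact mul_le_mul ((hSm _ (hadm.mem i hi)).trans (le_abs_self Sm)) (hunit i hi)
          (abs_nonneg _) (abs_nonneg _)
      refine (Finset.sum_le_sum h7).trans ?_
      rw [← Finset.sum_mul]
      calc _ ≤ A * (|Sm| * κ) := by
            gcongr
            exact action_le_of_chainCost_le hB.le hε0 hadm.cost
        _ = |Sm| * A / (|Sm| * A + 1) := by
            rw [hκ]
            ring
        _ ≤ 1 := by
            rw [div_le_one (by positivity)]
            linarith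
    linarith
  · have : t - a ≤ b - a := by linarith [hadm.time.2]
    gcongr

end Localised

section Pointwise

variable {M : Set (ℂ × ℝ)} {a b T : ℝ} {u : ℂ → ℝ → ℝ}

/-- A continuous planar curve is uniformly close to a smooth one with the same endpoint. -/
lemma exists_contDiff_near (hab : a ≤ b) {γ : ℝ → ℂ} (hγ : ContinuousOn γ (Icc a b)) {δ : ℝ}
    (hδ : 0 < δ) : ∃ x₀ : ℝ → ℂ, ContDiff ℝ 1 x₀ ∧ x₀ b = γ b ∧
      ∀ t ∈ Icc a b, ‖x₀ t - γ t‖ ≤ δ := by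
  obtain ⟨p, hp⟩ := exists_polynomial_near_of_continuousOn a b (fun t => (γ t).re)
    (Complex.continuous_re.comp_continuousOn hγ) (δ / 4) (by positivity)
  obtain ⟨q, hq⟩ := exists_polynomial_near_of_continuousOn a b (fun t => (γ t).im)
    (Complex.continuous_im.comp_continuousOn hγ) (δ / 4) (by positivity)
  set x : ℝ → ℂ := fun t => ((p.eval t : ℝ) : ℂ) + ((q.eval t : ℝ) : ℂ) * Complex.I with hx
  have hclose : ∀ t ∈ Icc a b, ‖x t - γ t‖ ≤ δ / 2 := by
    intro t ht
    have h1 := Complex.norm_le_abs_re_add_abs_im (x t - γ t)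
    have h2 := hp t ht
    have h3 := hq t ht
    simp only [hx, Complex.sub_re, Complex.sub_im, Complex.add_re, Complex.add_im,
      Complex.mul_re, Complex.mul_im, Complex.ofReal_re, Complex.ofReal_im, Complex.I_re,
      Complex.I_im, mul_zero, mul_one, sub_zero, add_zero, zero_add] at h1
    linarith
  have hsm : ContDiff ℝ 1 x := by
    have h1 : ContDiff ℝ 1 fun t : ℝ => ((p.eval t : ℝ) : ℂ) :=
      Complex.ofRealCLM.contDiff.comp (by simpa using p.contDiff_aeval (𝕜 := ℝ) 1)
    have h2 : ContDiff ℝ 1 fun t : ℝ => ((q.eval t : ℝ) : ℂ) :=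
      Complex.ofRealCLM.contDiff.comp (by simpa using q.contDiff_aeval (𝕜 := ℝ) 1)
    exact h1.add (h2.mul contDiff_const)
  refine ⟨fun t => x t + (γ b - x b), hsm.add contDiff_const, by simp, fun t ht => ?_⟩
  have h1 := hclose t ht
  have h2 := hclose b (right_mem_Icc.2 hab)
  calc ‖x t + (γ b - x b) - γ t‖ = ‖(x t - γ t) - (x b - γ b)‖ := by
        congr 1
        ring
    _ ≤ ‖x t - γ t‖ + ‖x b - γ b‖ := norm_sub_le _ _
    _ ≤ δ := by linarith

/-- A time-preserving path can be smoothed, with a uniform tube around it in the spacetime. -/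
lemma exists_smooth_tube (hM : IsOpen M) (hab : a ≤ b) {γ : ℝ → ℂ} (hγ : ContinuousOn γ (Icc a b))
    (hγM : ∀ t ∈ Icc a b, (γ t, t) ∈ M) :
    ∃ ρ > 0, ∃ x₀ : ℝ → ℂ, ContDiff ℝ 1 x₀ ∧ x₀ b = γ b ∧ ∃ K, IsCompact K ∧ K ⊆ M ∧
      ∀ t ∈ Icc a b, ∀ z ∈ closedBall (x₀ t) ρ, (z, t) ∈ K := by
  have hG : IsCompact ((fun t => (γ t, t)) '' Icc a b) :=
    isCompact_Icc.image_of_continuousOn (hγ.prodMk continuousOn_id)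
  obtain ⟨δ, hδ, hδM⟩ := hG.exists_cthickening_subset_open hM
    (by rintro _ ⟨t, ht, rfl⟩; exact hγM t ht)
  obtain ⟨x₀, hx₀, hb, hx⟩ := exists_contDiff_near hab hγ (half_pos hδ)
  refine ⟨δ / 2, half_pos hδ, x₀, hx₀, hb, _, hG.cthickening, hδM, fun t ht z hz => ?_⟩
  refine mem_cthickening_of_dist_le (z, t) (γ t, t) δ _ ⟨t, ht, rfl⟩ ?_
  have h1 : dist (x₀ t) (γ t) ≤ δ / 2 := by
    rw [dist_eq_norm]
    exact hx t ht
  rw [Prod.dist_eq, dist_self]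
  refine max_le ?_ hδ.le
  have h2 := dist_triangle z (x₀ t) (γ t)
  rw [mem_closedBall] at hz
  simp only
  linarith

lemma PolyReach.congr {v w : ℂ → ℝ} {Ω : Set ℂ} {x z : ℂ} {r : ℝ} (h : EqOn v w Ω)
    (hr : PolyReach v Ω x z r) : PolyReach w Ω x z r := by
  induction hr with
  | refl => exact .refl
  | step _ hs hc ih => exact ih.step hs fun y hy => h (hs hy) ▸ hc y hy

/-- The Harnack inequality `∂ₜ log u ≤ 1 / (t - a)` at the endpoint of a time-preserving path. -/
theorem harnack_of_path (hM : IsOpen M) {L : ℂ × ℝ → ℝ} (hL : ContDiffOn ℝ (⊤ : ℕ∞) L M)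
    (heq : ∀ p ∈ M, Real.exp (L p) * timeDeriv L p = spaceLap L p) (hab : a < b)
    (hconf : ∀ t ∈ Icc a b, ∀ x ∈ timeSlice M t, ∀ A,
      Confined (fun z => Real.exp (L (z, t))) (timeSlice M t) x A)
    {γ : ℝ → ℂ} (hγ : ContinuousOn γ (Icc a b)) (hγM : ∀ t ∈ Icc a b, (γ t, t) ∈ M) :
    (b - a) * timeDeriv L (γ b, b) ≤ 1 := by
  obtain ⟨ρ, hρ, x₀, hx₀, hb, K, hK, hKM, htube⟩ := exists_smooth_tube hM hab.le hγ hγM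
  obtain ⟨R, hR⟩ := hK.exists_bound_of_continuousOn (hL.continuousOn.mono hKM)
  obtain ⟨V, hV⟩ := (isCompact_Icc (a := a) (b := b)).exists_bound_of_continuousOn
    (hx₀.continuous_deriv le_rfl).continuousOn
  have hx₀M : ∀ t ∈ Icc a b, (x₀ t, t) ∈ M := fun t ht =>
    hKM (htube t ht _ (mem_closedBall_self hρ.le))
  have hmain := fun (A : ℝ) (hA : 0 < A) => localised_harnack hM hL heq hab hρ hA hx₀
    (Real.exp_pos (-R)) (Um := Real.exp R) (fun t ht z hz => ⟨hKM (htube t ht z hz),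
      Real.exp_le_exp.2 (abs_le.1 (hR _ (htube t ht z hz))).1,
      Real.exp_le_exp.2 (abs_le.1 (hR _ (htube t ht z hz))).2⟩) hV
    (exists_compact_spacetime hM (U := fun p => Real.exp (L p))
      (Real.continuous_exp.comp_continuousOn hL.continuousOn) (fun p _ => Real.exp_pos _)
      hx₀.continuous.continuousOn hx₀M fun t ht A => hconf t ht _ (hx₀M t ht) A)
  rw [hb] at hmain
  set C := 2 * (2 * (2 + Real.exp R) * V + 8 * ((2 + Real.exp R) / ρ) / Real.exp (-R) + 1)
  set Q := 6 * (8 * (2 + Real.exp R) ^ 2 / Real.exp (-R))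
  have hlim : Tendsto (fun A : ℝ => 1 + (b - a) * (C / A + Q / A ^ 2)) atTop
      (nhds (1 + (b - a) * (0 + 0))) := by
    refine tendsto_const_nhds.add (tendsto_const_nhds.mul (Tendsto.add ?_ ?_))
    · exact tendsto_const_nhds.div_atTop tendsto_id
    · exact tendsto_const_nhds.div_atTop (tendsto_pow_atTop two_ne_zero)
  rw [add_zero, mul_zero, add_zero] at hlim
  refine ge_of_tendsto hlim ?_
  filter_upwards [eventually_gt_atTop 0] with A hA
  exact hmain A hA

lemma lap_slice_eq_spaceLap (hM : IsOpen M) {L : ℂ × ℝ → ℝ} (hL : ContDiffOn ℝ (⊤ : ℕ∞) L M)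
    {p : ℂ × ℝ} (hp : p ∈ M) : lap (fun z => L (z, p.2)) p.1 = spaceLap L p := by
  have hslice : ∀ {f : ℂ × ℝ → ℝ} {z ζ : ℂ}, ContDiffOn ℝ (⊤ : ℕ∞) f M → (z, p.2) ∈ M →
      fderiv ℝ (fun z => f (z, p.2)) z ζ = dirDeriv (ζ, 0) f (z, p.2) := by
    intro f z ζ hf hz
    have h1 : HasFDerivAt (fun z : ℂ => (z, p.2)) (ContinuousLinearMap.inl ℝ ℂ ℝ) z :=
      (hasFDerivAt_id z).prodMk (hasFDerivAt_const p.2 z)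
    have h2 := (hf.hasFDerivAt_of_isOpen hM hz).comp z h1
    have h3 := h2.fderiv
    simp only [Function.comp_def] at h3
    rw [h3]
    rfl
  have hopen : IsOpen (timeSlice M p.2) := hM.preimage (by fun_prop : Continuous fun z : ℂ => (z, p.2))
  have hsm : ContDiffOn ℝ (⊤ : ℕ∞) (fun z => L (z, p.2)) (timeSlice M p.2) :=
    hL.comp (by fun_prop) fun z hz => hz
  have hd : DifferentiableAt ℝ (fderiv ℝ fun z => L (z, p.2)) p.1 :=
    ((hsm.fderiv_of_isOpen (m := (⊤ : ℕ∞)) hopen (by simp)).contDiffAt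
      (hopen.mem_nhds hp)).differentiableAt (by simp)
  have hsecond : ∀ ζ : ℂ, iteratedFDeriv ℝ 2 (fun z => L (z, p.2)) p.1 ![ζ, ζ] =
      dirDeriv (ζ, 0) (dirDeriv (ζ, 0) L) p := by
    intro ζ
    rw [iteratedFDeriv_two_apply]
    have h1 : fderiv ℝ (fun z => fderiv ℝ (fun z => L (z, p.2)) z ζ) p.1 ζ =
        fderiv ℝ (fderiv ℝ fun z => L (z, p.2)) p.1 ζ ζ := by
      rw [fderiv_clm_apply hd (differentiableAt_const ζ)]
      simp
    have h2 : (fun z => fderiv ℝ (fun z => L (z, p.2)) z ζ) =ᶠ[nhds p.1]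
        fun z => dirDeriv (ζ, 0) L (z, p.2) := by
      filter_upwards [hopen.mem_nhds hp] with z hz
      exact hslice hL hz
    simp only [Matrix.cons_val_zero, Matrix.cons_val_one]
    rw [← h1, h2.fderiv_eq, hslice (hL.dirDeriv hM _) hp]
  rw [lap, hsecond, hsecond, spaceLap]

namespace ConfRFS

lemma contDiffOn_log (h : ConfRFS T M u) :
    ContDiffOn ℝ (⊤ : ℕ∞) (fun p : ℂ × ℝ => Real.log (u p.1 p.2)) M :=
  h.smooth.log fun p hp => (h.pos p hp).ne'

lemma exp_log_mul_timeDeriv (h : ConfRFS T M u) {p : ℂ × ℝ} (hp : p ∈ M) :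
    Real.exp (Real.log (u p.1 p.2)) * timeDeriv (fun p : ℂ × ℝ => Real.log (u p.1 p.2)) p =
      spaceLap (fun p : ℂ × ℝ => Real.log (u p.1 p.2)) p := by
  rw [← lap_slice_eq_spaceLap h.opn h.contDiffOn_log hp, ← h.lfde p hp, Real.exp_log (h.pos p hp)]
  have h1 : HasDerivAt (u p.1) (timeDeriv (fun p : ℂ × ℝ => u p.1 p.2) p) p.2 :=
    hasDerivAt_time h.opn h.smooth (y := p.1) (t := p.2) hp
  have h2 := hasDerivAt_time h.opn h.contDiffOn_log (y := p.1) (t := p.2) hp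
  have h3 := h2.unique (h1.log (h.pos p hp).ne')
  rw [h1.deriv, show timeDeriv (fun p : ℂ × ℝ => Real.log (u p.1 p.2)) p = _ from h3]
  exact mul_div_cancel₀ _ (h.pos p hp).ne'

lemma confined_exp_log (h : ConfRFS T M u) (hcomp : ConfRFSComplete T M u) {t : ℝ} {x : ℂ}
    (hx : x ∈ timeSlice M t) (A : ℝ) :
    Confined (fun z => Real.exp (Real.log (u z t))) (timeSlice M t) x A := by
  have hcont : Continuous fun z : ℂ => (z, t) := by fun_prop
  obtain ⟨K, hK, hKM, hr⟩ := Confined.of_complete (h.opn.preimage hcont)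
    (h.smooth.continuousOn.comp hcont.continuousOn fun z hz => hz)
    (fun z hz => h.pos (z, t) hz) (hcomp t (h.sub hx)) hx A
  exact ⟨K, hK, hKM, fun z s hs hz =>
    hr z s hs (hz.congr fun y hy => Real.exp_log (h.pos (y, t) hy))⟩

/-- The Harnack inequality `∂ₜ log u ≤ 1 / t` on a complete initially determined spacetime. -/
theorem mul_timeDeriv_log_le_one (h : ConfRFS T M u) (hcomp : ConfRFSComplete T M u)
    (hid : InitiallyDetermined M) {z : ℂ} {t : ℝ} (hz : (z, t) ∈ M) :
    t * timeDeriv (fun p : ℂ × ℝ => Real.log (u p.1 p.2)) (z, t) ≤ 1 := by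
  have ht : 0 < t := (h.sub hz).1
  set S := timeDeriv (fun p : ℂ × ℝ => Real.log (u p.1 p.2)) (z, t)
  refine le_of_forall_pos_le_add fun ε hε => ?_
  have hinf : sInf {s : ℝ | 0 < s ∧ s ≤ t ∧ TimePreservingFrom M s z t} <
      min t (ε / (|S| + 1)) := by
    refine (hid (z, t) hz).trans_lt ?_
    exact lt_min ht (by positivity)
  have hne : {s : ℝ | 0 < s ∧ s ≤ t ∧ TimePreservingFrom M s z t}.Nonempty := by
    refine ⟨t, ht, le_rfl, fun _ => z, continuousOn_const, fun r hr => ?_, rfl⟩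
    rw [Icc_self, mem_singleton_iff] at hr
    rwa [hr]
  obtain ⟨a, ⟨ha0, -, γ, hγ, hγM, rfl⟩, hlt⟩ := exists_lt_of_csInf_lt hne hinf
  have hat := hlt.trans_le (min_le_left _ _)
  have haε := hlt.trans_le (min_le_right _ _)
  have hmain := harnack_of_path h.opn h.contDiffOn_log (fun p hp => h.exp_log_mul_timeDeriv hp) hat
    (fun t _ x hx A => h.confined_exp_log hcomp hx A) hγ hγM
  rw [lt_div_iff₀ (by positivity)] at haε
  have h1 : a * S ≤ a * |S| := by
    gcongr
    exact le_abs_self S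
  change (t - a) * S ≤ 1 at hmain
  linarith

/-- Along a worldline, `u / t` is nonincreasing. -/
theorem le_div_mul (h : ConfRFS T M u) (hcomp : ConfRFSComplete T M u)
    (hid : InitiallyDetermined M) {z : ℂ} {s t : ℝ} (hst : s ≤ t)
    (hz : ∀ r ∈ Icc s t, (z, r) ∈ M) : u z t ≤ t / s * u z s := by
  have hr0 : ∀ r ∈ Icc s t, 0 < r := fun r hr => (h.sub (hz r hr)).1
  have hs := left_mem_Icc.2 hst
  have ht := right_mem_Icc.2 hst
  have hderiv : ∀ r ∈ Icc s t, HasDerivAt (fun r => Real.log (u z r) - Real.log r)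
      (timeDeriv (fun p : ℂ × ℝ => Real.log (u p.1 p.2)) (z, r) - r⁻¹) r := fun r hr =>
    (hasDerivAt_time h.opn h.contDiffOn_log (hz r hr)).sub (Real.hasDerivAt_log (hr0 r hr).ne')
  have hanti : AntitoneOn (fun r => Real.log (u z r) - Real.log r) (Icc s t) := by
    refine antitoneOn_of_deriv_nonpos (convex_Icc s t)
      (fun r hr => (hderiv r hr).continuousAt.continuousWithinAt) (fun r hr => ?_) fun r hr => ?_
    · exact (hderiv r (interior_subset hr)).differentiableAt.differentiableWithinAt
    · have hr := interior_subset hr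
      rw [(hderiv r hr).deriv, sub_nonpos, ← one_div, le_div_iff₀ (hr0 r hr), mul_comm]
      exact h.mul_timeDeriv_log_le_one hcomp hid (hz r hr)
  have h1 := hanti hs ht hst
  have hus := h.pos _ (hz s hs)
  have hut := h.pos _ (hz t ht)
  have hs0 := hr0 s hs
  have ht0 := hr0 t ht
  simp only at h1 hus hut
  rw [← Real.log_le_log_iff hut (by positivity), Real.log_mul (by positivity) hus.ne',
    Real.log_div ht0.ne' hs0.ne']
  linarith

end ConfRFS

end Pointwise

/-- The parameters whose worldline stays in an open set during a compact time interval form a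
relatively open set. -/
lemma isOpen_worldlines {M : Set (ℂ × ℝ)} (hM : IsOpen M) (a b : ℝ) :
    IsOpen {z : ℂ | ∀ r ∈ Icc a b, (z, r) ∈ M} := by
  rw [isOpen_iff_mem_nhds]
  intro z hz
  obtain ⟨U, V, hU, -, hzU, hV, hUV⟩ := generalized_tube_lemma (isCompact_singleton (x := z))
    (isCompact_Icc (a := a) (b := b)) hM (by
      rintro ⟨_, r⟩ ⟨rfl, hr⟩
      exact hz r hr)
  filter_upwards [hU.mem_nhds (singleton_subset_iff.1 hzU)] with w hw r hr
  exact hUV ⟨hw, hV hr⟩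

/-- Simple Harnack estimate, initially determined case. -/
theorem simple_harnack_estimate
    (T : ℝ) (hT : 0 < T) (M : Set (ℂ × ℝ)) (u : ℂ → ℝ → ℝ)
    (hRF : ConfRFS T M u) (hcomp : ConfRFSComplete T M u) (hid : InitiallyDetermined M)
    (t₀ : ℝ) (ht₀ : t₀ ∈ Ioo (0:ℝ) T)
    (γ : ℝ → ℂ) (hγ : ContDiffOn ℝ 1 γ (Icc 0 1))
    (hγ' : ∀ s ∈ Icc (0:ℝ) 1, derivWithin γ (Icc 0 1) s ≠ 0)
    (hγM : ∀ s ∈ Icc (0:ℝ) 1, (γ s, t₀) ∈ M) :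
    ∀ t : ℝ, t₀ ≤ t → t < T →
      ∫ s in {s ∈ Icc (0:ℝ) 1 | ∀ r ∈ Icc t₀ t, (γ s, r) ∈ M},
          Real.sqrt (u (γ s) t) * ‖derivWithin γ (Icc 0 1) s‖
        ≤ Real.sqrt (t / t₀) *
          ∫ s in (0:ℝ)..1, Real.sqrt (u (γ s) t₀) * ‖derivWithin γ (Icc 0 1) s‖ := by
  intro t htt _
  set J := {s ∈ Icc (0:ℝ) 1 | ∀ r ∈ Icc t₀ t, (γ s, r) ∈ M} with hJ
  have hJI : J ⊆ Icc 0 1 := fun s hs => hs.1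
  have hJm : MeasurableSet J := by
    obtain ⟨W, hW, hWe⟩ := continuousOn_iff'.1 hγ.continuousOn _ (isOpen_worldlines hRF.opn t₀ t)
    have : J = W ∩ Icc 0 1 := by
      rw [← hWe]
      ext s
      exact and_comm
    rw [this]
    exact hW.measurableSet.inter measurableSet_Icc
  have hcont : ContinuousOn (fun s => Real.sqrt (t / t₀) *
      (Real.sqrt (u (γ s) t₀) * ‖derivWithin γ (Icc 0 1) s‖)) (Icc 0 1) := by
    have h1 : ContinuousOn (fun s => u (γ s) t₀) (Icc 0 1) :=
      hRF.smooth.continuousOn.comp (hγ.continuousOn.prodMk continuousOn_const) hγM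
    have h2 := hγ.continuousOn_derivWithin (uniqueDiffOn_Icc one_pos) le_rfl
    exact continuousOn_const.mul (h1.sqrt.mul h2.norm)
  have hint := hcont.integrableOn_Icc (μ := volume)
  calc _ ≤ ∫ s in J, Real.sqrt (t / t₀) *
        (Real.sqrt (u (γ s) t₀) * ‖derivWithin γ (Icc 0 1) s‖) := by
        refine integral_mono_of_nonneg (.of_forall fun s => by positivity) (hint.mono_set hJI) ?_
        filter_upwards [ae_restrict_mem hJm] with s hs
        rw [← mul_assoc, ← Real.sqrt_mul (div_nonneg (ht₀.1.le.trans htt) ht₀.1.le)]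
        gcongr
        exact hRF.le_div_mul hcomp hid htt hs.2
    _ ≤ ∫ s in Icc (0:ℝ) 1, Real.sqrt (t / t₀) *
        (Real.sqrt (u (γ s) t₀) * ‖derivWithin γ (Icc 0 1) s‖) :=
        setIntegral_mono_set hint (.of_forall fun s => by positivity) hJI.eventuallyLE
    _ = _ := by
        rw [integral_Icc_eq_integral_Ioc, ← intervalIntegral.integral_of_le zero_le_one,
          intervalIntegral.integral_const_mul]
end

section
/- (Vanishing times are constant along compact smooth arcs.) Let T > 0 and let (𝓜, u) be a complete conformal Ricci flow spacetime in the ambient space ℂ × (0,T). Fix t₀ ∈ (0,T) and let γ : [0,1] → ℂ be a smooth map with γ′(s) ≠ 0 and (γ(s),t₀) ∈ 𝓜 for every s ∈ [0,1]. Then the vanishing time T_{(γ(s),t₀)} is independent of s ∈ [0,1]. -/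
open Set MeasureTheory Filter Metric

lemma deriv_deriv_nonpos_of_isLocalMax {f : ℝ → ℝ} {a : ℝ} (h : IsLocalMax f a)
    (hc : ContinuousAt f a) : deriv (deriv f) a ≤ 0 := by
  by_contra! hpos
  have hmin := isLocalMin_of_deriv_deriv_pos hpos h.deriv_eq_zero hc
  have heq : f =ᶠ[nhds a] fun _ => f a := by
    filter_upwards [h, hmin] with x h₁ h₂ using le_antisymm h₁ h₂
  have h0 : deriv (deriv f) a = 0 := by
    rw [heq.deriv.deriv_eq]
    simp
  exact hpos.ne' h0

lemma eventually_deriv_comp_line {E : Type*} [NormedAddCommGroup E] [NormedSpace ℝ E]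
    {F : E → ℝ} {z : E} (hF : ContDiffAt ℝ 2 F z) (v : E) :
    ∀ᶠ s : ℝ in nhds 0, HasDerivAt (fun s : ℝ => F (z + s • v)) (fderiv ℝ F (z + s • v) v) s := by
  have hcont : Tendsto (fun s : ℝ => z + s • v) (nhds 0) (nhds z) := by
    have : Continuous fun s : ℝ => z + s • v := by fun_prop
    simpa using this.tendsto 0
  filter_upwards [hcont.eventually (hF.eventually (by simp))] with s hs
  have h₁ : HasFDerivAt F (fderiv ℝ F (z + s • v)) (z + s • v) :=
    (hs.differentiableAt (by simp)).hasFDerivAt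
  have h₂ : HasDerivAt (fun s : ℝ => z + s • v) v s := by
    simpa using ((hasDerivAt_id s).smul_const v).const_add z
  exact h₁.comp_hasDerivAt s h₂

lemma hasDerivAt_deriv_comp_line {E : Type*} [NormedAddCommGroup E] [NormedSpace ℝ E]
    {F : E → ℝ} {z : E} (hF : ContDiffAt ℝ 2 F z) (v : E) :
    HasDerivAt (deriv (fun s : ℝ => F (z + s • v))) (iteratedFDeriv ℝ 2 F z ![v, v]) 0 := by
  have heq : deriv (fun s : ℝ => F (z + s • v)) =ᶠ[nhds 0] fun s => fderiv ℝ F (z + s • v) v := by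
    filter_upwards [eventually_deriv_comp_line hF v] with s hs using hs.deriv
  refine HasDerivAt.congr_of_eventuallyEq ?_ heq
  have h₁ : HasFDerivAt (fderiv ℝ F) (fderiv ℝ (fderiv ℝ F) z) (z + (0 : ℝ) • v) := by
    rw [zero_smul, add_zero]
    exact ((hF.fderiv_right (m := 1) (by norm_num)).differentiableAt (by simp)).hasFDerivAt
  have h₂ : HasDerivAt (fun s : ℝ => z + s • v) v 0 := by
    simpa using ((hasDerivAt_id (0 : ℝ)).smul_const v).const_add z
  have h₃ : HasDerivAt (fun s : ℝ => fderiv ℝ F (z + s • v)) (fderiv ℝ (fderiv ℝ F) z v) 0 :=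
    HasFDerivAt.comp_hasDerivAt (l := fderiv ℝ F) (f := fun s : ℝ => z + s • v) 0 h₁ h₂
  have h₄ := h₃.clm_apply (hasDerivAt_const (0 : ℝ) v)
  rw [iteratedFDeriv_two_apply]
  simpa using h₄

lemma deriv_deriv_le_of_isLocalMax_add_log {g : ℝ → ℝ} {a b d g₂ : ℝ} (ha : 0 < a)
    (hg : ∀ᶠ s in nhds (0 : ℝ), DifferentiableAt ℝ g s) (hg₂ : HasDerivAt (deriv g) g₂ 0)
    (hmax : IsLocalMax (fun s => g s + Real.log (a - 2 * b * s - d * s ^ 2)) 0) :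
    g₂ ≤ 2 * d / a + 4 * b ^ 2 / a ^ 2 := by
  have hX : ∀ s : ℝ, HasDerivAt (fun s => a - 2 * b * s - d * s ^ 2) (-2 * b - 2 * d * s) s := by
    intro s
    have := (((hasDerivAt_id s).const_mul (2 * b)).const_sub a).sub
      (((hasDerivAt_id s).pow 2).const_mul d)
    convert! this using 1
    simp; ring
  have hXpos : ∀ᶠ s in nhds (0 : ℝ), 0 < a - 2 * b * s - d * s ^ 2 := by
    have : Continuous fun s : ℝ => a - 2 * b * s - d * s ^ 2 := by fun_prop
    exact this.continuousAt.eventually (lt_mem_nhds (by simpa using ha))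
  have hderiv : deriv (fun s => g s + Real.log (a - 2 * b * s - d * s ^ 2)) =ᶠ[nhds 0]
      fun s => deriv g s + (-2 * b - 2 * d * s) / (a - 2 * b * s - d * s ^ 2) := by
    filter_upwards [hg, hXpos] with s hs hs'
    exact (hs.hasDerivAt.add ((hX s).log hs'.ne')).deriv
  have hnum : HasDerivAt (fun s : ℝ => -2 * b - 2 * d * s) (-2 * d) 0 := by
    have := ((hasDerivAt_id (0 : ℝ)).const_mul (2 * d)).const_sub (-2 * b)
    convert! this using 1
    simp
  have hsecond := (hg₂.add (hnum.div (hX 0) (by simpa using ha.ne'))).congr_of_eventuallyEq hderiv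
  have hle := deriv_deriv_nonpos_of_isLocalMax hmax
    ((hg.self_of_nhds.hasDerivAt.add ((hX 0).log (by simpa using ha.ne'))).continuousAt)
  rw [hsecond.deriv] at hle
  have : (-2 * d * (a - 2 * b * 0 - d * 0 ^ 2) - (-2 * b - 2 * d * 0) * (-2 * b - 2 * d * 0)) /
      (a - 2 * b * 0 - d * 0 ^ 2) ^ 2 = -(2 * d / a + 4 * b ^ 2 / a ^ 2) := by
    rw [show a - 2 * b * 0 - d * 0 ^ 2 = a by ring]
    field_simp; ring
  rw [this] at hle
  linarith

/-- Second-order condition at a spatial maximum of `F + log (ρ² - |· - z₀|²)`. -/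
lemma lap_le_of_isLocalMax_add_log {F : ℂ → ℝ} {z z₀ : ℂ} {ρ : ℝ} (hF : ContDiffAt ℝ 2 F z)
    (hz : ‖z - z₀‖ ^ 2 < ρ ^ 2)
    (hmax : IsLocalMax (fun y => F y + Real.log (ρ ^ 2 - ‖y - z₀‖ ^ 2)) z) :
    lap F z ≤ 4 * ρ ^ 2 / (ρ ^ 2 - ‖z - z₀‖ ^ 2) ^ 2 := by
  set a := ρ ^ 2 - ‖z - z₀‖ ^ 2 with ha
  have hapos : 0 < a := sub_pos.2 hz
  have hnorm : ∀ y : ℂ, ‖y‖ ^ 2 = y.re ^ 2 + y.im ^ 2 := fun y => by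
    rw [← Complex.normSq_eq_norm_sq, Complex.normSq_apply]; ring
  have key : ∀ v : ℂ, iteratedFDeriv ℝ 2 F z ![v, v] ≤
      2 * ‖v‖ ^ 2 / a +
        4 * ((z - z₀).re * v.re + (z - z₀).im * v.im) ^ 2 / a ^ 2 := by
    intro v
    refine deriv_deriv_le_of_isLocalMax_add_log hapos
      ((eventually_deriv_comp_line hF v).mono fun s hs => hs.differentiableAt)
      (hasDerivAt_deriv_comp_line hF v) ?_
    have hcont : Continuous fun s : ℝ => z + s • v := by fun_prop
    have hmax' : IsLocalMax (fun y => F y + Real.log (ρ ^ 2 - ‖y - z₀‖ ^ 2))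
        ((fun s : ℝ => z + s • v) 0) := by simpa using hmax
    have := hmax'.comp_continuous (g := fun s : ℝ => z + s • v) (b := 0) hcont.continuousAt
    convert! this using 1
    funext s
    simp only [Function.comp]
    congr 2
    rw [ha, hnorm, hnorm, hnorm]
    simp
    ring
  have h₁ := key 1
  have h₂ := key Complex.I
  simp at h₁ h₂
  have hsum : 2 / a + 4 * (z.re - z₀.re) ^ 2 / a ^ 2 + (2 / a + 4 * (z.im - z₀.im) ^ 2 / a ^ 2) =
      4 * ρ ^ 2 / a ^ 2 := by
    have : ρ ^ 2 = a + ((z.re - z₀.re) ^ 2 + (z.im - z₀.im) ^ 2) := by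
      rw [ha, hnorm]; simp
    rw [this]
    field_simp; ring
  unfold lap
  linarith

lemma deriv_nonneg_of_forall_le_left {h : ℝ → ℝ} {h' s t : ℝ} (hst : s < t)
    (hd : HasDerivAt h h' t) (hle : ∀ r ∈ Icc s t, h r ≤ h t) : 0 ≤ h' := by
  have hmax : IsLocalMaxOn h (Icc s t) t := by
    filter_upwards [self_mem_nhdsWithin] with r hr using hle r hr
  have hcone : s - t ∈ posTangentConeAt (Icc s t) t :=
    sub_mem_posTangentConeAt_of_segment_subset
      ((convex_Icc s t).segment_subset (right_mem_Icc.2 hst.le) (left_mem_Icc.2 hst.le))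
  have := hmax.hasFDerivWithinAt_nonpos hd.hasFDerivAt.hasFDerivWithinAt hcone
  simp at this
  nlinarith

lemma ConfRFS.hasDerivAt_time {T : ℝ} {M : Set (ℂ × ℝ)} {u : ℂ → ℝ → ℝ} (hRF : ConfRFS T M u)
    {z : ℂ} {t : ℝ} (hp : (z, t) ∈ M) :
    HasDerivAt (u z) (lap (fun y => Real.log (u y t)) z) t := by
  have hd : DifferentiableAt ℝ (fun p : ℂ × ℝ => u p.1 p.2) (z, t) :=
    (hRF.smooth.contDiffAt (hRF.opn.mem_nhds hp)).differentiableAt (by simp)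
  have hd' : DifferentiableAt ℝ (u z) t :=
    DifferentiableAt.comp (g := fun p : ℂ × ℝ => u p.1 p.2) t hd
      ((differentiableAt_const z).prodMk differentiableAt_id)
  rw [← hRF.lfde (z, t) hp]
  exact hd'.hasDerivAt

lemma ConfRFS.contDiffAt_log_space {T : ℝ} {M : Set (ℂ × ℝ)} {u : ℂ → ℝ → ℝ}
    (hRF : ConfRFS T M u) {z : ℂ} {t : ℝ} (hp : (z, t) ∈ M) :
    ContDiffAt ℝ 2 (fun y => Real.log (u y t)) z := by
  have hd : ContDiffAt ℝ 2 (fun p : ℂ × ℝ => u p.1 p.2) (z, t) :=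
    (hRF.smooth.contDiffAt (hRF.opn.mem_nhds hp)).of_le
      (WithTop.coe_le_coe.2 (le_top : (2 : ℕ∞) ≤ ⊤))
  have hd' : ContDiffAt ℝ 2 (fun y => u y t) z :=
    ContDiffAt.comp (g := fun p : ℂ × ℝ => u p.1 p.2) z hd (contDiffAt_id.prodMk contDiffAt_const)
  exact hd'.log (ne_of_gt (hRF.pos _ hp))

/-- Interior bound at a space-time maximum of `u (ρ(t)² - |z - z₀|²)` over a domain whose
boundary moves inwards with speed `c`. -/
lemma ConfRFS.le_of_isMax {T : ℝ} {M : Set (ℂ × ℝ)} {u : ℂ → ℝ → ℝ} (hRF : ConfRFS T M u)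
    {z₀ z : ℂ} {r c τ t₁ t : ℝ} (hr : 0 < r) (hc : 0 < c) (ht₁ : t₁ < t) (htτ : t < τ)
    (hp : (z, t) ∈ M) (hz : ‖z - z₀‖ < r + c * (τ - t))
    (hspace : ∀ y, ‖y - z₀‖ ≤ r + c * (τ - t) →
      u y t * ((r + c * (τ - t)) ^ 2 - ‖y - z₀‖ ^ 2) ≤
        u z t * ((r + c * (τ - t)) ^ 2 - ‖z - z₀‖ ^ 2))
    (htime : ∀ s ∈ Icc t₁ t,
      u z s * ((r + c * (τ - s)) ^ 2 - ‖z - z₀‖ ^ 2) ≤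
        u z t * ((r + c * (τ - t)) ^ 2 - ‖z - z₀‖ ^ 2)) :
    u z t * ((r + c * (τ - t)) ^ 2 - ‖z - z₀‖ ^ 2) ≤ 2 * (r + c * (τ - t)) / c := by
  have hρ : 0 < r + c * (τ - t) := by nlinarith [mul_pos hc (sub_pos.2 htτ)]
  have hX : 0 < (r + c * (τ - t)) ^ 2 - ‖z - z₀‖ ^ 2 := by
    nlinarith [norm_nonneg (z - z₀)]
  have hu : 0 < u z t := hRF.pos _ hp
  have hlap : lap (fun y => Real.log (u y t)) z ≤
      4 * (r + c * (τ - t)) ^ 2 / ((r + c * (τ - t)) ^ 2 - ‖z - z₀‖ ^ 2) ^ 2 := by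
    refine lap_le_of_isLocalMax_add_log (hRF.contDiffAt_log_space hp) (by linarith) ?_
    have h₁ : ∀ᶠ y in nhds z, ‖y - z₀‖ < r + c * (τ - t) :=
      (by fun_prop : Continuous fun y : ℂ => ‖y - z₀‖).continuousAt.eventually (gt_mem_nhds hz)
    have h₂ : ∀ᶠ y in nhds z, (y, t) ∈ M :=
      (by fun_prop : Continuous fun y : ℂ => (y, t)).continuousAt.eventually (hRF.opn.mem_nhds hp)
    filter_upwards [h₁, h₂] with y hy hyM
    have hXy : 0 < (r + c * (τ - t)) ^ 2 - ‖y - z₀‖ ^ 2 := by nlinarith [norm_nonneg (y - z₀)]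
    have huy : 0 < u y t := hRF.pos _ hyM
    rw [← Real.log_mul huy.ne' hXy.ne', ← Real.log_mul hu.ne' hX.ne']
    exact Real.log_le_log (mul_pos huy hXy) (hspace y hy.le)
  have hder : HasDerivAt (fun s => u z s * ((r + c * (τ - s)) ^ 2 - ‖z - z₀‖ ^ 2))
      (lap (fun y => Real.log (u y t)) z * ((r + c * (τ - t)) ^ 2 - ‖z - z₀‖ ^ 2) +
        u z t * (2 * (r + c * (τ - t)) * -c)) t := by
    have h₁ : HasDerivAt (fun s => r + c * (τ - s)) (-c) t := by
      simpa using (((hasDerivAt_id t).const_sub τ).const_mul c).const_add r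
    have h₂ := (h₁.pow 2).sub_const (‖z - z₀‖ ^ 2)
    convert! (hRF.hasDerivAt_time hp).mul h₂ using 1
    simp
  have hnonneg := deriv_nonneg_of_forall_le_left ht₁ hder htime
  set ρ := r + c * (τ - t)
  set X := ρ ^ 2 - ‖z - z₀‖ ^ 2
  have h₁ : lap (fun y => Real.log (u y t)) z * X ≤ 4 * ρ ^ 2 / X := by
    calc _ ≤ 4 * ρ ^ 2 / X ^ 2 * X := by gcongr
      _ = _ := by field_simp
  have h₂ : u z t * (2 * ρ * c) ≤ 4 * ρ ^ 2 / X := by linarith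
  rw [le_div_iff₀ hX] at h₂
  rw [le_div_iff₀ hc]
  refine le_of_mul_le_mul_left ?_ (by positivity : 0 < 2 * ρ)
  linarith

/-- On a disc shrinking at positive speed, the conformal factor is bounded by a barrier whose
metric is incomplete at the limiting boundary circle. -/
lemma ConfRFS.exists_barrier {T : ℝ} {M : Set (ℂ × ℝ)} {u : ℂ → ℝ → ℝ} (hRF : ConfRFS T M u)
    {z₀ : ℂ} {r c τ t₁ : ℝ} (hr : 0 < r) (hc : 0 < c) (ht₁ : t₁ < τ)
    (hM : ∀ t ∈ Ico t₁ τ, ∀ z, ‖z - z₀‖ ≤ r + c * (τ - t) → (z, t) ∈ M) :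
    ∃ C : ℝ, ∀ t ∈ Ico t₁ τ, ∀ z, ‖z - z₀‖ ≤ r + c * (τ - t) →
      u z t * ((r + c * (τ - t)) ^ 2 - ‖z - z₀‖ ^ 2) ≤ C := by
  have hucont : ContinuousOn (fun p : ℂ × ℝ => u p.1 p.2) M := hRF.smooth.continuousOn
  let K : ℝ → Set (ℂ × ℝ) := fun t => {p | p.2 ∈ Icc t₁ t ∧ ‖p.1 - z₀‖ ≤ r + c * (τ - p.2)}
  have hKcompact : ∀ t, IsCompact (K t) := by
    intro t
    have hsub : K t ⊆ closedBall z₀ (r + c * (τ - t₁)) ×ˢ Icc t₁ t := by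
      rintro ⟨z, s⟩ ⟨hs, hz⟩
      refine ⟨?_, hs⟩
      rw [mem_closedBall, dist_eq_norm]
      have : c * (τ - s) ≤ c * (τ - t₁) := by gcongr; exact hs.1
      simp only at hz
      linarith
    refine ((isCompact_closedBall _ _).prod isCompact_Icc).of_isClosed_subset ?_ hsub
    exact (isClosed_Icc.preimage continuous_snd).inter
      (isClosed_le (f := fun p : ℂ × ℝ => ‖p.1 - z₀‖) (g := fun p => r + c * (τ - p.2))
        (by fun_prop) (by fun_prop))
  have hKM : ∀ t < τ, K t ⊆ M := fun t ht p hp => hM p.2 ⟨hp.1.1, hp.1.2.trans_lt ht⟩ p.1 hp.2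
  have hcont : ∀ t < τ, ContinuousOn
      (fun p : ℂ × ℝ => u p.1 p.2 * ((r + c * (τ - p.2)) ^ 2 - ‖p.1 - z₀‖ ^ 2)) (K t) := by
    intro t ht
    exact (hucont.mono (hKM t ht)).mul (by fun_prop)
  obtain ⟨C₁, hC₁⟩ := (hKcompact t₁).bddAbove_image (hcont t₁ ht₁)
  refine ⟨max C₁ (2 * (r + c * (τ - t₁)) / c), fun t ht z hz => ?_⟩
  have hne : (K t).Nonempty := ⟨(z, t), right_mem_Icc.2 ht.1, hz⟩
  obtain ⟨⟨y, s⟩, ⟨hs, hy⟩, hmax⟩ := (hKcompact t).exists_isMaxOn hne (hcont t ht.2)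
  simp only at hs hy
  refine (hmax (show (z, t) ∈ K t from ⟨right_mem_Icc.2 ht.1, hz⟩)).trans ?_
  have hsτ : s < τ := hs.2.trans_lt ht.2
  have hρ : 0 < r + c * (τ - s) := by nlinarith [mul_pos hc (sub_pos.2 hsτ)]
  have hρ' : r + c * (τ - s) ≤ r + c * (τ - t₁) := by gcongr; exact hs.1
  rcases hs.1.eq_or_lt with rfl | hs₁
  · exact le_max_of_le_left (hC₁ ⟨(y, t₁), ⟨left_mem_Icc.2 le_rfl, hy⟩, rfl⟩)
  refine le_max_of_le_right ?_
  refine le_trans ?_ (show 2 * (r + c * (τ - s)) / c ≤ _ by gcongr)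
  rcases hy.eq_or_lt with hy' | hy'
  · simp only [hy', sub_self, mul_zero]
    positivity
  refine hRF.le_of_isMax hr hc hs₁ hsτ (hKM t ht.2 ⟨hs, hy⟩) hy' (fun x hx => ?_) fun w hw => ?_
  · exact hmax (show (x, s) ∈ K t from ⟨hs, hx⟩)
  · refine hmax (show (y, w) ∈ K t from ⟨⟨hw.1, hw.2.trans hs.2⟩, hy.trans ?_⟩)
    have : c * (τ - s) ≤ c * (τ - w) := by gcongr; exact hw.2
    simp only
    linarith

lemma exists_contDiff_path_of_isPreconnected {E : Type*} [NormedAddCommGroup E] [NormedSpace ℝ E]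
    {U : Set E} (hU : IsOpen U) (hconn : IsPreconnected U) {x y : E} (hx : x ∈ U) (hy : y ∈ U) :
    ∃ γ : ℝ → E, ContDiff ℝ 1 γ ∧ (∀ s, γ s ∈ U) ∧ (∀ s ≤ 0, γ s = x) ∧ ∀ s ≥ 1, γ s = y := by
  refine hconn.induction₂ (fun x y => ∃ γ : ℝ → E, ContDiff ℝ 1 γ ∧ (∀ s, γ s ∈ U) ∧
    (∀ s ≤ 0, γ s = x) ∧ ∀ s ≥ 1, γ s = y) ?_ ?_ ?_ hx hy
  · intro a ha
    obtain ⟨ε, hε, hball⟩ := Metric.isOpen_iff.1 hU a ha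
    filter_upwards [mem_nhdsWithin_of_mem_nhds (ball_mem_nhds a hε)] with b hb
    refine ⟨fun s => a + Real.smoothTransition s • (b - a), ?_, fun s => hball ?_, ?_, ?_⟩
    · exact contDiff_const.add (Real.smoothTransition.contDiff.smul contDiff_const)
    · exact (convex_ball a ε).add_smul_sub_mem (mem_ball_self hε) hb
        ⟨Real.smoothTransition.nonneg s, Real.smoothTransition.le_one s⟩
    · intro s hs
      simp [Real.smoothTransition.zero_of_nonpos hs]
    · intro s hs
      simp [Real.smoothTransition.one_of_one_le hs]
  · rintro a b c - - - ⟨γ₁, h₁, h₁U, h₁0, h₁1⟩ ⟨γ₂, h₂, h₂U, h₂0, h₂1⟩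
    refine ⟨fun s => γ₁ (2 * s) + γ₂ (2 * s - 1) - b, ?_, fun s => ?_, fun s hs => ?_,
      fun s hs => ?_⟩
    · exact ((h₁.comp (by fun_prop)).add (h₂.comp (by fun_prop))).sub contDiff_const
    · rcases le_total (2 * s) 1 with hs | hs
      · simpa [h₂0 (2 * s - 1) (by linarith)] using h₁U (2 * s)
      · simpa [h₁1 (2 * s) hs] using h₂U (2 * s - 1)
    · simp [h₁0 (2 * s) (by linarith), h₂0 (2 * s - 1) (by linarith)]
    · simp [h₁1 (2 * s) (by linarith), h₂1 (2 * s - 1) (by linarith)]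
  · rintro a b - - ⟨γ, h, hU', h0, h1⟩
    exact ⟨fun s => γ (1 - s), h.comp (by fun_prop), fun s => hU' _,
      fun s hs => h1 _ (by linarith), fun s hs => h0 _ (by linarith)⟩

/-- The lengths whose infimum is `confDist`. -/
def confLengths (v : ℂ → ℝ) (Ω : Set ℂ) (x y : ℂ) : Set ℝ :=
  {L : ℝ | ∃ γ : ℝ → ℂ, ContDiffOn ℝ 1 γ (Icc 0 1) ∧
    (∀ s ∈ Icc (0:ℝ) 1, γ s ∈ Ω) ∧ γ 0 = x ∧ γ 1 = y ∧
    L = ∫ s in (0:ℝ)..1, Real.sqrt (v (γ s)) * ‖derivWithin γ (Icc 0 1) s‖}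

lemma confLengths_nonneg {v : ℂ → ℝ} {Ω : Set ℂ} {x y : ℂ} {L : ℝ}
    (hL : L ∈ confLengths v Ω x y) : 0 ≤ L := by
  obtain ⟨γ, -, -, -, -, rfl⟩ := hL
  exact intervalIntegral.integral_nonneg zero_le_one fun s _ => by positivity

lemma confDist_le_of_path {v : ℂ → ℝ} {Ω : Set ℂ} {x y : ℂ} {γ : ℝ → ℂ} {B : ℝ}
    (hγ : ContDiff ℝ 1 γ) (hΩ : ∀ s ∈ Icc (0:ℝ) 1, γ s ∈ Ω) (h0 : γ 0 = x) (h1 : γ 1 = y)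
    (hB : ∀ s ∈ Icc (0:ℝ) 1, Real.sqrt (v (γ s)) * ‖deriv γ s‖ ≤ B) :
    confDist v Ω x y ≤ B := by
  have hmem : (∫ s in (0:ℝ)..1, Real.sqrt (v (γ s)) * ‖derivWithin γ (Icc 0 1) s‖) ∈
      confLengths v Ω x y := ⟨γ, hγ.contDiffOn, hΩ, h0, h1, rfl⟩
  refine (csInf_le ⟨0, fun L hL => confLengths_nonneg hL⟩ hmem).trans ?_
  refine (le_abs_self _).trans ?_
  have := intervalIntegral.norm_integral_le_of_norm_le_const (a := 0) (b := 1) (C := B)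
    (f := fun s => Real.sqrt (v (γ s)) * ‖derivWithin γ (Icc 0 1) s‖) fun s hs => by
      rw [uIoc_of_le zero_le_one] at hs
      have hs' : s ∈ Icc (0:ℝ) 1 := Ioc_subset_Icc_self hs
      rw [Real.norm_of_nonneg (by positivity),
        ((hγ.differentiable (by simp)) s).derivWithin (uniqueDiffOn_Icc zero_lt_one s hs')]
      exact hB s hs'
  simpa using this

/-- Paths ending at the centre of a Euclidean ball and starting outside of it are long. -/
lemma le_confDist_of_closedBall_subset {v : ℂ → ℝ} {Ω : Set ℂ} {x l : ℂ} {ε m : ℝ}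
    (hv : ContinuousOn v Ω) (hm : 0 ≤ m)
    (hmv : ∀ z ∈ closedBall l ε, m ≤ Real.sqrt (v z)) (hx : ε ≤ ‖x - l‖)
    (hne : (confLengths v Ω x l).Nonempty) :
    m * ε ≤ confDist v Ω x l := by
  refine le_csInf hne ?_
  rintro L ⟨γ, hγ, hΩ, h0, h1, rfl⟩
  have hγc : ContinuousOn γ (Icc 0 1) := hγ.continuousOn
  have hdc : ContinuousOn (fun s => derivWithin γ (Icc 0 1) s) (Icc 0 1) :=
    hγ.continuousOn_derivWithin (uniqueDiffOn_Icc zero_lt_one) (by simp)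
  have hFc : ContinuousOn
      (fun s => Real.sqrt (v (γ s)) * ‖derivWithin γ (Icc 0 1) s‖) (Icc 0 1) :=
    (hv.comp hγc hΩ).sqrt.mul hdc.norm
  let S : Set ℝ := {s ∈ Icc (0:ℝ) 1 | ε ≤ ‖γ s - l‖}
  have hSc : IsCompact S := by
    have hcl : IsClosed S := by
      exact ((hγc.sub (continuousOn_const (c := l))).norm).preimage_isClosed_of_isClosed
        isClosed_Icc (isClosed_Ici (a := ε))
    exact isCompact_Icc.of_isClosed_subset hcl fun s hs => hs.1
  obtain ⟨a, ⟨haI, haε⟩, hamax⟩ := hSc.exists_isGreatest ⟨0, ⟨by simp, by rwa [h0]⟩⟩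
  have hsub : Icc a 1 ⊆ Icc 0 1 := Icc_subset_Icc_left haI.1
  have hball : ∀ s ∈ Ioc a 1, γ s ∈ closedBall l ε := by
    intro s hs
    by_contra hs'
    rw [mem_closedBall, dist_eq_norm, not_le] at hs'
    exact (hamax ⟨hsub (Ioc_subset_Icc_self hs), hs'.le⟩).not_gt hs.1
  have hint : ∀ f : ℝ → ℝ, ContinuousOn f (Icc 0 1) → ∀ b ∈ Icc (0:ℝ) 1, ∀ d ∈ Icc (0:ℝ) 1,
      IntervalIntegrable f volume b d := by
    intro f hf b hb d hd
    exact (hf.mono (ordConnected_Icc.uIcc_subset hb hd)).intervalIntegrable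
  have h0I : (0:ℝ) ∈ Icc (0:ℝ) 1 := by simp
  have h1I : (1:ℝ) ∈ Icc (0:ℝ) 1 := by simp
  have hftc : ∫ s in a..1, derivWithin γ (Icc 0 1) s = γ 1 - γ a := by
    refine intervalIntegral.integral_eq_sub_of_hasDerivAt_of_le haI.2 (hγc.mono hsub) ?_ ?_
    · intro s hs
      have hs' : s ∈ Ioo (0:ℝ) 1 := ⟨haI.1.trans_lt hs.1, hs.2⟩
      exact ((hγ.differentiableOn (by simp)) s (Ioo_subset_Icc_self hs')).hasDerivWithinAt.hasDerivAt
        (Icc_mem_nhds hs'.1 hs'.2)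
    · exact (hdc.mono (ordConnected_Icc.uIcc_subset haI h1I)).intervalIntegrable
  calc m * ε ≤ m * ‖γ 1 - γ a‖ := by
        rw [h1, norm_sub_rev]; gcongr
    _ = m * ‖∫ s in a..1, derivWithin γ (Icc 0 1) s‖ := by rw [hftc]
    _ ≤ m * ∫ s in a..1, ‖derivWithin γ (Icc 0 1) s‖ := by
        gcongr
        exact intervalIntegral.norm_integral_le_integral_norm haI.2
    _ = ∫ s in a..1, m * ‖derivWithin γ (Icc 0 1) s‖ := by
        rw [intervalIntegral.integral_const_mul]
    _ ≤ ∫ s in a..1, Real.sqrt (v (γ s)) * ‖derivWithin γ (Icc 0 1) s‖ := by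
        refine intervalIntegral.integral_mono_on_of_le_Ioo haI.2
          ((hint _ hdc.norm a haI 1 h1I).const_mul m) (hint _ hFc a haI 1 h1I) fun s hs => ?_
        gcongr
        exact hmv _ (hball s ⟨hs.1, hs.2.le⟩)
    _ ≤ ∫ s in (0:ℝ)..1, Real.sqrt (v (γ s)) * ‖derivWithin γ (Icc 0 1) s‖ := by
        rw [← intervalIntegral.integral_add_adjacent_intervals (hint _ hFc 0 h0I a haI)
          (hint _ hFc a haI 1 h1I)]
        refine le_add_of_nonneg_left (intervalIntegral.integral_nonneg haI.1 fun s _ => ?_)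
        positivity

/-- If `v|dz|²` is complete on an open set `Ω`, then `v` cannot be bounded by
`C / (1 - s)` along a segment from `z₀ ∈ Ω` to a point `q ∉ Ω`. -/
lemma ConfComplete.mem_of_le_along_segment {v : ℂ → ℝ} {Ω : Set ℂ} (hcomp : ConfComplete v Ω)
    (hΩ : IsOpen Ω) (hv : ContinuousOn v Ω) (hpos : ∀ z ∈ Ω, 0 < v z) {z₀ q : ℂ} {C : ℝ}
    (hseg : ∀ y ∈ Ioc (0:ℝ) 1, q + (y ^ 2 : ℝ) • (z₀ - q) ∈ Ω)
    (hC : ∀ y ∈ Ioc (0:ℝ) 1, v (q + (y ^ 2 : ℝ) • (z₀ - q)) * y ^ 2 ≤ C) : q ∈ Ω := by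
  by_contra hq
  set ζ : ℝ → ℂ := fun y => q + (y ^ 2 : ℝ) • (z₀ - q) with hζ
  have hζc : Continuous ζ := by fun_prop
  have hζd : ∀ y, HasDerivAt ζ ((2 * y) • (z₀ - q)) y := by
    intro y
    have := (((hasDerivAt_id y).pow 2).smul_const (z₀ - q)).const_add q
    convert! this using 1
    simp
  set B := 2 * Real.sqrt C * ‖z₀ - q‖ with hB
  have hdist : ∀ a ∈ Ioc (0:ℝ) 1, ∀ b ∈ Ioc (0:ℝ) 1,
      confDist v Ω (ζ a) (ζ b) ≤ B * |b - a| := by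
    intro a ha b hb
    have hmem : ∀ s ∈ Icc (0:ℝ) 1, a + s * (b - a) ∈ Ioc (0:ℝ) 1 := fun s hs => by
      simpa using (convex_Ioc (0:ℝ) 1).add_smul_sub_mem ha hb hs
    refine confDist_le_of_path (γ := fun s => ζ (a + s * (b - a))) (by fun_prop)
      (fun s hs => hseg _ (hmem s hs)) (by simp) (by simp) fun s hs => ?_
    have hd : HasDerivAt (fun s => ζ (a + s * (b - a)))
        ((b - a) • (2 * (a + s * (b - a))) • (z₀ - q)) s := by
      have h₂ : HasDerivAt (fun s => a + s * (b - a)) (b - a) s := by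
        simpa using ((hasDerivAt_id s).mul_const (b - a)).const_add a
      exact HasDerivAt.scomp s (hζd _) h₂
    rw [hd.deriv]
    set y := a + s * (b - a)
    have hy : y ∈ Ioc (0:ℝ) 1 := hmem s hs
    have hsqrt : Real.sqrt (v (ζ y)) * y ≤ Real.sqrt C := by
      calc Real.sqrt (v (ζ y)) * y = Real.sqrt (v (ζ y) * y ^ 2) := by
            rw [Real.sqrt_mul (hpos _ (hseg y hy)).le, Real.sqrt_sq hy.1.le]
        _ ≤ Real.sqrt C := Real.sqrt_le_sqrt (hC y hy)
    rw [norm_smul, norm_smul, Real.norm_eq_abs, Real.norm_of_nonneg (by linarith [hy.1])]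
    calc _ = (Real.sqrt (v (ζ y)) * y) * (2 * ‖z₀ - q‖ * |b - a|) := by ring
      _ ≤ Real.sqrt C * (2 * ‖z₀ - q‖ * |b - a|) := by gcongr
      _ = _ := by rw [hB]; ring
  have hB0 : 0 ≤ B := by positivity
  set y : ℕ → ℝ := fun n => 1 / ((n : ℝ) + 1) with hy
  have hyI : ∀ n, y n ∈ Ioc (0:ℝ) 1 := fun n =>
    ⟨by positivity, by rw [hy]; simp only; rw [div_le_one (by positivity)]; simp⟩
  have hylim : Tendsto y atTop (nhds 0) := tendsto_one_div_add_atTop_nhds_zero_nat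
  have hcompo : ∀ n, ζ (y n) ∈ connectedComponentIn Ω (ζ 1) := by
    have hsub : ζ '' Ioc 0 1 ⊆ connectedComponentIn Ω (ζ 1) :=
      (isPreconnected_Ioc.image ζ hζc.continuousOn).subset_connectedComponentIn
        ⟨1, by simp, rfl⟩ (by rintro _ ⟨s, hs, rfl⟩; exact hseg s hs)
    exact fun n => hsub ⟨y n, hyI n, rfl⟩
  obtain ⟨l, hl, hlim⟩ := hcomp (ζ 1) (hseg 1 (by simp)) (fun n => ζ (y n)) hcompo (by
    intro ε hε
    obtain ⟨N, hN⟩ := Metric.cauchySeq_iff.1 hylim.cauchySeq (ε / (B + 1)) (by positivity)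
    refine ⟨N, fun m hm n hn => (hdist _ (hyI m) _ (hyI n)).trans_lt ?_⟩
    have h := hN n hn m hm
    rw [Real.dist_eq, lt_div_iff₀ (by positivity)] at h
    nlinarith [abs_nonneg (y n - y m)])
  have hlΩ : l ∈ Ω := connectedComponentIn_subset _ _ hl
  obtain ⟨ε, hε, hball⟩ := Metric.nhds_basis_closedBall.mem_iff.1 (hΩ.mem_nhds hlΩ)
  obtain ⟨w, hw, hwmin⟩ := (isCompact_closedBall l ε).exists_isMinOn
    ⟨l, mem_closedBall_self hε.le⟩ (hv.mono hball)
  set m := Real.sqrt (v w) with hm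
  have hm0 : 0 < m := Real.sqrt_pos.2 (hpos w (hball hw))
  have hqε : ε < ‖q - l‖ := by
    by_contra! h
    exact hq (hball (by rwa [mem_closedBall, dist_eq_norm]))
  have hfar : ∀ᶠ n in atTop, ε < ‖ζ (y n) - l‖ := by
    have h₁ : Tendsto (fun n => ‖ζ (y n) - l‖) atTop (nhds ‖ζ 0 - l‖) :=
      (((hζc.tendsto 0).comp hylim).sub_const l).norm
    exact h₁.eventually (lt_mem_nhds (by simpa [hζ] using hqε))
  obtain ⟨n, hn₁, hn₂⟩ := (hfar.and (hlim.eventually (gt_mem_nhds (mul_pos hm0 hε)))).exists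
  have hne : (confLengths v Ω (ζ (y n)) l).Nonempty := by
    obtain ⟨γ, hγ, hγU, hγ0, hγ1⟩ := exists_contDiff_path_of_isPreconnected
      hΩ.connectedComponentIn isPreconnected_connectedComponentIn (hcompo n) hl
    exact ⟨_, γ, hγ.contDiffOn, fun s _ => connectedComponentIn_subset _ _ (hγU s),
      hγ0 0 le_rfl, hγ1 1 le_rfl, rfl⟩
  exact hn₂.not_ge (le_confDist_of_closedBall_subset hv hm0.le
    (fun z hz => Real.sqrt_le_sqrt (hwmin hz)) hn₁.le hne)

/-- A point cannot vanish at the moment a disc, shrinking at positive speed inside the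
spacetime, reaches it. -/
lemma ConfRFS.mem_of_shrinking_disc {T : ℝ} {M : Set (ℂ × ℝ)} {u : ℂ → ℝ → ℝ}
    (hRF : ConfRFS T M u) (hcomp : ConfRFSComplete T M u) {z₀ q : ℂ} {c τ t₁ : ℝ}
    (hτ : τ ∈ Ioo 0 T) (hq : q ≠ z₀) (hc : 0 < c) (ht₁ : t₁ < τ)
    (hM : ∀ t ∈ Ico t₁ τ, ∀ z, ‖z - z₀‖ ≤ ‖q - z₀‖ + c * (τ - t) → (z, t) ∈ M)
    (hMτ : ∀ z, ‖z - z₀‖ < ‖q - z₀‖ → (z, τ) ∈ M) : (q, τ) ∈ M := by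
  have hr : 0 < ‖q - z₀‖ := norm_pos_iff.2 (sub_ne_zero.2 hq)
  obtain ⟨C, hC⟩ := hRF.exists_barrier hr hc ht₁ hM
  have hbound : ∀ z, ‖z - z₀‖ < ‖q - z₀‖ → u z τ * (‖q - z₀‖ ^ 2 - ‖z - z₀‖ ^ 2) ≤ C := by
    intro z hz
    have hcont : ContinuousAt (u z) τ := (hRF.hasDerivAt_time (hMτ z hz)).continuousAt
    have hlim : Tendsto (fun t => u z t * ((‖q - z₀‖ + c * (τ - t)) ^ 2 - ‖z - z₀‖ ^ 2))
        (nhdsWithin τ (Iio τ)) (nhds (u z τ * (‖q - z₀‖ ^ 2 - ‖z - z₀‖ ^ 2))) := by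
      have h₁ : ContinuousAt
          (fun t => u z t * ((‖q - z₀‖ + c * (τ - t)) ^ 2 - ‖z - z₀‖ ^ 2)) τ :=
        hcont.mul (by fun_prop)
      have h₂ := h₁.tendsto
      simp only [sub_self, mul_zero, add_zero] at h₂
      exact h₂.mono_left nhdsWithin_le_nhds
    refine le_of_tendsto hlim ?_
    filter_upwards [Ico_mem_nhdsLT ht₁] with t ht
    refine hC t ht z (hz.le.trans ?_)
    nlinarith [mul_pos hc (sub_pos.2 ht.2)]
  have hopen : IsOpen (timeSlice M τ) := hRF.opn.preimage (by fun_prop : Continuous fun z => (z, τ))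
  have hnorm : ∀ y ∈ Ioc (0:ℝ) 1,
      ‖q + (y ^ 2 : ℝ) • (z₀ - q) - z₀‖ = (1 - y ^ 2) * ‖q - z₀‖ := by
    intro y hy
    have : q + (y ^ 2 : ℝ) • (z₀ - q) - z₀ = (1 - y ^ 2 : ℝ) • (q - z₀) := by module
    rw [this, norm_smul, Real.norm_of_nonneg (by nlinarith [hy.1, hy.2])]
  have hlt : ∀ y ∈ Ioc (0:ℝ) 1, ‖q + (y ^ 2 : ℝ) • (z₀ - q) - z₀‖ < ‖q - z₀‖ := by
    intro y hy
    rw [hnorm y hy]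
    nlinarith [mul_pos (pow_pos hy.1 2) hr]
  refine (hcomp τ hτ).mem_of_le_along_segment (Ω := timeSlice M τ) (z₀ := z₀) (q := q)
    (C := C / ‖q - z₀‖ ^ 2) hopen ?_ (fun z hz => hRF.pos _ hz) (fun y hy => hMτ _ (hlt y hy)) ?_
  · intro z hz
    exact (ContinuousAt.comp (g := fun p : ℂ × ℝ => u p.1 p.2) (f := fun z => (z, τ))
      (hRF.smooth.continuousOn.continuousAt (hRF.opn.mem_nhds hz))
      (by fun_prop)).continuousWithinAt
  · intro y hy
    have h₁ := hbound _ (hlt y hy)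
    have hu := hRF.pos _ (hMτ _ (hlt y hy))
    simp only at hu
    rw [le_div_iff₀ (by positivity)]
    refine le_trans ?_ h₁
    rw [hnorm y hy, mul_assoc]
    refine mul_le_mul_of_nonneg_left ?_ hu.le
    have hy2 : y ^ 2 ≤ 1 := by nlinarith [hy.1, hy.2]
    have : y ^ 2 ≤ 1 - (1 - y ^ 2) ^ 2 := by nlinarith [sq_nonneg y]
    nlinarith [mul_le_mul_of_nonneg_right this (sq_nonneg ‖q - z₀‖)]

section VanishTime

variable {M : Set (ℂ × ℝ)} {z : ℂ} {T t t₀ : ℝ}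

lemma mem_of_mem_worldline (ht : t ∈ connectedComponentIn {r : ℝ | (z, r) ∈ M} t₀) :
    (z, t) ∈ M :=
  connectedComponentIn_subset {r : ℝ | (z, r) ∈ M} t₀ ht

lemma bddAbove_worldline (hsub : M ⊆ {p : ℂ × ℝ | p.2 ∈ Ioo 0 T}) :
    BddAbove (connectedComponentIn {r : ℝ | (z, r) ∈ M} t₀) :=
  ⟨T, fun _ hr => (hsub (mem_of_mem_worldline hr)).2.le⟩

lemma vanishTime_le (hsub : M ⊆ {p : ℂ × ℝ | p.2 ∈ Ioo 0 T}) (hz : (z, t₀) ∈ M) :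
    vanishTime M z t₀ ≤ T :=
  csSup_le ⟨t₀, mem_connectedComponentIn (F := {r : ℝ | (z, r) ∈ M}) hz⟩
    fun _ hr => (hsub (mem_of_mem_worldline hr)).2.le

lemma lt_vanishTime (hopn : IsOpen M) (hsub : M ⊆ {p : ℂ × ℝ | p.2 ∈ Ioo 0 T}) (ht : t₀ ≤ t)
    (hz : ∀ r ∈ Icc t₀ t, (z, r) ∈ M) : t < vanishTime M z t₀ := by
  have hS : IsOpen {r : ℝ | (z, r) ∈ M} := hopn.preimage (by fun_prop : Continuous fun r => (z, r))
  have hmem : t ∈ connectedComponentIn {r : ℝ | (z, r) ∈ M} t₀ :=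
    isPreconnected_Icc.subset_connectedComponentIn (left_mem_Icc.2 ht) hz (right_mem_Icc.2 ht)
  obtain ⟨b, hb, hsubset⟩ := exists_Ico_subset_of_mem_nhds
    (hS.connectedComponentIn.mem_nhds hmem) (exists_gt t)
  have hmid : (t + b) / 2 ∈ Ico t b := ⟨by linarith, by linarith⟩
  exact (by linarith : t < (t + b) / 2).trans_le
    (le_csSup (bddAbove_worldline hsub) (hsubset hmid))

lemma mem_of_lt_vanishTime (hz : (z, t₀) ∈ M) (ht : t₀ ≤ t) (h : t < vanishTime M z t₀) :
    (z, t) ∈ M := by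
  obtain ⟨b, hb, htb⟩ := exists_lt_of_lt_csSup
    ⟨t₀, mem_connectedComponentIn (F := {r : ℝ | (z, r) ∈ M}) hz⟩ h
  exact mem_of_mem_worldline (isPreconnected_connectedComponentIn.ordConnected.out
    (mem_connectedComponentIn (F := {r : ℝ | (z, r) ∈ M}) hz) hb ⟨ht, htb.le⟩)

lemma vanishTime_notMem (hopn : IsOpen M) (hsub : M ⊆ {p : ℂ × ℝ | p.2 ∈ Ioo 0 T})
    (hz : (z, t₀) ∈ M) : (z, vanishTime M z t₀) ∉ M := by
  intro hmem
  have h₀ : t₀ < vanishTime M z t₀ :=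
    lt_vanishTime hopn hsub le_rfl fun r hr => by
      rw [Icc_self] at hr
      rwa [hr]
  refine (lt_vanishTime hopn hsub h₀.le fun r hr => ?_).false
  rcases hr.2.eq_or_lt with rfl | hlt
  · exact hmem
  · exact mem_of_lt_vanishTime hz hr.1 hlt

lemma lowerSemicontinuousOn_vanishTime (hopn : IsOpen M)
    (hsub : M ⊆ {p : ℂ × ℝ | p.2 ∈ Ioo 0 T}) :
    LowerSemicontinuousOn (fun z => vanishTime M z t₀) (timeSlice M t₀) := by
  intro z hz a ha
  have h₀ : t₀ < vanishTime M z t₀ :=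
    lt_vanishTime hopn hsub le_rfl fun r hr => by
      rw [Icc_self] at hr
      rwa [hr]
  obtain ⟨b, hab, hbv⟩ := exists_between (max_lt ha h₀)
  have hsubset : ({z} : Set ℂ) ×ˢ Icc t₀ b ⊆ M := by
    rintro ⟨w, r⟩ ⟨rfl, hr⟩
    exact mem_of_lt_vanishTime hz hr.1 (hr.2.trans_lt hbv)
  obtain ⟨U, V, hU, -, hzU, hV, hUV⟩ :=
    generalized_tube_lemma isCompact_singleton isCompact_Icc hopn hsubset
  filter_upwards [mem_nhdsWithin_of_mem_nhds (hU.mem_nhds (hzU rfl))] with w hw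
  exact ((le_max_left _ _).trans_lt hab).trans (lt_vanishTime hopn hsub
    ((le_max_right _ _).trans hab.le) fun r hr => hUV ⟨hw, hV hr⟩)

end VanishTime

/-- The vanishing time cannot be touched from below, away from `z₀`, by a strictly decreasing
function of the distance to `z₀`. -/
lemma ConfRFS.eq_centre_of_touching {T : ℝ} {M : Set (ℂ × ℝ)} {u : ℂ → ℝ → ℝ}
    (hRF : ConfRFS T M u) (hcomp : ConfRFSComplete T M u) {t₀ : ℝ} (ht₀ : t₀ ∈ Ioo 0 T)
    {z₀ q : ℂ} {k R R' : ℝ} (hk : 0 < k) (hR : R' < R)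
    (hball : closedBall z₀ R' ⊆ timeSlice M t₀) (hq : ‖q - z₀‖ < R')
    (hmin : ∀ z, ‖z - z₀‖ ≤ R' → vanishTime M q t₀ + k / (R - ‖q - z₀‖) ≤
      vanishTime M z t₀ + k / (R - ‖z - z₀‖)) : q = z₀ := by
  by_contra hne
  set r := ‖q - z₀‖ with hr
  set τ := vanishTime M q t₀ with hτ
  have hr0 : 0 < r := norm_pos_iff.2 (sub_ne_zero.2 hne)
  have hslice : ∀ z, ‖z - z₀‖ ≤ R' → (z, t₀) ∈ M := fun z hz =>
    hball (by rwa [mem_closedBall, dist_eq_norm])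
  have hqM : (q, t₀) ∈ M := hslice q hq.le
  have hτ₀ : t₀ < τ := lt_vanishTime hRF.opn hRF.sub le_rfl fun s hs => by
    rw [Icc_self] at hs
    rwa [hs]
  have hinner : ∀ z, ‖z - z₀‖ < r → τ < vanishTime M z t₀ := by
    intro z hz
    have h₁ := hmin z (hz.le.trans hq.le)
    have h₂ : k / (R - ‖z - z₀‖) < k / (R - r) :=
      div_lt_div_of_pos_left hk (by linarith) (by linarith)
    linarith
  have hτT : τ < T := (hinner z₀ (by simpa using hr0)).trans_le
    (vanishTime_le hRF.sub (hslice z₀ (by simpa using (hr0.trans hq).le)))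
  set δ := min ((R - r) / 2) (R' - r) with hδ
  have hδ0 : 0 < δ := lt_min (by linarith) (by linarith)
  set c := (R - r) ^ 2 / (4 * k) with hc
  have hRr : 0 < R - r := by linarith
  have hc0 : 0 < c := by positivity
  have ht₁ : max t₀ (τ - δ / c) < τ := max_lt hτ₀ (by linarith [div_pos hδ0 hc0])
  refine vanishTime_notMem hRF.opn hRF.sub hqM (hRF.mem_of_shrinking_disc hcomp
    ⟨ht₀.1.trans hτ₀, hτT⟩ hne hc0 ht₁ ?_ ?_)
  · intro t ht z hz
    have htt₀ : t₀ ≤ t := (le_max_left _ _).trans ht.1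
    have hcδ : c * (τ - t) ≤ δ := by
      have : τ - t ≤ δ / c := by linarith [(le_max_right t₀ (τ - δ / c)).trans ht.1]
      rwa [le_div_iff₀ hc0, mul_comm] at this
    have hd₁ : δ ≤ (R - r) / 2 := min_le_left _ _
    have hd₂ : δ ≤ R' - r := min_le_right _ _
    have hzR' : ‖z - z₀‖ ≤ R' := by linarith
    refine mem_of_lt_vanishTime (hslice z hzR') htt₀ ?_
    rcases lt_or_ge ‖z - z₀‖ r with hlt | hge
    · exact ht.2.trans (hinner z hlt)
    have hz2 : (R - r) / 2 ≤ R - ‖z - z₀‖ := by linarith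
    have hzpos : 0 < R - ‖z - z₀‖ := by linarith
    have hdiff : k / (R - ‖z - z₀‖) - k / (R - r) ≤ (τ - t) / 2 := by
      rw [div_sub_div _ _ hzpos.ne' hRr.ne', div_le_iff₀ (by positivity)]
      have h₁ : k * (‖z - z₀‖ - r) ≤ k * (c * (τ - t)) := by gcongr; linarith
      have h₂ : k * (c * (τ - t)) = (R - r) ^ 2 / 4 * (τ - t) := by
        rw [hc]; field_simp
      have h₃ : (R - r) ^ 2 / 2 ≤ (R - ‖z - z₀‖) * (R - r) := by nlinarith
      have h₄ := mul_le_mul_of_nonneg_left h₃ (by linarith [ht.2] : 0 ≤ (τ - t) / 2)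
      nlinarith
    linarith [hmin z hzR', ht.2]
  · intro z hz
    exact mem_of_lt_vanishTime (hslice z (hz.le.trans hq.le)) hτ₀.le (hinner z hz)

lemma ConfRFS.vanishTime_le_of_mem_ball {T : ℝ} {M : Set (ℂ × ℝ)} {u : ℂ → ℝ → ℝ}
    (hRF : ConfRFS T M u) (hcomp : ConfRFSComplete T M u) {t₀ : ℝ} (ht₀ : t₀ ∈ Ioo 0 T)
    {z₀ z : ℂ} {R : ℝ} (hball : ball z₀ R ⊆ timeSlice M t₀) (hz : z ∈ ball z₀ R) :
    vanishTime M z₀ t₀ ≤ vanishTime M z t₀ := by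
  have hzR : ‖z - z₀‖ < R := by rwa [mem_ball, dist_eq_norm] at hz
  have hR : 0 < R := (norm_nonneg _).trans_lt hzR
  have hz₀ : (z₀, t₀) ∈ M := hball (mem_ball_self hR)
  have key : ∀ k > 0, vanishTime M z₀ t₀ + k / R ≤ vanishTime M z t₀ + k / (R - ‖z - z₀‖) := by
    intro k hk
    -- The penalty term exceeds `T + k / R` on the boundary circle.
    obtain ⟨R', ⟨hzR', hR'0⟩, hR'R, hpen⟩ : ∃ R', (‖z - z₀‖ ≤ R' ∧ 0 ≤ R') ∧ R' < R ∧
        T + k / R < k / (R - R') := by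
      have hT : 0 < T := ht₀.1.trans ht₀.2
      have hd : 0 < k / (T + k / R + 1) := by positivity
      refine ⟨max ‖z - z₀‖ (R - k / (T + k / R + 1)), ⟨le_max_left _ _,
        (norm_nonneg _).trans (le_max_left _ _)⟩, max_lt hzR (by linarith), ?_⟩
      rw [lt_div_iff₀ (by linarith [max_lt hzR (by linarith : R - k / (T + k / R + 1) < R)])]
      have h₁ : R - max ‖z - z₀‖ (R - k / (T + k / R + 1)) ≤ k / (T + k / R + 1) := by
        linarith [le_max_right ‖z - z₀‖ (R - k / (T + k / R + 1))]
      calc (T + k / R) * (R - max ‖z - z₀‖ (R - k / (T + k / R + 1)))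
          ≤ (T + k / R) * (k / (T + k / R + 1)) := by gcongr
        _ < k := by
            rw [mul_div_assoc', div_lt_iff₀ (by positivity)]
            nlinarith
    have hsub : closedBall z₀ R' ⊆ timeSlice M t₀ := (closedBall_subset_ball hR'R).trans hball
    have hlsc : LowerSemicontinuousOn
        (fun y => vanishTime M y t₀ + k / (R - ‖y - z₀‖)) (closedBall z₀ R') := by
      refine ((lowerSemicontinuousOn_vanishTime hRF.opn hRF.sub).mono hsub).add
        (ContinuousOn.lowerSemicontinuousOn ?_)
      refine continuousOn_const.div (by fun_prop) fun y hy => ?_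
      rw [mem_closedBall, dist_eq_norm] at hy
      linarith
    obtain ⟨q, hq, hqmin⟩ := hlsc.exists_isMinOn ⟨z₀, mem_closedBall_self hR'0⟩
      (isCompact_closedBall z₀ R')
    have hmin : ∀ y, ‖y - z₀‖ ≤ R' → vanishTime M q t₀ + k / (R - ‖q - z₀‖) ≤
        vanishTime M y t₀ + k / (R - ‖y - z₀‖) := fun y hy =>
      hqmin (by rwa [mem_closedBall, dist_eq_norm])
    have hqR' : ‖q - z₀‖ < R' := by
      rw [mem_closedBall, dist_eq_norm] at hq
      refine lt_of_le_of_ne hq fun h => ?_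
      have h₁ := hmin z₀ (by simpa using hR'0)
      have h₂ := vanishTime_le hRF.sub hz₀
      have h₃ : t₀ < vanishTime M q t₀ := lt_vanishTime hRF.opn hRF.sub le_rfl fun s hs => by
        rw [Icc_self] at hs
        rw [hs]
        exact hsub (by rwa [mem_closedBall, dist_eq_norm])
      rw [h] at h₁
      simp only [sub_self, norm_zero, sub_zero] at h₁
      linarith [ht₀.1]
    have hqz := hRF.eq_centre_of_touching hcomp ht₀ hk hR'R hsub hqR' hmin
    simpa [hqz] using hmin z hzR'
  have hlim : Tendsto (fun k : ℝ => vanishTime M z t₀ + k / (R - ‖z - z₀‖))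
      (nhdsWithin 0 (Ioi 0)) (nhds (vanishTime M z t₀)) := by
    have : Continuous fun k : ℝ => vanishTime M z t₀ + k / (R - ‖z - z₀‖) := by fun_prop
    simpa using (this.tendsto 0).mono_left nhdsWithin_le_nhds
  refine ge_of_tendsto hlim ?_
  filter_upwards [self_mem_nhdsWithin] with k hk
  have := key k hk
  have : 0 < k / R := div_pos hk hR
  linarith

lemma ConfRFS.eventually_vanishTime_eq {T : ℝ} {M : Set (ℂ × ℝ)} {u : ℂ → ℝ → ℝ}
    (hRF : ConfRFS T M u) (hcomp : ConfRFSComplete T M u) {t₀ : ℝ} (ht₀ : t₀ ∈ Ioo 0 T)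
    {z₀ : ℂ} (hz₀ : (z₀, t₀) ∈ M) :
    ∀ᶠ z in nhds z₀, vanishTime M z t₀ = vanishTime M z₀ t₀ := by
  have hopen : IsOpen (timeSlice M t₀) :=
    hRF.opn.preimage (by fun_prop : Continuous fun z => (z, t₀))
  obtain ⟨R, hR, hball⟩ := Metric.isOpen_iff.1 hopen z₀ hz₀
  filter_upwards [ball_mem_nhds z₀ (half_pos hR)] with z hz
  refine le_antisymm (hRF.vanishTime_le_of_mem_ball hcomp ht₀ (R := R / 2) ?_ ?_)
    (hRF.vanishTime_le_of_mem_ball hcomp ht₀ hball (ball_subset_ball (by linarith) hz))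
  · refine (ball_subset_ball' ?_).trans hball
    linarith [mem_ball.1 hz]
  · rwa [mem_ball_comm]

/-- Vanishing times are constant along compact smooth arcs. -/
theorem vanishTime_const_on_arc
    (T : ℝ) (hT : 0 < T) (M : Set (ℂ × ℝ)) (u : ℂ → ℝ → ℝ)
    (hRF : ConfRFS T M u) (hcomp : ConfRFSComplete T M u)
    (t₀ : ℝ) (ht₀ : t₀ ∈ Ioo (0:ℝ) T)
    (γ : ℝ → ℂ) (hγ : ContDiffOn ℝ (⊤ : ℕ∞) γ (Icc 0 1))
    (hγ' : ∀ s ∈ Icc (0:ℝ) 1, derivWithin γ (Icc 0 1) s ≠ 0)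
    (hγM : ∀ s ∈ Icc (0:ℝ) 1, (γ s, t₀) ∈ M) :
    ∀ s ∈ Icc (0:ℝ) 1, ∀ s' ∈ Icc (0:ℝ) 1,
      vanishTime M (γ s) t₀ = vanishTime M (γ s') t₀ := by
  intro s hs s' hs'
  refine isPreconnected_Icc.induction₂
    (fun a b => vanishTime M (γ a) t₀ = vanishTime M (γ b) t₀) (fun a ha => ?_)
    (fun _ _ _ _ _ _ h₁ h₂ => h₁.trans h₂) (fun _ _ _ _ h => h.symm) hs hs'
  filter_upwards [(hγ.continuousOn a ha).eventually
    (hRF.eventually_vanishTime_eq hcomp ht₀ (hγM a ha))] with b hb using hb.symm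
end
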